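/- For every positive natural number n there exists a constant C > 0, depending only on n, such that the following holds. Let R > 0, T > 0, let B̄_R denote the closed ball of radius R centered at the origin in ℝⁿ, and let u : [0,T] × B̄_R → ℝ be everywhere positive, twice continuously differentiable in the space variable and once continuously differentiable in the time variable, satisfying the heat equation ∂_t u = Δu on (0,T] × B̄_R. Then for every real α > 1 and every (t, x) ∈ (0,T] × B̄_{R/2}: ‖∇u(t,x)‖²/u(t,x)² - α · ∂_t u(t,x)/u(t,x) ≤ n·α²/(2t) + (C·α²/R²)·(1 + α²/(α-1)). -/

import Mathlib

open MeasureTheory Real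
open scoped BigOperators RealInnerProductSpace

noncomputable section

/-- The Euclidean Laplacian `Δf(x) = Σᵢ ∂²f/∂xᵢ²(x)` of `f : ℝⁿ → ℝ`. -/
def lap {n : ℕ} (f : EuclideanSpace ℝ (Fin n) → ℝ) (x : EuclideanSpace ℝ (Fin n)) : ℝ :=
  ∑ i : Fin n,
    fderiv ℝ (fun y => fderiv ℝ f y (EuclideanSpace.single i 1)) x (EuclideanSpace.single i 1)

open Set Filter Topology Metric

/-- Euclidean space of dimension `n`. -/
abbrev Euc (n : ℕ) : Type := EuclideanSpace ℝ (Fin n)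

/-- The `i`-th standard basis vector. -/
abbrev basisVec {n : ℕ} (i : Fin n) : Euc n := EuclideanSpace.single i 1

/-- `g` has second derivative `q` at `x` along the line through `x` with direction `e`. -/
def HasSecondLineDeriv {n : ℕ} (g : Euc n → ℝ) (x e : Euc n) (q : ℝ) : Prop :=
  ∃ p : ℝ → ℝ, (∀ᶠ r in 𝓝 (0 : ℝ), HasDerivAt (fun r : ℝ => g (x + r • e)) (p r) r) ∧
    HasDerivAt p q 0

/-- `g` has second derivatives along the coordinate lines at `x`, with sum `L`. -/
def HasLapAt {n : ℕ} (g : Euc n → ℝ) (x : Euc n) (L : ℝ) : Prop :=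
  ∃ q : Fin n → ℝ, (∀ i, HasSecondLineDeriv g x (basisVec i) (q i)) ∧ ∑ i, q i = L

lemma HasSecondLineDeriv.sub {n : ℕ} {g h : Euc n → ℝ} {x e : Euc n} {a b : ℝ}
    (hg : HasSecondLineDeriv g x e a) (hh : HasSecondLineDeriv h x e b) :
    HasSecondLineDeriv (fun y => g y - h y) x e (a - b) := by
  obtain ⟨p, hp, hp'⟩ := hg
  obtain ⟨q, hq, hq'⟩ := hh
  exact ⟨fun r => p r - q r, by filter_upwards [hp, hq] with r h1 h2 using h1.sub h2, hp'.sub hq'⟩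

lemma HasSecondLineDeriv.const {n : ℕ} (c : ℝ) (x e : Euc n) :
    HasSecondLineDeriv (fun _ => c) x e 0 :=
  ⟨fun _ => 0, Eventually.of_forall fun r => hasDerivAt_const r c, hasDerivAt_const _ _⟩

lemma HasSecondLineDeriv.unique {n : ℕ} {g : Euc n → ℝ} {x e : Euc n} {a b : ℝ}
    (h1 : HasSecondLineDeriv g x e a) (h2 : HasSecondLineDeriv g x e b) : a = b := by
  obtain ⟨p, hp, hp'⟩ := h1
  obtain ⟨q, hq, hq'⟩ := h2
  have : p =ᶠ[𝓝 0] q := by filter_upwards [hp, hq] with r h1 h2 using h1.unique h2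
  exact (hp'.congr_of_eventuallyEq this.symm).unique hq'

lemma HasLapAt.sub {n : ℕ} {g h : Euc n → ℝ} {x : Euc n} {a b : ℝ}
    (hg : HasLapAt g x a) (hh : HasLapAt h x b) :
    HasLapAt (fun y => g y - h y) x (a - b) := by
  obtain ⟨p, hp, rfl⟩ := hg
  obtain ⟨q, hq, rfl⟩ := hh
  exact ⟨fun i => p i - q i, fun i => (hp i).sub (hq i), by simp⟩

lemma HasLapAt.const {n : ℕ} (c : ℝ) (x : Euc n) : HasLapAt (fun _ => c) x 0 :=
  ⟨fun _ => 0, fun _ => HasSecondLineDeriv.const c x _, by simp⟩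

lemma HasLapAt.unique {n : ℕ} {g : Euc n → ℝ} {x : Euc n} {a b : ℝ}
    (h1 : HasLapAt g x a) (h2 : HasLapAt g x b) : a = b := by
  obtain ⟨p, hp, rfl⟩ := h1
  obtain ⟨q, hq, rfl⟩ := h2
  exact Finset.sum_congr rfl fun i _ => (hp i).unique (hq i)

lemma HasSecondLineDeriv.nonpos_of_isLocalMax {n : ℕ} {g : Euc n → ℝ} {x e : Euc n} {a : ℝ}
    (h : HasSecondLineDeriv g x e a) (hx : IsLocalMax g x) : a ≤ 0 := by
  obtain ⟨p, hp, hp'⟩ := h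
  by_contra! ha
  set l : ℝ → ℝ := fun r => g (x + r • e) with hl
  have hcl : ContinuousAt (fun r : ℝ => x + r • e) 0 := by fun_prop
  have hmax : IsLocalMax l 0 := by
    have : Tendsto (fun r : ℝ => x + r • e) (𝓝 0) (𝓝 x) := by simpa using hcl.tendsto
    have h2 := this.eventually hx
    simpa [IsLocalMax, IsMaxFilter, hl] using h2
  have hd : deriv l =ᶠ[𝓝 0] p := by filter_upwards [hp] with r hr using hr.deriv
  have hd0 : deriv l 0 = 0 := hmax.deriv_eq_zero
  have hdd : deriv (deriv l) 0 = a := by rw [hd.deriv_eq]; exact hp'.deriv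
  have hmin : IsLocalMin l 0 :=
    isLocalMin_of_deriv_deriv_pos (by rw [hdd]; exact ha) hd0 hp.self_of_nhds.continuousAt
  have hconst : l =ᶠ[𝓝 0] fun _ => l 0 := by
    filter_upwards [hmin, hmax] with r h1 h2 using le_antisymm h2 h1
  have h3 : deriv l =ᶠ[𝓝 0] fun _ => 0 := by
    filter_upwards [hconst.eventuallyEq_nhds] with r hr
    rw [hr.deriv_eq]; simp
  rw [h3.deriv_eq] at hdd
  simp at hdd
  linarith

lemma HasLapAt.nonpos_of_isLocalMax {n : ℕ} {g : Euc n → ℝ} {x : Euc n} {L : ℝ}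
    (h : HasLapAt g x L) (hx : IsLocalMax g x) : L ≤ 0 := by
  obtain ⟨q, hq, rfl⟩ := h
  exact Finset.sum_nonpos fun i _ => (hq i).nonpos_of_isLocalMax hx

lemma hasDerivAt_line {n : ℕ} {g : Euc n → ℝ} {x e : Euc n} {r : ℝ}
    (hg : DifferentiableAt ℝ g (x + r • e)) :
    HasDerivAt (fun r : ℝ => g (x + r • e)) (fderiv ℝ g (x + r • e) e) r := by
  have h1 : HasDerivAt (fun r : ℝ => x + r • e) e r := by
    simpa using ((hasDerivAt_id r).smul_const e).const_add x
  exact hg.hasFDerivAt.comp_hasDerivAt r h1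

lemma ContDiffAt.hasSecondLineDeriv {n : ℕ} {g : Euc n → ℝ} {x : Euc n}
    (hg : ContDiffAt ℝ 2 g x) (e : Euc n) :
    HasSecondLineDeriv g x e (fderiv ℝ (fun y => fderiv ℝ g y e) x e) := by
  have hcl : Tendsto (fun r : ℝ => x + r • e) (𝓝 0) (𝓝 x) := by
    have : ContinuousAt (fun r : ℝ => x + r • e) 0 := by fun_prop
    simpa using this.tendsto
  refine ⟨fun r => fderiv ℝ g (x + r • e) e, ?_, ?_⟩
  · have h1 : ∀ᶠ y in 𝓝 x, ContDiffAt ℝ 2 g y := hg.eventually (by simp)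
    filter_upwards [hcl.eventually h1] with r hr
    exact hasDerivAt_line (hr.differentiableAt (by norm_num))
  · have h2 : ContDiffAt ℝ 1 (fderiv ℝ g) x := hg.fderiv_right (by norm_num)
    have h3 : DifferentiableAt ℝ (fun y => fderiv ℝ g y e) (x + (0 : ℝ) • e) := by
      simpa using (h2.differentiableAt (by norm_num)).clm_apply (differentiableAt_const e)
    simpa using hasDerivAt_line h3

lemma ContDiffAt.hasLapAt {n : ℕ} {g : Euc n → ℝ} {x : Euc n}
    (hg : ContDiffAt ℝ 2 g x) : HasLapAt g x (lap g x) :=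
  ⟨_, fun i => hg.hasSecondLineDeriv (basisVec i), rfl⟩

/-- Differentiation under the integral sign against an integrable function supported in a
compact set. -/
lemma hasDerivAt_integral_mul_of_support {n : ℕ} {f : Euc n → ℝ} {S : Set (Euc n)}
    (hS : IsCompact S) (hf : Integrable f) (hfS : ∀ y ∉ S, f y = 0)
    {K K' : ℝ → Euc n → ℝ} {r₀ δ : ℝ} (hδ : 0 < δ)
    (hK : ∀ r ∈ ball r₀ δ, ∀ y, HasDerivAt (fun r => K r y) (K' r y) r)
    (hKc : ∀ r ∈ ball r₀ δ, Continuous (K r))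
    (hK' : ContinuousOn (fun p : ℝ × Euc n => K' p.1 p.2) (ball r₀ δ ×ˢ univ)) :
    HasDerivAt (fun r => ∫ y, K r y * f y) (∫ y, K' r₀ y * f y) r₀ := by
  have hcomp : IsCompact (closedBall r₀ (δ / 2) ×ˢ S) := (isCompact_closedBall _ _).prod hS
  have hsub : closedBall r₀ (δ / 2) ⊆ ball r₀ δ := closedBall_subset_ball (by linarith)
  obtain ⟨M, hM⟩ := hcomp.exists_bound_of_continuousOn
    (hK'.mono (prod_mono hsub (subset_univ _)))
  have hr₀ : r₀ ∈ ball r₀ δ := mem_ball_self hδ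
  have hK'c : Continuous (K' r₀) := by
    have : ContinuousOn (fun y => K' r₀ y) univ :=
      hK'.comp (f := fun y => (r₀, y)) (by fun_prop) (fun y _ => ⟨hr₀, mem_univ _⟩)
    simpa [continuousOn_univ] using this
  have hinteg : Integrable (fun y => K r₀ y * f y) := by
    obtain ⟨M', hM'⟩ := hS.exists_bound_of_continuousOn (hKc r₀ hr₀).continuousOn
    refine (hf.norm.const_mul M').mono' ((hKc r₀ hr₀).aestronglyMeasurable.mul hf.1)
      (Eventually.of_forall fun y => ?_)
    by_cases hy : y ∈ S
    · rw [norm_mul]; exact mul_le_mul_of_nonneg_right (hM' y hy) (norm_nonneg _)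
    · simp [hfS y hy]
  refine (hasDerivAt_integral_of_dominated_loc_of_deriv_le
    (s := ball r₀ (δ / 2)) (bound := fun y => M * ‖f y‖)
    (F := fun r y => K r y * f y) (F' := fun r y => K' r y * f y)
    (ball_mem_nhds _ (by linarith)) ?_ hinteg (hK'c.aestronglyMeasurable.mul hf.1) ?_
    (hf.norm.const_mul M) ?_).2
  · filter_upwards [ball_mem_nhds r₀ hδ] with r hr
    exact (hKc r hr).aestronglyMeasurable.mul hf.1
  · refine Eventually.of_forall fun y r hr => ?_
    by_cases hy : y ∈ S
    · rw [norm_mul]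
      exact mul_le_mul_of_nonneg_right (hM (r, y) ⟨ball_subset_closedBall hr, hy⟩) (norm_nonneg _)
    · simp [hfS y hy]
  · refine Eventually.of_forall fun y r hr => ?_
    exact (hK r (hsub (ball_subset_closedBall hr)) y).mul_const _

/-- The heat kernel at time `s` and distance `r`. -/
def heatKer (n : ℕ) (s r : ℝ) : ℝ := (4 * π * s) ^ (-(n : ℝ) / 2) * exp (-r ^ 2 / (4 * s))

lemma heatKer_pos (n : ℕ) {s : ℝ} (hs : 0 < s) (r : ℝ) : 0 < heatKer n s r := by
  unfold heatKer; positivity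

lemma integral_heatKer {n : ℕ} {s : ℝ} (hs : 0 < s) : ∫ z : Euc n, heatKer n s ‖z‖ = 1 := by
  have h := GaussianFourier.integral_rexp_neg_mul_sq_norm (V := Euc n) (b := 1 / (4 * s))
    (by positivity)
  have h2 : ∀ z : Euc n, heatKer n s ‖z‖
      = (4 * π * s) ^ (-(n : ℝ) / 2) * exp (-(1 / (4 * s)) * ‖z‖ ^ 2) := by
    intro z; unfold heatKer; congr 2; ring
  simp_rw [h2]
  rw [integral_const_mul, h]
  simp only [finrank_euclideanSpace, Fintype.card_fin]
  have : π / (1 / (4 * s)) = 4 * π * s := by field_simp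
  rw [this, ← Real.rpow_add (by positivity)]
  ring_nf; simp

lemma integrable_heatKer {n : ℕ} {s : ℝ} (hs : 0 < s) :
    Integrable (fun z : Euc n => heatKer n s ‖z‖) := by
  by_contra h
  have := integral_undef h
  rw [integral_heatKer hs] at this
  exact one_ne_zero this

lemma continuous_heatKer_norm (n : ℕ) (s : ℝ) : Continuous fun z : Euc n => heatKer n s ‖z‖ := by
  unfold heatKer; fun_prop

/-- The heat extension of `f`, i.e. the solution of the heat equation with initial value `f`. -/
def heatExt {n : ℕ} (f : Euc n → ℝ) (s : ℝ) (x : Euc n) : ℝ :=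
  ∫ z : Euc n, heatKer n 1 ‖z‖ * f (x + √s • z)

lemma heatExt_zero {n : ℕ} (f : Euc n → ℝ) (x : Euc n) : heatExt f 0 x = f x := by
  simp [heatExt, integral_mul_const, integral_heatKer]

lemma heatExt_nonneg {n : ℕ} {f : Euc n → ℝ} (hf : ∀ y, 0 ≤ f y) (s : ℝ) (x : Euc n) :
    0 ≤ heatExt f s x :=
  integral_nonneg fun _ => mul_nonneg (heatKer_pos n one_pos _).le (hf _)

lemma heatKer_scale (n : ℕ) {s : ℝ} (hs : 0 < s) (r : ℝ) :
    heatKer n s r = (√s ^ n)⁻¹ * heatKer n 1 ((√s)⁻¹ * r) := by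
  unfold heatKer
  have h1 : (√s ^ n)⁻¹ = s ^ (-(n : ℝ) / 2) := by
    rw [neg_div, Real.rpow_neg hs.le, Real.sqrt_eq_rpow, ← Real.rpow_natCast, ← Real.rpow_mul hs.le]
    congr 2; ring
  rw [h1, Real.mul_rpow (by positivity) hs.le, mul_pow, inv_pow, Real.sq_sqrt hs.le, mul_one]
  have : -((s)⁻¹ * r ^ 2) / (4 * 1) = -r ^ 2 / (4 * s) := by field_simp
  rw [this]; ring

lemma heatExt_eq_kernel {n : ℕ} (f : Euc n → ℝ) {s : ℝ} (hs : 0 < s) (x : Euc n) :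
    heatExt f s x = ∫ y, heatKer n s ‖y - x‖ * f y := by
  have hq : 0 < √s := Real.sqrt_pos.2 hs
  rw [← integral_add_right_eq_self (μ := (volume : Measure (Euc n))) _ x]
  have h := Measure.integral_comp_smul (volume : Measure (Euc n))
    (fun z : Euc n => heatKer n 1 ‖(√s)⁻¹ • z‖ * f (x + z)) (√s)
  have h1 : ∀ z : Euc n, (√s)⁻¹ • (√s) • z = z := fun z => by
    rw [smul_smul, inv_mul_cancel₀ hq.ne', one_smul]
  simp only [h1, finrank_euclideanSpace, Fintype.card_fin] at h
  unfold heatExt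
  rw [h, abs_of_nonneg (by positivity), smul_eq_mul, ← integral_const_mul]
  congr 1; ext y
  rw [heatKer_scale n hs, add_sub_cancel_right, norm_smul, norm_inv, Real.norm_of_nonneg hq.le,
    add_comm y x]
  ring

lemma continuous_heatExt {n : ℕ} {f : Euc n → ℝ} (hf : Continuous f) {M : ℝ}
    (hM : ∀ y, |f y| ≤ M) : Continuous fun p : ℝ × Euc n => heatExt f p.1 p.2 := by
  unfold heatExt
  refine continuous_of_dominated (bound := fun z => heatKer n 1 ‖z‖ * M) ?_ ?_ ?_ ?_
  · intro p
    have := continuous_heatKer_norm n 1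
    exact (this.mul (by fun_prop)).aestronglyMeasurable
  · refine fun p => Eventually.of_forall fun z => ?_
    rw [norm_mul, Real.norm_of_nonneg (heatKer_pos n one_pos _).le]
    exact mul_le_mul_of_nonneg_left (hM _) (heatKer_pos n one_pos _).le
  · exact (integrable_heatKer one_pos).mul_const _
  · exact Eventually.of_forall fun z => by fun_prop

lemma abs_heatExt_le {n : ℕ} {f : Euc n → ℝ} {M : ℝ}
    (hM : ∀ y, |f y| ≤ M) (s : ℝ) (x : Euc n) : |heatExt f s x| ≤ M := by
  unfold heatExt
  have h := norm_integral_le_of_norm_le (f := fun z : Euc n => heatKer n 1 ‖z‖ * f (x + √s • z))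
    (g := fun z => heatKer n 1 ‖z‖ * M) ((integrable_heatKer one_pos).mul_const _)
    (Eventually.of_forall fun z => by
      rw [norm_mul, Real.norm_of_nonneg (heatKer_pos n one_pos _).le]
      exact mul_le_mul_of_nonneg_left (hM _) (heatKer_pos n one_pos _).le)
  rwa [integral_mul_const, integral_heatKer one_pos, one_mul] at h

lemma heatKer_le (n : ℕ) {s : ℝ} (hs : 0 < s) (r : ℝ) :
    heatKer n s r ≤ (4 * π * s) ^ (-(n : ℝ) / 2) := by
  unfold heatKer
  refine mul_le_of_le_one_right (by positivity) (exp_le_one_iff.2 ?_)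
  rw [neg_div]; exact neg_nonpos.2 (by positivity)

lemma heatKer_anti (n : ℕ) {s : ℝ} (hs : 0 < s) {r r' : ℝ} (hr : 0 ≤ r) (h : r ≤ r') :
    heatKer n s r' ≤ heatKer n s r := by
  unfold heatKer
  gcongr

lemma integrable_heatKer_mul {n : ℕ} {f : Euc n → ℝ} (hf : Integrable f) {s : ℝ} (hs : 0 < s)
    (x : Euc n) : Integrable fun y => heatKer n s ‖y - x‖ * f y := by
  refine (hf.norm.const_mul ((4 * π * s) ^ (-(n : ℝ) / 2))).mono' ?_
    (Eventually.of_forall fun y => ?_)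
  · exact (((continuous_heatKer_norm n s).comp (continuous_id.sub continuous_const))
      ).aestronglyMeasurable.mul hf.1
  · rw [norm_mul, Real.norm_of_nonneg (heatKer_pos n hs _).le]
    exact mul_le_mul_of_nonneg_right (heatKer_le n hs _) (norm_nonneg _)

lemma heatExt_le_mass {n : ℕ} {f : Euc n → ℝ} (hf : Integrable f) (h0 : ∀ y, 0 ≤ f y) {s : ℝ}
    (hs : 0 < s) (x : Euc n) :
    heatExt f s x ≤ (4 * π * s) ^ (-(n : ℝ) / 2) * ∫ y, f y := by
  rw [heatExt_eq_kernel f hs, ← integral_const_mul]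
  exact integral_mono (integrable_heatKer_mul hf hs x) (hf.const_mul _)
    fun y => mul_le_mul_of_nonneg_right (heatKer_le n hs _) (h0 y)

lemma hasDerivAt_heatKer_time (n : ℕ) {s : ℝ} (hs : 0 < s) (r : ℝ) :
    HasDerivAt (fun s => heatKer n s r)
      (heatKer n s r * (r ^ 2 / (4 * s ^ 2) - n / (2 * s))) s := by
  unfold heatKer
  have h1 : HasDerivAt (fun s : ℝ => 4 * π * s) (4 * π) s := by
    simpa using (hasDerivAt_id s).const_mul (4 * π)
  have h2 := h1.rpow_const (p := -(n : ℝ) / 2) (Or.inl (by positivity))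
  have h3 : HasDerivAt (fun s : ℝ => -r ^ 2 / (4 * s)) (r ^ 2 / (4 * s ^ 2)) s := by
    have := ((hasDerivAt_id s).const_mul 4).inv (by simpa using hs.ne')
    have h := this.const_mul (-r ^ 2)
    refine h.congr_deriv ?_ |>.congr_of_eventuallyEq ?_
    · simp; field_simp
    · exact Eventually.of_forall fun s => by simp [div_eq_mul_inv]
  refine (h2.mul h3.exp).congr_deriv ?_
  rw [Real.rpow_sub_one (by positivity)]
  field_simp
  ring

lemma norm_sub_line_sq {n : ℕ} (y x : Euc n) (i : Fin n) (r : ℝ) :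
    ‖y - (x + r • basisVec i)‖ ^ 2 = ‖y - x‖ ^ 2 - 2 * r * (y - x) i + r ^ 2 := by
  rw [← sub_sub, norm_sub_sq_real, inner_smul_right, norm_smul]
  simp [EuclideanSpace.inner_single_right]
  ring

lemma hasDerivAt_heatKer_line {n : ℕ} (s : ℝ) (y x : Euc n) (i : Fin n) (r : ℝ) :
    HasDerivAt (fun r : ℝ => heatKer n s ‖y - (x + r • basisVec i)‖)
      (heatKer n s ‖y - (x + r • basisVec i)‖ * (((y - x) i - r) / (2 * s))) r := by
  unfold heatKer
  simp_rw [norm_sub_line_sq]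
  have h : HasDerivAt (fun r : ℝ => -(‖y - x‖ ^ 2 - 2 * r * (y - x) i + r ^ 2) / (4 * s))
      (((y - x) i - r) / (2 * s)) r := by
    have h1 : HasDerivAt (fun r : ℝ => -(‖y - x‖ ^ 2 - 2 * r * (y - x) i + r ^ 2))
        (2 * (y - x) i - 2 * r) r := by
      have a := ((hasDerivAt_id r).const_mul 2).mul_const ((y - x) i)
      have b := (hasDerivAt_id r).pow 2
      refine ((a.const_sub (‖y - x‖ ^ 2)).add b).neg.congr_deriv ?_
      simp; ring
    refine (h1.div_const (4 * s)).congr_deriv ?_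
    by_cases hs : s = 0
    · simp [hs]
    · field_simp; ring
  refine (h.exp.const_mul _).congr_deriv ?_
  ring

lemma hasDerivAt_heatKer_line_two {n : ℕ} (s : ℝ) (y x : Euc n) (i : Fin n) (r : ℝ) :
    HasDerivAt (fun r : ℝ => heatKer n s ‖y - (x + r • basisVec i)‖ * (((y - x) i - r) / (2 * s)))
      (heatKer n s ‖y - (x + r • basisVec i)‖ *
        ((((y - x) i - r) / (2 * s)) ^ 2 - 1 / (2 * s))) r := by
  have h2 : HasDerivAt (fun r : ℝ => ((y - x) i - r) / (2 * s)) (-1 / (2 * s)) r :=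
    ((hasDerivAt_id r).const_sub _).div_const _
  refine ((hasDerivAt_heatKer_line s y x i r).mul h2).congr_deriv ?_
  ring

/-- The heat extension of an integrable compactly supported function solves the heat equation. -/
lemma heatExt_heat_eq {n : ℕ} {f : Euc n → ℝ} {S : Set (Euc n)}
    (hS : IsCompact S) (hf : Integrable f) (hfS : ∀ y ∉ S, f y = 0) {s : ℝ} (hs : 0 < s)
    (x : Euc n) :
    ∃ L, HasDerivAt (fun s => heatExt f s x) L s ∧ HasLapAt (heatExt f s) x L := by
  have hker : heatExt f s = fun x => ∫ y, heatKer n s ‖y - x‖ * f y :=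
    funext fun x => heatExt_eq_kernel f hs x
  refine ⟨∫ y, heatKer n s ‖y - x‖ * (‖y - x‖ ^ 2 / (4 * s ^ 2) - n / (2 * s)) * f y, ?_, ?_⟩
  · have h := hasDerivAt_integral_mul_of_support hS hf hfS (r₀ := s) hs
      (K := fun s y => heatKer n s ‖y - x‖)
      (K' := fun s y => heatKer n s ‖y - x‖ * (‖y - x‖ ^ 2 / (4 * s ^ 2) - n / (2 * s))) ?_ ?_ ?_
    · refine h.congr_of_eventuallyEq ?_
      filter_upwards [lt_mem_nhds hs] with r hr using heatExt_eq_kernel f hr x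
    · intro r hr y
      have : 0 < r := by rw [Real.ball_eq_Ioo] at hr; simpa using hr.1
      exact hasDerivAt_heatKer_time n this _
    · intro r hr
      exact (continuous_heatKer_norm n r).comp (continuous_id.sub continuous_const)
    · intro p hp
      have hp0 : 0 < p.1 := by have := hp.1; rw [Real.ball_eq_Ioo] at this; simpa using this.1
      apply ContinuousAt.continuousWithinAt
      unfold heatKer
      have h1 : 4 * π * p.1 ≠ 0 := by positivity
      have h2 : 4 * p.1 ≠ 0 := by positivity
      have h3 : 4 * p.1 ^ 2 ≠ 0 := by positivity
      have h4 : 2 * p.1 ≠ 0 := by positivity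
      fun_prop (disch := first | assumption | exact Or.inl h1)
  · refine ⟨fun i => ∫ y, heatKer n s ‖y - x‖ *
      ((((y - x) i) / (2 * s)) ^ 2 - 1 / (2 * s)) * f y, fun i => ?_, ?_⟩
    · rw [hker]
      refine ⟨fun r => ∫ y, heatKer n s ‖y - (x + r • basisVec i)‖ *
        (((y - x) i - r) / (2 * s)) * f y, Eventually.of_forall fun r => ?_, ?_⟩
      · refine hasDerivAt_integral_mul_of_support hS hf hfS one_pos
          (fun r _ y => hasDerivAt_heatKer_line s y x i r) ?_ ?_
        · intro r _
          exact (continuous_heatKer_norm n s).comp (continuous_id.sub continuous_const)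
        · have hc : Continuous fun p : ℝ × Euc n =>
              heatKer n s ‖p.2 - (x + p.1 • basisVec i)‖ :=
            (continuous_heatKer_norm n s).comp (by fun_prop)
          exact (hc.mul (by fun_prop)).continuousOn
      · have h := hasDerivAt_integral_mul_of_support hS hf hfS (r₀ := 0) one_pos
          (fun r _ y => hasDerivAt_heatKer_line_two s y x i r) ?_ ?_
        · simpa using h
        · intro r _
          have hc : Continuous fun y : Euc n => heatKer n s ‖y - (x + r • basisVec i)‖ :=
            (continuous_heatKer_norm n s).comp (by fun_prop)
          exact hc.mul (by fun_prop)
        · have hc : Continuous fun p : ℝ × Euc n =>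
              heatKer n s ‖p.2 - (x + p.1 • basisVec i)‖ :=
            (continuous_heatKer_norm n s).comp (by fun_prop)
          exact (hc.mul (by fun_prop)).continuousOn
    · rw [← integral_finsetSum]
      · congr 1; ext y
        rw [← Finset.sum_mul, ← Finset.mul_sum, Finset.sum_sub_distrib]
        simp only [div_pow]
        rw [← Finset.sum_div, EuclideanSpace.norm_sq_eq]
        simp
        left; left
        rw [mul_pow]; norm_num
        field_simp
      · intro i _
        have hc : Continuous fun y : Euc n => heatKer n s ‖y - x‖ *
            ((((y - x) i) / (2 * s)) ^ 2 - 1 / (2 * s)) :=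
          ((continuous_heatKer_norm n s).comp (by fun_prop)).mul (by fun_prop)
        obtain ⟨M', hM'⟩ := hS.exists_bound_of_continuousOn hc.continuousOn
        refine (hf.norm.const_mul M').mono' (hc.aestronglyMeasurable.mul hf.1)
          (Eventually.of_forall fun y => ?_)
        by_cases hy : y ∈ S
        · rw [norm_mul]; exact mul_le_mul_of_nonneg_right (hM' y hy) (norm_nonneg _)
        · simp [hfS y hy]

/-- An upper bound for the mass of the heat kernel at time `h` at distance at least `3 * ρ / 8`. -/
def gaussTail (n : ℕ) (h ρ : ℝ) : ℝ := 2 ^ ((n : ℝ) / 2) * exp (-ρ ^ 2 / (64 * h))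

lemma gaussTail_pos (n : ℕ) (h ρ : ℝ) : 0 < gaussTail n h ρ := by unfold gaussTail; positivity

lemma heatKer_eq_double (n : ℕ) {s : ℝ} (hs : 0 < s) (r : ℝ) :
    heatKer n s r = 2 ^ ((n : ℝ) / 2) * exp (-r ^ 2 / (8 * s)) * heatKer n (2 * s) r := by
  unfold heatKer
  have h1 : (4 * π * (2 * s)) ^ (-(n : ℝ) / 2)
      = 2 ^ (-((n : ℝ) / 2)) * (4 * π * s) ^ (-(n : ℝ) / 2) := by
    rw [show 4 * π * (2 * s) = 2 * (4 * π * s) by ring,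
      Real.mul_rpow (by positivity) (by positivity), neg_div]
  have h2 : exp (-r ^ 2 / (4 * s)) = exp (-r ^ 2 / (8 * s)) * exp (-r ^ 2 / (4 * (2 * s))) := by
    rw [← Real.exp_add]; congr 1; field_simp; ring
  rw [h1, h2, Real.rpow_neg (by positivity)]
  have : (2 : ℝ) ^ ((n : ℝ) / 2) ≠ 0 := by positivity
  field_simp

lemma heatKer_le_gaussTail_mul (n : ℕ) {h ρ r : ℝ} (hh : 0 < h) (hρ : 0 ≤ ρ) (hr : 3 * ρ / 8 ≤ r) :
    heatKer n h r ≤ gaussTail n h ρ * heatKer n (2 * h) r := by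
  rw [heatKer_eq_double n hh]
  refine mul_le_mul_of_nonneg_right ?_ (heatKer_pos n (by positivity) r).le
  unfold gaussTail
  gcongr 2 ^ ((n : ℝ) / 2) * exp ?_
  rw [div_le_div_iff₀ (by positivity) (by positivity)]
  have : (3 * ρ / 8) ^ 2 ≤ r ^ 2 := by gcongr
  nlinarith [mul_le_mul_of_nonneg_left this hh.le, mul_nonneg hh.le (sq_nonneg ρ)]

lemma heatKer_half_le_gaussTail_mul (n : ℕ) {h ρ r : ℝ} (hh : 0 < h) (hr0 : 0 ≤ r)
    (hr : r ≤ ρ / 2) :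
    heatKer n h (ρ / 2) ≤ gaussTail n h ρ * heatKer n (2 * h) r := by
  refine (heatKer_le_gaussTail_mul n hh (by linarith) (by linarith)).trans ?_
  exact mul_le_mul_of_nonneg_left (heatKer_anti n (by positivity) hr0 hr) (gaussTail_pos n h ρ).le

lemma integral_heatKer_sub {n : ℕ} {s : ℝ} (hs : 0 < s) (c : Euc n) :
    ∫ y : Euc n, heatKer n s ‖y - c‖ = 1 := by
  rw [integral_sub_right_eq_self (fun y : Euc n => heatKer n s ‖y‖) c, integral_heatKer hs]

lemma integrable_heatKer_sub {n : ℕ} {s : ℝ} (hs : 0 < s) (c : Euc n) :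
    Integrable fun y : Euc n => heatKer n s ‖y - c‖ :=
  (integrable_heatKer hs).comp_sub_right c

lemma abs_integral_heatKer_mul_le_tail {n : ℕ} {g : Euc n → ℝ} {M h ρ : ℝ} {c : Euc n}
    (hh : 0 < h) (hρ : 0 ≤ ρ) (hM : ∀ y, |g y| ≤ M) (hg : ∀ y, ‖y - c‖ < 3 * ρ / 8 → g y = 0) :
    |∫ y, heatKer n h ‖y - c‖ * g y| ≤ M * gaussTail n h ρ := by
  have hM0 : 0 ≤ M := (abs_nonneg _).trans (hM 0)
  have h2h : 0 < 2 * h := by positivity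
  have := norm_integral_le_of_norm_le (f := fun y => heatKer n h ‖y - c‖ * g y)
    (g := fun y => M * gaussTail n h ρ * heatKer n (2 * h) ‖y - c‖)
    ((integrable_heatKer_sub h2h c).const_mul _) (Eventually.of_forall fun y => ?_)
  · rwa [integral_const_mul, integral_heatKer_sub h2h, mul_one] at this
  · by_cases hy : ‖y - c‖ < 3 * ρ / 8
    · rw [hg y hy]
      have := heatKer_pos n h2h ‖y - c‖
      have := gaussTail_pos n h ρ
      simp; positivity
    · rw [norm_mul, Real.norm_of_nonneg (heatKer_pos n hh _).le, Real.norm_eq_abs, mul_comm,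
        mul_assoc]
      push Not at hy
      exact mul_le_mul (hM y) (heatKer_le_gaussTail_mul n hh hρ hy) (heatKer_pos n hh _).le hM0

lemma heatKer_half_mul_integral_le_tail {n : ℕ} {g : Euc n → ℝ} {M h ρ : ℝ} {c : Euc n}
    (hh : 0 < h) (hM : ∀ y, |g y| ≤ M) (hg : ∀ y, ρ / 2 < ‖y - c‖ → g y = 0) :
    |heatKer n h (ρ / 2) * ∫ y, g y| ≤ M * gaussTail n h ρ := by
  have hM0 : 0 ≤ M := (abs_nonneg _).trans (hM 0)
  have h2h : 0 < 2 * h := by positivity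
  have := norm_integral_le_of_norm_le (f := fun y => heatKer n h (ρ / 2) * g y)
    (g := fun y => M * gaussTail n h ρ * heatKer n (2 * h) ‖y - c‖)
    ((integrable_heatKer_sub h2h c).const_mul _) (Eventually.of_forall fun y => ?_)
  · rwa [integral_const_mul, integral_const_mul, integral_heatKer_sub h2h, mul_one] at this
  · by_cases hy : ρ / 2 < ‖y - c‖
    · rw [hg y hy]
      have := heatKer_pos n h2h ‖y - c‖
      have := gaussTail_pos n h ρ
      simp; positivity
    · rw [norm_mul, Real.norm_of_nonneg (heatKer_pos n hh _).le, Real.norm_eq_abs, mul_comm,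
        mul_assoc]
      push Not at hy
      exact mul_le_mul (hM y) (heatKer_half_le_gaussTail_mul n hh (norm_nonneg _) hy)
        (heatKer_pos n hh _).le hM0

/-- For fixed distance the heat kernel increases for small times. -/
lemma heatKer_mono_time (n : ℕ) {s t r : ℝ} (hs : 0 < s) (hst : s ≤ t)
    (ht : 2 * n * t ≤ r ^ 2) : heatKer n s r ≤ heatKer n t r := by
  have hmono : MonotoneOn (fun s => heatKer n s r) (Icc s t) := by
    have hd : ∀ q ∈ Icc s t, HasDerivAt (fun s => heatKer n s r)
      (heatKer n q r * (r ^ 2 / (4 * q ^ 2) - n / (2 * q))) q :=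
      fun q hq => hasDerivAt_heatKer_time n (hs.trans_le hq.1) r
    refine monotoneOn_of_deriv_nonneg (convex_Icc s t)
      (fun q hq => (hd q hq).continuousAt.continuousWithinAt)
      (fun q hq => (hd q (interior_subset hq)).differentiableAt.differentiableWithinAt)
      fun q hq => ?_
    have hq := interior_subset hq
    have hq0 : 0 < q := hs.trans_le hq.1
    rw [(hd q hq).deriv]
    refine mul_nonneg (heatKer_pos n hq0 r).le (sub_nonneg.2 ?_)
    rw [div_le_div_iff₀ (by positivity) (by positivity)]
    have h1 : 2 * n * q ≤ r ^ 2 := le_trans (by gcongr; exact hq.2) ht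
    nlinarith
  exact hmono ⟨le_rfl, hst⟩ ⟨hst, le_rfl⟩ hst

/-- A bounded differentiable family integrated against an integrable weight. -/
lemma hasDerivAt_integral_weight {n : ℕ} {k : Euc n → ℝ} (hk : Integrable k)
    {g g' : ℝ → Euc n → ℝ} {M M' : ℝ} (hg : ∀ r, Continuous (g r)) (hg' : ∀ r, Continuous (g' r))
    (hM : ∀ r z, |g r z| ≤ M) (hM' : ∀ r z, |g' r z| ≤ M')
    (hd : ∀ r z, HasDerivAt (fun r => g r z) (g' r z) r) (r₀ : ℝ) :
    HasDerivAt (fun r => ∫ z, k z * g r z) (∫ z, k z * g' r₀ z) r₀ := by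
  refine (hasDerivAt_integral_of_dominated_loc_of_deriv_le (s := univ)
    (bound := fun z => ‖k z‖ * M') (F := fun r z => k z * g r z) (F' := fun r z => k z * g' r z)
    univ_mem (Eventually.of_forall fun r => hk.1.mul (hg r).aestronglyMeasurable) ?_
    (hk.1.mul (hg' r₀).aestronglyMeasurable) (Eventually.of_forall fun z r _ => ?_)
    (hk.norm.mul_const M') (Eventually.of_forall fun z r _ => (hd r z).const_mul _)).2
  · refine (hk.norm.mul_const M).mono' (hk.1.mul (hg r₀).aestronglyMeasurable)
      (Eventually.of_forall fun z => ?_)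
    rw [norm_mul]; exact mul_le_mul_of_nonneg_left (hM _ _) (norm_nonneg _)
  · rw [norm_mul]; exact mul_le_mul_of_nonneg_left (hM' _ _) (norm_nonneg _)

/-- The partial derivative of `g` in the `i`-th coordinate direction. -/
def pderiv {n : ℕ} (i : Fin n) (g : Euc n → ℝ) (x : Euc n) : ℝ := fderiv ℝ g x (basisVec i)

lemma lap_eq_sum_pderiv {n : ℕ} (g : Euc n → ℝ) (x : Euc n) :
    lap g x = ∑ i, pderiv i (pderiv i g) x := rfl

/-- Smooth functions with compact support. -/
def IsTest {n : ℕ} (g : Euc n → ℝ) : Prop := ContDiff ℝ (⊤ : ℕ∞) g ∧ HasCompactSupport g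

lemma IsTest.continuous {n : ℕ} {g : Euc n → ℝ} (hg : IsTest g) : Continuous g := hg.1.continuous

lemma IsTest.differentiable {n : ℕ} {g : Euc n → ℝ} (hg : IsTest g) : Differentiable ℝ g :=
  hg.1.differentiable (by simp)

lemma IsTest.pderiv {n : ℕ} {g : Euc n → ℝ} (hg : IsTest g) (i : Fin n) :
    IsTest (pderiv i g) := by
  constructor
  · have h : ContDiff ℝ (⊤ : ℕ∞) (fderiv ℝ g) := hg.1.fderiv_right (by simp)
    exact h.clm_apply contDiff_const
  · exact hg.2.fderiv_apply ℝ _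

lemma support_pderiv_subset {n : ℕ} (g : Euc n → ℝ) (i : Fin n) :
    Function.support (pderiv i g) ⊆ tsupport g :=
  fun x hx => support_fderiv_subset ℝ (f := g) fun h => hx (by simp [pderiv, h])

lemma IsTest.exists_bound {n : ℕ} {g : Euc n → ℝ} (hg : IsTest g) : ∃ M, ∀ x, |g x| ≤ M :=
  hg.2.exists_bound_of_continuous hg.continuous

lemma IsTest.integrable {n : ℕ} {g : Euc n → ℝ} (hg : IsTest g) : Integrable g :=
  hg.continuous.integrable_of_hasCompactSupport hg.2

lemma IsTest.lap {n : ℕ} {g : Euc n → ℝ} (hg : IsTest g) : IsTest (lap g) := by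
  have h : _root_.lap g = fun x => ∑ i, _root_.pderiv i (_root_.pderiv i g) x := rfl
  rw [h]
  refine ⟨ContDiff.sum fun i _ => ((hg.pderiv i).pderiv i).1, ?_⟩
  refine HasCompactSupport.of_support_subset_isCompact hg.2 ?_
  intro x hx
  rw [Function.mem_support] at hx
  obtain ⟨i, _, hi⟩ := Finset.exists_ne_zero_of_sum_ne_zero hx
  exact closure_minimal (support_pderiv_subset g i) (isClosed_tsupport g)
    (support_pderiv_subset _ i hi)

lemma IsTest.hasDerivAt_line {n : ℕ} {g : Euc n → ℝ} (hg : IsTest g) (i : Fin n) (x : Euc n)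
    (r : ℝ) : HasDerivAt (fun r : ℝ => g (x + r • basisVec i))
      (_root_.pderiv i g (x + r • basisVec i)) r :=
  _root_.hasDerivAt_line (hg.differentiable _)

lemma IsTest.hasLapAt_heatExt {n : ℕ} {g : Euc n → ℝ} (hg : IsTest g) (s : ℝ) (x : Euc n) :
    HasLapAt (heatExt g s) x (heatExt (_root_.lap g) s x) := by
  have key : ∀ {g : Euc n → ℝ}, IsTest g → ∀ (i : Fin n) (r : ℝ),
      HasDerivAt (fun r : ℝ => heatExt g s (x + r • basisVec i))
        (heatExt (_root_.pderiv i g) s (x + r • basisVec i)) r := by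
    intro g hg i r
    obtain ⟨M, hM⟩ := hg.exists_bound
    obtain ⟨M', hM'⟩ := (hg.pderiv i).exists_bound
    have hc := hg.continuous
    have hc' := (hg.pderiv i).continuous
    refine hasDerivAt_integral_weight (integrable_heatKer one_pos)
      (g := fun r z => g (x + r • basisVec i + √s • z))
      (g' := fun r z => _root_.pderiv i g (x + r • basisVec i + √s • z))
      (fun r => by fun_prop) (fun r => by fun_prop) (fun _ _ => hM _) (fun _ _ => hM' _) ?_ r
    intro r z
    simpa only [add_right_comm] using hg.hasDerivAt_line i (x + √s • z) r
  refine ⟨fun i => heatExt (_root_.pderiv i (_root_.pderiv i g)) s x, fun i =>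
    ⟨fun r => heatExt (_root_.pderiv i g) s (x + r • basisVec i),
      Eventually.of_forall fun r => key hg i r, by simpa using key (hg.pderiv i) i 0⟩, ?_⟩
  unfold heatExt
  simp_rw [lap_eq_sum_pderiv, Finset.mul_sum]
  rw [integral_finsetSum]
  intro i _
  obtain ⟨M, hM⟩ := ((hg.pderiv i).pderiv i).exists_bound
  have hc := ((hg.pderiv i).pderiv i).continuous
  refine ((integrable_heatKer one_pos).mul_const M).mono'
    ((integrable_heatKer one_pos).1.mul (by fun_prop)) (Eventually.of_forall fun z => ?_)
  rw [norm_mul, Real.norm_of_nonneg (heatKer_pos n one_pos _).le]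
  exact mul_le_mul_of_nonneg_left (hM _) (heatKer_pos n one_pos _).le

lemma IsTest.hasDerivAt_heatExt {n : ℕ} {g : Euc n → ℝ} (hg : IsTest g) {s : ℝ} (hs : 0 < s)
    (x : Euc n) : HasDerivAt (fun s => heatExt g s x) (heatExt (_root_.lap g) s x) s := by
  obtain ⟨L, h1, h2⟩ := heatExt_heat_eq hg.2 hg.integrable
    (fun y hy => image_eq_zero_of_notMem_tsupport hy) hs x
  rwa [h2.unique (hg.hasLapAt_heatExt s x)] at h1

lemma IsTest.continuous_heatExt_time {n : ℕ} {g : Euc n → ℝ} (hg : IsTest g) (x : Euc n) :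
    Continuous fun s => heatExt g s x := by
  obtain ⟨M, hM⟩ := hg.exists_bound
  exact (continuous_heatExt hg.continuous hM).comp (by fun_prop : Continuous fun s : ℝ => (s, x))

lemma IsTest.hasDerivWithinAt_heatExt_zero {n : ℕ} {g : Euc n → ℝ} (hg : IsTest g) (x : Euc n) :
    HasDerivWithinAt (fun s => heatExt g s x) (_root_.lap g x) (Ici 0) 0 := by
  refine hasDerivWithinAt_Ici_of_tendsto_deriv (s := Ioi 0)
    (fun s hs => (hg.hasDerivAt_heatExt hs x).differentiableAt.differentiableWithinAt)
    (hg.continuous_heatExt_time x).continuousWithinAt self_mem_nhdsWithin ?_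
  have h := (hg.lap.continuous_heatExt_time x).tendsto 0
  rw [heatExt_zero] at h
  refine (h.mono_left nhdsWithin_le_nhds).congr' ?_
  filter_upwards [self_mem_nhdsWithin] with s hs using (hg.hasDerivAt_heatExt hs x).deriv.symm

lemma IsTest.abs_heatExt_sub_le {n : ℕ} {g : Euc n → ℝ} (hg : IsTest g) {M : ℝ}
    (hM : ∀ x, |_root_.lap g x| ≤ M) {s : ℝ} (hs : 0 ≤ s) (x : Euc n) :
    |heatExt g s x - g x| ≤ M * s := by
  have h := norm_image_sub_le_of_norm_deriv_right_le_segment (a := 0) (b := s)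
    (f := fun s => heatExt g s x) (f' := fun s => heatExt (_root_.lap g) s x) (C := M)
    (hg.continuous_heatExt_time x).continuousOn ?_ (fun q _ => abs_heatExt_le hM q x) s
    ⟨hs, le_rfl⟩
  · simpa [heatExt_zero] using h
  · intro q hq
    rcases hq.1.eq_or_lt with rfl | hq
    · rw [heatExt_zero]; exact hg.hasDerivWithinAt_heatExt_zero x
    · exact (hg.hasDerivAt_heatExt hq x).hasDerivWithinAt

lemma integrable_prod_heatKer_mul {n : ℕ} {f g : Euc n → ℝ} (hf : Continuous f)
    (hfi : Integrable f) (hg : Continuous g) {M : ℝ} (hM : ∀ x, |g x| ≤ M) (a : ℝ) :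
    Integrable (fun p : Euc n × Euc n => heatKer n 1 ‖p.2‖ * (g (p.1 + a • p.2) * f p.1))
      (volume.prod volume) := by
  have h1 : Integrable (fun p : Euc n × Euc n => f p.1 * heatKer n 1 ‖p.2‖)
      (volume.prod volume) := hfi.mul_prod (integrable_heatKer one_pos)
  have hk := continuous_heatKer_norm n 1
  refine (h1.norm.const_mul M).mono' ?_ (Eventually.of_forall fun p => ?_)
  · have : Continuous fun p : Euc n × Euc n => heatKer n 1 ‖p.2‖ * (g (p.1 + a • p.2) * f p.1) :=
      (hk.comp continuous_snd).mul (by fun_prop)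
    exact this.aestronglyMeasurable
  · calc _ = |g (p.1 + a • p.2)| * ‖f p.1 * heatKer n 1 ‖p.2‖‖ := by
          simp only [norm_mul, Real.norm_eq_abs]; ring
      _ ≤ _ := mul_le_mul_of_nonneg_right (hM _) (norm_nonneg _)

/-- The heat semigroup commutes with convolution. -/
lemma integral_heatExt_mul {n : ℕ} {f g : Euc n → ℝ} (hf : Continuous f) (hfi : Integrable f)
    (hg : Continuous g) (hgi : Integrable g) {M M' : ℝ} (hM : ∀ x, |g x| ≤ M)
    (hM' : ∀ x, |f x| ≤ M') (s : ℝ) (x : Euc n) :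
    ∫ y, heatExt g s y * f (x - y) = ∫ z, g z * heatExt f s (x - z) := by
  have h1 := integrable_prod_heatKer_mul (f := fun y => f (x - y)) (hf.comp (by fun_prop))
    (hfi.comp_sub_left x) hg hM (√s)
  have h2 := integrable_prod_heatKer_mul hg hgi (g := fun y => f (x - y)) (hf.comp (by fun_prop))
    (fun y => hM' (x - y)) (-√s)
  have e1 : ∫ y, heatExt g s y * f (x - y)
      = ∫ w, ∫ y, heatKer n 1 ‖w‖ * (g (y + √s • w) * f (x - y)) := by
    rw [← integral_integral_swap h1]
    congr 1; ext y
    rw [heatExt, ← integral_mul_const]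
    simp only [mul_assoc]
  have e2 : ∫ z, g z * heatExt f s (x - z)
      = ∫ w, ∫ z, heatKer n 1 ‖w‖ * (f (x - (z + (-√s) • w)) * g z) := by
    rw [← integral_integral_swap h2]
    congr 1; ext z
    rw [heatExt, ← integral_const_mul]
    congr 1; ext w
    rw [show x - (z + (-√s) • w) = x - z + √s • w by simp only [neg_smul]; abel]
    ring
  rw [e1, e2]
  congr 1; ext w
  rw [← integral_add_right_eq_self (μ := (volume : Measure (Euc n)))
    (fun z => heatKer n 1 ‖w‖ * (f (x - (z + (-√s) • w)) * g z)) (√s • w)]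
  congr 1; ext y
  rw [show y + √s • w + (-√s) • w = y by simp]
  ring

/-- `v` is a nonnegative solution of the heat equation on `[a, b] × closedBall c ρ`, with
regularity assumed only in each variable separately. -/
structure SepSol {n : ℕ} (v : ℝ → Euc n → ℝ) (a b : ℝ) (c : Euc n) (ρ : ℝ) : Prop where
  nonneg : ∀ t ∈ Icc a b, ∀ x ∈ closedBall c ρ, 0 ≤ v t x
  lip : ∀ t ∈ Icc a b, ∃ k, LipschitzOnWith k (v t) (closedBall c ρ)
  cont_time : ∀ x ∈ closedBall c ρ, ContinuousOn (fun t => v t x) (Icc a b)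
  heat : ∀ t ∈ Ioc a b, ∀ x ∈ ball c ρ,
    ∃ L, HasDerivAt (fun t => v t x) L t ∧ HasLapAt (v t) x L

/-- `w` is a continuous subsolution of the heat equation on `[a, b] × closedBall c ρ`, nonpositive
on the lateral boundary. -/
structure IsSubsol {n : ℕ} (w : ℝ → Euc n → ℝ) (a b : ℝ) (c : Euc n) (ρ : ℝ) : Prop where
  cont : ContinuousOn (fun p : ℝ × Euc n => w p.1 p.2) (Icc a b ×ˢ closedBall c ρ)
  bdry : ∀ t ∈ Icc a b, ∀ x ∈ sphere c ρ, w t x ≤ 0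
  heat : ∀ t ∈ Ioc a b, ∀ x ∈ ball c ρ,
    ∃ d L, HasDerivAt (fun t => w t x) d t ∧ HasLapAt (w t) x L ∧ d ≤ L

lemma SepSol.mono {n : ℕ} {v : ℝ → Euc n → ℝ} {a b a' b' ρ : ℝ} {c : Euc n}
    (h : SepSol v a b c ρ) (ha : a ≤ a') (hb : b' ≤ b) : SepSol v a' b' c ρ where
  nonneg t ht := h.nonneg t (Icc_subset_Icc ha hb ht)
  lip t ht := h.lip t (Icc_subset_Icc ha hb ht)
  cont_time x hx := (h.cont_time x hx).mono (Icc_subset_Icc ha hb)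
  heat t ht := h.heat t (Ioc_subset_Ioc ha hb ht)

lemma SepSol.cont_space {n : ℕ} {v : ℝ → Euc n → ℝ} {a b ρ : ℝ} {c : Euc n}
    (h : SepSol v a b c ρ) {t : ℝ} (ht : t ∈ Icc a b) : ContinuousOn (v t) (closedBall c ρ) :=
  let ⟨_, hk⟩ := h.lip t ht
  hk.continuousOn

lemma IsSubsol.mono {n : ℕ} {w : ℝ → Euc n → ℝ} {a b a' b' ρ : ℝ} {c : Euc n}
    (h : IsSubsol w a b c ρ) (ha : a ≤ a') (hb : b' ≤ b) : IsSubsol w a' b' c ρ where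
  cont := h.cont.mono (prod_mono (Icc_subset_Icc ha hb) le_rfl)
  bdry t ht := h.bdry t (Icc_subset_Icc ha hb ht)
  heat t ht := h.heat t (Ioc_subset_Ioc ha hb ht)

lemma IsSubsol.cont_space {n : ℕ} {w : ℝ → Euc n → ℝ} {a b ρ : ℝ} {c : Euc n}
    (h : IsSubsol w a b c ρ) {t : ℝ} (ht : t ∈ Icc a b) : ContinuousOn (w t) (closedBall c ρ) :=
  h.cont.comp (f := fun x => (t, x)) (by fun_prop) fun _ hx => ⟨ht, hx⟩

lemma IsSubsol.cont_time {n : ℕ} {w : ℝ → Euc n → ℝ} {a b ρ : ℝ} {c : Euc n}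
    (h : IsSubsol w a b c ρ) {x : Euc n} (hx : x ∈ closedBall c ρ) :
    ContinuousOn (fun t => w t x) (Icc a b) :=
  h.cont.comp (f := fun t => (t, x)) (by fun_prop) fun _ ht => ⟨ht, hx⟩

lemma IsSubsol.sub_supersol {n : ℕ} {w z : ℝ → Euc n → ℝ} {a b ρ : ℝ} {c : Euc n}
    (h : IsSubsol w a b c ρ)
    (hz : ContinuousOn (fun p : ℝ × Euc n => z p.1 p.2) (Icc a b ×ˢ closedBall c ρ))
    (hz0 : ∀ t ∈ Icc a b, ∀ x ∈ sphere c ρ, 0 ≤ z t x)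
    (hzh : ∀ t ∈ Ioc a b, ∀ x ∈ ball c ρ,
      ∃ d L, HasDerivAt (fun t => z t x) d t ∧ HasLapAt (z t) x L ∧ L ≤ d) :
    IsSubsol (fun t x => w t x - z t x) a b c ρ where
  cont := h.cont.sub hz
  bdry t ht x hx := by linarith [h.bdry t ht x hx, hz0 t ht x hx]
  heat t ht x hx := by
    obtain ⟨d, L, h1, h2, h3⟩ := h.heat t ht x hx
    obtain ⟨d', L', h1', h2', h3'⟩ := hzh t ht x hx
    exact ⟨d - d', L - L', h1.sub h1', h2.sub h2', by linarith⟩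

lemma IsSubsol.sub_affine {n : ℕ} {w : ℝ → Euc n → ℝ} {a b ρ ε η s : ℝ} {c : Euc n}
    (h : IsSubsol w a b c ρ) (hε : 0 ≤ ε) (hη : 0 ≤ η) (hs : s ≤ a) :
    IsSubsol (fun t x => w t x - (ε * (t - s) + η)) a b c ρ := by
  refine h.sub_supersol (z := fun t _ => ε * (t - s) + η) (by fun_prop) ?_ ?_
  · intro t ht x _
    have : 0 ≤ t - s := by linarith [ht.1]
    positivity
  · intro t _ x _
    refine ⟨ε, 0, ?_, HasLapAt.const _ _, hε⟩
    simpa using (((hasDerivAt_id t).sub_const s).const_mul ε).add_const η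

/-- Comparison of `v` with subsolutions on `[s, t]`. -/
def Compares {n : ℕ} (v : ℝ → Euc n → ℝ) (c : Euc n) (ρ s t : ℝ) : Prop :=
  ∀ w, IsSubsol w s t c ρ → (∀ x ∈ closedBall c ρ, w s x ≤ v s x) →
    ∀ x ∈ closedBall c ρ, w t x ≤ v t x

/-- Subsolutions below `v` at time `t` do not jump above `v` immediately after `t`. -/
def RightStable {n : ℕ} (v : ℝ → Euc n → ℝ) (c : Euc n) (ρ b t : ℝ) : Prop :=
  ∀ b' w, t < b' → b' ≤ b → IsSubsol w t b' c ρ → (∀ x ∈ closedBall c ρ, w t x ≤ v t x) →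
    ∀ ε > 0, ∃ δ > 0, ∀ t' ∈ Ioc t b', t' < t + δ → ∀ x ∈ closedBall c ρ, w t' x ≤ v t' x + ε

lemma RightStable.mono {n : ℕ} {v : ℝ → Euc n → ℝ} {c : Euc n} {ρ b b₁ t : ℝ}
    (h : RightStable v c ρ b t) (hb : b₁ ≤ b) : RightStable v c ρ b₁ t :=
  fun b' w h1 h2 => h b' w h1 (h2.trans hb)

lemma compares_of_rightStable {n : ℕ} {v : ℝ → Euc n → ℝ} {a b ρ : ℝ} {c : Euc n} (hab : a < b)
    (hv : SepSol v a b c ρ) (hR : ∀ t ∈ Ico a b, RightStable v c ρ b t) :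
    Compares v c ρ a b := by
  intro w hw hwa x₀ hx₀
  by_contra! hlt
  obtain ⟨ε, hε, η, hη, hεη⟩ : ∃ ε > 0, ∃ η > 0, w b x₀ - v b x₀ - ε * (b - a) ≥ η := by
    have hba : 0 < b - a := sub_pos.2 hab
    refine ⟨(w b x₀ - v b x₀) / (2 * (b - a)), by
      have : 0 < w b x₀ - v b x₀ := by linarith
      positivity, (w b x₀ - v b x₀) / 2, by linarith, ?_⟩
    have : (w b x₀ - v b x₀) / (2 * (b - a)) * (b - a) = (w b x₀ - v b x₀) / 2 := by
      field_simp
    rw [this]; linarith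
  set g : ℝ → Euc n → ℝ := fun t x => w t x - v t x - ε * (t - a) with hg
  set S : Set ℝ := {s | s ∈ Icc a b ∧ ∀ t ∈ Icc s b, ∃ x ∈ closedBall c ρ, η ≤ g t x} with hS
  have hbS : b ∈ S := by
    refine ⟨⟨hab.le, le_rfl⟩, fun t ht => ⟨x₀, hx₀, ?_⟩⟩
    rw [le_antisymm ht.2 ht.1]; exact hεη
  have hSbdd : BddBelow S := ⟨a, fun s hs => hs.1.1⟩
  set σ := sInf S with hσ
  have hσa : a ≤ σ := le_csInf ⟨b, hbS⟩ fun s hs => hs.1.1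
  have hσb : σ ≤ b := csInf_le hSbdd hbS
  have hσI : σ ∈ Icc a b := ⟨hσa, hσb⟩
  have hgt : ∀ t ∈ Ioc σ b, ∃ x ∈ closedBall c ρ, η ≤ g t x := by
    intro t ht
    obtain ⟨s, hs, hst⟩ := exists_lt_of_csInf_lt ⟨b, hbS⟩ ht.1
    exact hs.2 t ⟨hst.le, ht.2⟩
  have hgc : ContinuousOn (g σ) (closedBall c ρ) :=
    ((hw.cont_space hσI).sub (hv.cont_space hσI)).sub continuousOn_const
  obtain ⟨z, hz, hzmax⟩ := (isCompact_closedBall c ρ).exists_isMaxOn ⟨x₀, hx₀⟩ hgc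
  have hzη : η ≤ g σ z := by
    rcases hσb.eq_or_lt with h | h
    · have : g σ x₀ ≤ g σ z := hzmax hx₀
      refine le_trans ?_ this
      rw [h]; exact hεη
    by_contra! hlt'
    set η' := max (g σ z) 0 with hη'
    have hη'lt : η' < η := max_lt hlt' hη
    have hsub := (hw.mono hσa le_rfl).sub_affine hε.le (le_max_right (g σ z) 0) hσa
    obtain ⟨δ, hδ, hδ'⟩ := hR σ ⟨hσa, h⟩ b _ h le_rfl hsub (fun x hx => by
      have : g σ x ≤ g σ z := hzmax hx
      have h2 : g σ z ≤ η' := le_max_left _ _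
      simp only [hg] at this h2 ⊢
      linarith) ((η - η') / 2) (by linarith)
    obtain ⟨t, ht1, ht2⟩ := exists_between (lt_min h (show σ < σ + δ by linarith))
    have htb : t < b := ht2.trans_le (min_le_left _ _)
    obtain ⟨x, hx, hxη⟩ := hgt t ⟨ht1, htb.le⟩
    have := hδ' t ⟨ht1, htb.le⟩ (ht2.trans_le (min_le_right _ _)) x hx
    simp only [hg] at hxη
    linarith
  have hσa' : a < σ := by
    refine hσa.lt_of_ne fun h => ?_
    have := hwa z hz
    simp only [hg] at hzη
    rw [← h] at hzη
    linarith [sub_self a]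
  have hzball : z ∈ ball c ρ := by
    rcases (mem_closedBall.1 hz).eq_or_lt with h | h
    · exfalso
      have h1 := hw.bdry σ hσI z h
      have h2 := hv.nonneg σ hσI z hz
      have h3 : 0 ≤ ε * (σ - a) := mul_nonneg hε.le (by linarith)
      simp only [hg] at hzη
      linarith
    · exact h
  obtain ⟨d, L, hd, hL, hdL⟩ := hw.heat σ ⟨hσa', hσb⟩ z hzball
  obtain ⟨L', hd', hL'⟩ := hv.heat σ ⟨hσa', hσb⟩ z hzball
  have hlap : HasLapAt (g σ) z (L - L' - 0) := (hL.sub hL').sub (HasLapAt.const _ _)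
  have hloc : IsLocalMax (g σ) z :=
    hzmax.isLocalMax (mem_of_superset (isOpen_ball.mem_nhds hzball) ball_subset_closedBall)
  have hneg := hlap.nonpos_of_isLocalMax hloc
  have hgd : HasDerivAt (fun t => g t z) (d - L' - ε) σ := by
    refine ((hd.sub hd').sub (((hasDerivAt_id σ).sub_const a).const_mul ε)).congr_deriv ?_
    simp
  have hev : ∀ᶠ t in 𝓝[<] σ, g σ z < g t z := by
    have h1 := hgd.hasDerivWithinAt (s := Iio σ)
    rw [hasDerivWithinAt_iff_tendsto_slope' (by simp)] at h1
    have h2 := h1.eventually (gt_mem_nhds (show d - L' - ε < 0 by linarith))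
    filter_upwards [h2, self_mem_nhdsWithin] with t ht htσ
    rw [slope_def_field] at ht
    have hts : t - σ < 0 := sub_neg.2 htσ
    rcases div_neg_iff.1 ht with h | h
    · linarith [h.1]
    · linarith [h.2]
  obtain ⟨l, hl, hlσ⟩ := (mem_nhdsLT_iff_exists_Ioo_subset' hσa').1 hev
  obtain ⟨s, hs1, hs2⟩ := exists_between (max_lt hl hσa')
  have : s ∈ S := by
    refine ⟨⟨(le_max_right _ _).trans hs1.le, hs2.le.trans hσb⟩, fun t ht => ?_⟩
    rcases lt_trichotomy t σ with h | h | h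
    · exact ⟨z, hz, hzη.trans
        (hlσ ⟨(le_max_left _ _).trans_lt (hs1.trans_le ht.1), h⟩ : g σ z < g t z).le⟩
    · exact ⟨z, hz, by rw [h]; exact hzη⟩
    · exact hgt t ⟨h, ht.2⟩
  exact absurd (csInf_le hSbdd this) (not_le.2 hs2)

lemma compares_of_forall_gt {n : ℕ} {v : ℝ → Euc n → ℝ} {a b ρ : ℝ} {c : Euc n} (hab : a < b)
    (hv : SepSol v a b c ρ) (h : ∀ τ ∈ Ioo a b, Compares v c ρ τ b) : Compares v c ρ a b := by
  intro w hw hwa x hx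
  set e : ℝ → Euc n → ℝ := fun τ => indicator (closedBall c ρ) fun x => max (w τ x - v τ x) 0
    with he
  obtain ⟨M, hM⟩ := (isCompact_Icc.prod (isCompact_closedBall c ρ)).exists_bound_of_continuousOn
    hw.cont
  have hM0 : 0 ≤ M := (norm_nonneg _).trans (hM (a, x) ⟨⟨le_rfl, hab.le⟩, hx⟩)
  have he0 : ∀ τ y, 0 ≤ e τ y := fun τ y => indicator_nonneg (fun _ _ => le_max_right _ _) y
  have heM : ∀ τ ∈ Icc a b, ∀ y, |e τ y| ≤ (closedBall c ρ).indicator (fun _ => M) y := by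
    intro τ hτ y
    rw [abs_of_nonneg (he0 τ y)]
    refine indicator_le_indicator' fun hy => max_le ?_ hM0
    have h1 := hM (τ, y) ⟨hτ, hy⟩
    rw [Real.norm_eq_abs] at h1
    linarith [le_abs_self (w τ y), hv.nonneg τ hτ y hy]
  have heM' : ∀ τ ∈ Icc a b, ∀ y, |e τ y| ≤ M := fun τ hτ y =>
    (heM τ hτ y).trans (indicator_le_self' (fun _ _ => hM0) y)
  have hec : ∀ τ ∈ Icc a b, Continuous (e τ) := by
    intro τ hτ
    refine continuous_indicator (fun y hy => ?_) ?_
    · have hy' : y ∈ sphere c ρ := frontier_closedBall_subset_sphere hy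
      have h1 := hw.bdry τ hτ y hy'
      have h2 := hv.nonneg τ hτ y (sphere_subset_closedBall hy')
      exact max_eq_right (by linarith)
    · rw [isClosed_closedBall.closure_eq]
      exact ((hw.cont_space hτ).sub (hv.cont_space hτ)).sup continuousOn_const
  have hesupp : ∀ τ, ∀ y ∉ closedBall c ρ, e τ y = 0 := fun τ y hy => indicator_of_notMem hy _
  have hei : ∀ τ ∈ Icc a b, Integrable (e τ) := fun τ hτ =>
    (hec τ hτ).integrable_of_hasCompactSupport
      (HasCompactSupport.intro (isCompact_closedBall c ρ) (hesupp τ))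
  have hle : ∀ τ ∈ Ioo a b,
      w b x ≤ v b x + (4 * π * (b - τ)) ^ (-(n : ℝ) / 2) * ∫ y, e τ y := by
    intro τ hτ
    have hτI : τ ∈ Icc a b := Ioo_subset_Icc_self hτ
    have hsub : IsSubsol (fun t y => w t y - heatExt (e τ) (t - τ) y) τ b c ρ := by
      refine (hw.mono hτ.1.le le_rfl).sub_supersol ?_ ?_ ?_
      · exact ((continuous_heatExt (hec τ hτI) (heM' τ hτI)).comp
          (by fun_prop : Continuous fun p : ℝ × Euc n => (p.1 - τ, p.2))).continuousOn
      · exact fun t _ y _ => heatExt_nonneg (he0 τ) _ _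
      · intro t ht y _
        obtain ⟨L, h1, h2⟩ := heatExt_heat_eq (isCompact_closedBall c ρ) (hei τ hτI) (hesupp τ)
          (sub_pos.2 ht.1) y
        exact ⟨L, L, h1.comp_sub_const t τ, h2, le_rfl⟩
    have h1 := h τ hτ _ hsub (fun y hy => by
      rw [sub_self, heatExt_zero]
      have : e τ y = max (w τ y - v τ y) 0 := indicator_of_mem hy _
      rw [this]
      linarith [le_max_left (w τ y - v τ y) 0]) x hx
    have h2 := heatExt_le_mass (hei τ hτI) (he0 τ) (sub_pos.2 hτ.2) x
    linarith
  have hlim : Tendsto (fun τ => ∫ y, e τ y) (𝓝[>] a) (𝓝 (∫ _ : Euc n, 0)) := by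
    have hev : ∀ᶠ τ in 𝓝[>] a, τ ∈ Ioo a b := Ioo_mem_nhdsGT hab
    refine tendsto_integral_filter_of_dominated_convergence
      ((closedBall c ρ).indicator fun _ => M) ?_ ?_ ?_ ?_
    · filter_upwards [hev] with τ hτ using (hec τ (Ioo_subset_Icc_self hτ)).aestronglyMeasurable
    · filter_upwards [hev] with τ hτ
      exact Eventually.of_forall fun y => heM τ (Ioo_subset_Icc_self hτ) y
    · exact (integrable_indicator_iff measurableSet_closedBall).2
        (integrableOn_const (isCompact_closedBall c ρ).measure_lt_top.ne)
    · refine Eventually.of_forall fun y => ?_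
      by_cases hy : y ∈ closedBall c ρ
      · have hc : ContinuousOn (fun τ => max (w τ y - v τ y) 0) (Icc a b) :=
          ((hw.cont_time hy).sub (hv.cont_time y hy)).sup continuousOn_const
        have h1 := (hc a ⟨le_rfl, hab.le⟩).mono_of_mem_nhdsWithin
          (Icc_mem_nhdsGT_of_mem ⟨le_rfl, hab⟩)
        have h2 : max (w a y - v a y) 0 = 0 := max_eq_right (by linarith [hwa y hy])
        have h3 : (fun τ => e τ y) = fun τ => max (w τ y - v τ y) 0 :=
          funext fun τ => indicator_of_mem hy _
        rw [h3]
        simpa [ContinuousWithinAt, h2] using h1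
      · simp only [hesupp _ y hy]; exact tendsto_const_nhds
  have hlim2 : Tendsto (fun τ => v b x + (4 * π * (b - τ)) ^ (-(n : ℝ) / 2) * ∫ y, e τ y)
      (𝓝[>] a) (𝓝 (v b x + (4 * π * (b - a)) ^ (-(n : ℝ) / 2) * ∫ _ : Euc n, 0)) := by
    refine tendsto_const_nhds.add (Tendsto.mul ?_ hlim)
    have hpos : 4 * π * (b - a) ≠ 0 := by
      have := sub_pos.2 hab
      positivity
    have : ContinuousAt (fun τ => (4 * π * (b - τ)) ^ (-(n : ℝ) / 2)) a :=
      ContinuousAt.rpow_const (by fun_prop) (Or.inl hpos)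
    exact this.tendsto.mono_left nhdsWithin_le_nhds
  have := ge_of_tendsto hlim2 (by
    filter_upwards [Ioo_mem_nhdsGT hab] with τ hτ using hle τ hτ)
  simpa using this

/-- Baire category: a nonempty closed set covered by countably many closed sets has a point near
which it is contained in one of them. -/
lemma exists_ball_inter_subset_of_baire {X : Type*} [MetricSpace X] [CompleteSpace X] {F : Set X}
    (hF : IsClosed F) (hne : F.Nonempty) {A : ℕ → Set X} (hA : ∀ k, IsClosed (A k))
    (hFA : F ⊆ ⋃ k, A k) : ∃ k, ∃ x ∈ F, ∃ δ > 0, ball x δ ∩ F ⊆ A k := by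
  have : CompleteSpace F := hF.completeSpace_coe
  have : Nonempty F := hne.to_subtype
  obtain ⟨k, ⟨x, hxF⟩, hx⟩ := nonempty_interior_of_iUnion_of_closed
    (f := fun k => ((↑) : F → X) ⁻¹' A k) (fun k => (hA k).preimage continuous_subtype_val) (by
      ext y
      simpa using hFA y.2)
  obtain ⟨δ, hδ, hsub⟩ := Metric.mem_nhds_iff.1 (mem_interior_iff_mem_nhds.1 hx)
  exact ⟨k, x, hxF, δ, hδ, fun y hy => hsub (show (⟨y, hy.2⟩ : F) ∈ _ from hy.1)⟩

lemma rightStable_of_sepSol {n : ℕ} {v : ℝ → Euc n → ℝ} {a b ρ : ℝ} {c : Euc n}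
    (hv : SepSol v a b c ρ) : ∀ t ∈ Ico a b, RightStable v c ρ b t := by
  by_contra! hcon
  set N : Set ℝ := {t | t ∈ Ico a b ∧ ¬ RightStable v c ρ b t} with hN
  set F : Set ℝ := closure N with hF
  have hFI : F ⊆ Icc a b := closure_minimal (fun t ht => Ico_subset_Icc_self ht.1) isClosed_Icc
  have hNF : N ⊆ F := subset_closure
  set A : ℕ → Set ℝ := fun k => {t | t ∈ Icc a b ∧ LipschitzOnWith k (v t) (closedBall c ρ)}
    with hAdef
  have hA : ∀ k, IsClosed (A k) := by
    intro k
    refine IsSeqClosed.isClosed fun τ t hτ hlim => ?_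
    have htI : t ∈ Icc a b := isClosed_Icc.mem_of_tendsto hlim (Eventually.of_forall fun j => (hτ j).1)
    have hlim' : Tendsto τ atTop (𝓝[Icc a b] t) :=
      tendsto_nhdsWithin_iff.2 ⟨hlim, Eventually.of_forall fun j => (hτ j).1⟩
    refine ⟨htI, LipschitzOnWith.of_dist_le_mul fun x hx y hy => ?_⟩
    have hx' := (hv.cont_time x hx t htI).tendsto.comp hlim'
    have hy' := (hv.cont_time y hy t htI).tendsto.comp hlim'
    exact le_of_tendsto (hx'.dist hy') (Eventually.of_forall fun j => (hτ j).2.dist_le_mul x hx y hy)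
  have hFA : F ⊆ ⋃ k, A k := by
    intro t ht
    obtain ⟨k, hk⟩ := hv.lip t (hFI ht)
    obtain ⟨m, hm⟩ := exists_nat_ge k
    exact mem_iUnion.2 ⟨m, hFI ht, hk.weaken (by exact_mod_cast hm)⟩
  obtain ⟨k, t₀, ht₀, δ, hδ, hsub⟩ := exists_ball_inter_subset_of_baire isClosed_closure
    (hcon.elim fun t ht => ⟨t, hNF ht⟩) hA hFA
  obtain ⟨t, htN, htδ⟩ := Metric.mem_closure_iff.1 ht₀ δ hδ
  rw [dist_comm] at htδ
  refine htN.2 ?_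
  intro b' w htb' hb'b hw hwt ε hε
  have hcv : ContinuousOn (fun p : ℝ × Euc n => v p.1 p.2)
      ((F ∩ ball t₀ δ) ×ˢ closedBall c ρ) := by
    refine continuousOn_prod_of_continuousOn_lipschitzOnWith' _ (k : NNReal) ?_ ?_
    · exact fun s hs => (hsub ⟨hs.2, hs.1⟩).2
    · exact fun x hx => (hv.cont_time x hx).mono (inter_subset_left.trans hFI)
  have hev : ∀ᶠ s in 𝓝 t, ∀ x ∈ closedBall c ρ, s ∈ F → s ∈ Icc t b' → s ∈ ball t₀ δ →
      w s x < v s x + ε := by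
    have hev' := (isCompact_closedBall c ρ).eventually_forall_of_forall_eventually (x₀ := t) (P :=
      fun s x => x ∈ closedBall c ρ → s ∈ F → s ∈ Icc t b' → s ∈ ball t₀ δ →
        w s x < v s x + ε) fun x hx => ?_
    · exact hev'.mono fun s hs x hx => hs x hx hx
    have h1 : ContinuousOn (fun p : ℝ × Euc n => w p.1 p.2 - v p.1 p.2)
        ((F ∩ ball t₀ δ ∩ Icc t b') ×ˢ closedBall c ρ) :=
      (hw.cont.mono (prod_mono inter_subset_right le_rfl)).sub
        (hcv.mono (prod_mono inter_subset_left le_rfl))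
    have h2 := (h1 (t, x) ⟨⟨⟨hNF htN, htδ⟩, le_rfl, htb'.le⟩, hx⟩).eventually
      (gt_mem_nhds (show w t x - v t x < ε by linarith [hwt x hx]))
    filter_upwards [eventually_nhdsWithin_iff.1 h2] with p hp hx hF hI hb
    linarith [hp ⟨⟨⟨hF, hb⟩, hI⟩, hx⟩]
  obtain ⟨δ₁, hδ₁, hev⟩ := Metric.eventually_nhds_iff.1
    (hev.and (isOpen_ball.mem_nhds (mem_ball.2 htδ)))
  refine ⟨δ₁, hδ₁, fun t' ht' htδ' x hx => ?_⟩
  have hnear : ∀ s ∈ Icc t t', dist s t < δ₁ := fun s hs => by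
    rw [Real.dist_eq, abs_of_nonneg (by linarith [hs.1])]; linarith [hs.2]
  set G := F ∩ Icc t t' with hG
  have hGc : IsCompact G := isCompact_Icc.inter_left isClosed_closure
  have htG : t ∈ G := ⟨hNF htN, le_rfl, ht'.1.le⟩
  obtain ⟨hs1, hs2⟩ := hGc.sSup_mem ⟨t, htG⟩
  set s := sSup G with hs
  have hws : ∀ y ∈ closedBall c ρ, w s y < v s y + ε := fun y hy =>
    (hev (hnear s hs2)).1 y hy hs1 ⟨hs2.1, hs2.2.trans ht'.2⟩ (hev (hnear s hs2)).2
  rcases hs2.2.eq_or_lt with h | h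
  · rw [← h]; exact (hws x hx).le
  have has : a ≤ s := htN.1.1.trans hs2.1
  have hvs : SepSol v s t' c ρ := hv.mono has (ht'.2.trans hb'b)
  have hcmp : Compares v c ρ s t' := by
    refine compares_of_forall_gt h hvs fun τ hτ => ?_
    refine compares_of_rightStable hτ.2 (hvs.mono hτ.1.le le_rfl) fun q hq => ?_
    by_contra hq'
    have hqs : s < q := hτ.1.trans_le hq.1
    have hqN : q ∈ N := ⟨⟨has.trans hqs.le, hq.2.trans_le (ht'.2.trans hb'b)⟩,
      fun hR => hq' (hR.mono (ht'.2.trans hb'b))⟩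
    exact absurd (le_csSup hGc.bddAbove ⟨hNF hqN, hs2.1.trans hqs.le, hq.2.le⟩) (not_le.2 hqs)
  have := hcmp _ ((hw.mono hs2.1 ht'.2).sub_affine le_rfl hε.le le_rfl (s := s)) (fun y hy => by
    linarith [hws y hy]) x hx
  linarith

/-- The minimum principle for nonnegative separately regular solutions. -/
lemma SepSol.compares {n : ℕ} {v : ℝ → Euc n → ℝ} {a b ρ : ℝ} {c : Euc n} (hab : a < b)
    (hv : SepSol v a b c ρ) : Compares v c ρ a b :=
  compares_of_rightStable hab hv (rightStable_of_sepSol hv)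

lemma SepSol.heatExt_sub_le {n : ℕ} {v : ℝ → Euc n → ℝ} {a b ρ : ℝ} {c : Euc n} (hab : a < b)
    (hρ : 0 < ρ) (hsmall : 2 * n * (b - a) ≤ (ρ / 2) ^ 2) (hv : SepSol v a b c ρ)
    {f : Euc n → ℝ} (hf : Continuous f) (hf0 : ∀ y, 0 ≤ f y) (hfs : ∀ y, ρ / 2 < ‖y - c‖ → f y = 0)
    (hfv : ∀ y ∈ closedBall c ρ, f y ≤ v a y) :
    heatExt f (b - a) c - heatKer n (b - a) (ρ / 2) * ∫ y, f y ≤ v b c := by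
  have hfs' : ∀ y ∉ closedBall c (ρ / 2), f y = 0 := fun y hy =>
    hfs y (by simpa [dist_eq_norm] using hy)
  have hcs : HasCompactSupport f := HasCompactSupport.intro (isCompact_closedBall c (ρ / 2)) hfs'
  have hfi : Integrable f := hf.integrable_of_hasCompactSupport hcs
  obtain ⟨M, hM⟩ := hcs.exists_bound_of_continuous hf
  have hI : 0 ≤ ∫ y, f y := integral_nonneg hf0
  set m := heatKer n (b - a) (ρ / 2) * ∫ y, f y with hm
  have hm0 : 0 ≤ m := mul_nonneg (heatKer_pos n (sub_pos.2 hab) _).le hI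
  have hw : IsSubsol (fun t x => heatExt f (t - a) x - m) a b c ρ := by
    refine ⟨?_, ?_, ?_⟩
    · exact (((continuous_heatExt hf hM).comp
        (by fun_prop : Continuous fun p : ℝ × Euc n => (p.1 - a, p.2))).sub
          continuous_const).continuousOn
    · intro t ht x hx
      rw [mem_sphere, dist_eq_norm] at hx
      rcases ht.1.eq_or_lt with h | h
      · rw [← h, sub_self, heatExt_zero, hfs x (by rw [hx]; linarith)]; linarith
      · have hta : 0 < t - a := sub_pos.2 h
        have h1 : heatExt f (t - a) x ≤ heatKer n (t - a) (ρ / 2) * ∫ y, f y := by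
          rw [heatExt_eq_kernel f hta, ← integral_const_mul]
          refine integral_mono (integrable_heatKer_mul hfi hta x) (hfi.const_mul _) fun y => ?_
          by_cases hy : ρ / 2 < ‖y - c‖
          · simp [hfs y hy]
          · refine mul_le_mul_of_nonneg_right (heatKer_anti n hta (by linarith) ?_) (hf0 y)
            have : ‖x - c‖ ≤ ‖y - x‖ + ‖y - c‖ := by
              rw [show x - c = (y - c) - (y - x) by abel, add_comm]; exact norm_sub_le _ _
            linarith
        have h2 : heatKer n (t - a) (ρ / 2) ≤ heatKer n (b - a) (ρ / 2) :=
          heatKer_mono_time n hta (by linarith [ht.2]) hsmall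
        linarith [mul_le_mul_of_nonneg_right h2 hI]
    · intro t ht x _
      obtain ⟨L, h1, h2⟩ := heatExt_heat_eq (isCompact_closedBall c (ρ / 2)) hfi hfs'
        (sub_pos.2 ht.1) x
      refine ⟨L, L, (h1.comp_sub_const t a).sub_const m, ?_, le_rfl⟩
      simpa using h2.sub (HasLapAt.const m x)
  refine hv.compares hab _ hw (fun x hx => ?_) c (mem_closedBall_self hρ.le)
  rw [sub_self, heatExt_zero]
  linarith [hfv x hx]

/-- A continuous cut-off function, equal to `1` within distance `3 * ρ / 8` of `c` and to `0` at
distance at least `ρ / 2`. -/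
def cutoff {n : ℕ} (ρ : ℝ) (c y : Euc n) : ℝ := max 0 (min 1 (4 - 8 * ‖y - c‖ / ρ))

lemma cutoff_nonneg {n : ℕ} (ρ : ℝ) (c y : Euc n) : 0 ≤ cutoff ρ c y := le_max_left _ _

lemma cutoff_le_one {n : ℕ} (ρ : ℝ) (c y : Euc n) : cutoff ρ c y ≤ 1 :=
  max_le zero_le_one (min_le_left _ _)

lemma cutoff_eq_one {n : ℕ} {ρ : ℝ} (hρ : 0 < ρ) {c y : Euc n} (h : ‖y - c‖ ≤ 3 * ρ / 8) :
    cutoff ρ c y = 1 := by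
  have : 8 * ‖y - c‖ / ρ ≤ 3 := by rw [div_le_iff₀ hρ]; linarith
  unfold cutoff
  rw [min_eq_left (by linarith), max_eq_right zero_le_one]

lemma cutoff_eq_zero {n : ℕ} {ρ : ℝ} (hρ : 0 < ρ) {c y : Euc n} (h : ρ / 2 ≤ ‖y - c‖) :
    cutoff ρ c y = 0 := by
  have : 4 ≤ 8 * ‖y - c‖ / ρ := by rw [le_div_iff₀ hρ]; linarith
  unfold cutoff
  exact max_eq_left ((min_le_right _ _).trans (by linarith))

lemma continuous_cutoff {n : ℕ} (ρ : ℝ) (c : Euc n) : Continuous (cutoff ρ c) := by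
  unfold cutoff; fun_prop

lemma continuous_cutoff_mul {n : ℕ} {ρ : ℝ} (hρ : 0 < ρ) {c : Euc n} {g : Euc n → ℝ}
    (hg : ContinuousOn g (closedBall c ρ)) : Continuous fun y => cutoff ρ c y * g y := by
  refine ContinuousOn.continuous_of_tsupport_subset (s := ball c ρ)
    ((continuous_cutoff ρ c).continuousOn.mul (hg.mono ball_subset_closedBall)) isOpen_ball ?_
  refine (closure_minimal ?_ (isClosed_closedBall (x := c) (ε := ρ / 2))).trans
    (closedBall_subset_ball (by linarith))
  intro y hy
  by_contra h
  rw [mem_closedBall, dist_eq_norm, not_le] at h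
  exact hy (by simp [cutoff_eq_zero hρ h.le])

lemma SepSol.cutoff_estimate {n : ℕ} {v : ℝ → Euc n → ℝ} {a b ρ : ℝ} {c : Euc n} (hab : a < b)
    (hρ : 0 < ρ) (hsmall : 2 * n * (b - a) ≤ (ρ / 2) ^ 2) (hv : SepSol v a b c ρ) :
    heatExt (fun y => cutoff ρ c y * v a y) (b - a) c
      - heatKer n (b - a) (ρ / 2) * ∫ y, cutoff ρ c y * v a y ≤ v b c := by
  have ha : a ∈ Icc a b := ⟨le_rfl, hab.le⟩
  refine hv.heatExt_sub_le hab hρ hsmall (continuous_cutoff_mul hρ (hv.cont_space ha)) ?_ ?_ ?_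
  · intro y
    by_cases hy : y ∈ closedBall c ρ
    · exact mul_nonneg (cutoff_nonneg _ _ _) (hv.nonneg a ha y hy)
    · rw [mem_closedBall, dist_eq_norm, not_le] at hy
      simp [cutoff_eq_zero hρ (by linarith : ρ / 2 ≤ ‖y - c‖)]
  · exact fun y hy => by simp [cutoff_eq_zero hρ hy.le]
  · exact fun y hy => mul_le_of_le_one_left (hv.nonneg a ha y hy) (cutoff_le_one _ _ _)

lemma integrable_cutoff_mul {n : ℕ} {ρ : ℝ} (hρ : 0 < ρ) {c : Euc n} {g : Euc n → ℝ}
    (hg : ContinuousOn g (closedBall c ρ)) : Integrable fun y => cutoff ρ c y * g y := by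
  refine (continuous_cutoff_mul hρ hg).integrable_of_hasCompactSupport
    (HasCompactSupport.intro (isCompact_closedBall c ρ) fun y hy => ?_)
  rw [mem_closedBall, dist_eq_norm, not_le] at hy
  simp [cutoff_eq_zero hρ (by linarith : ρ / 2 ≤ ‖y - c‖)]

/-- A weak Harnack inequality: the value of `v` controls its earlier local mass. -/
lemma SepSol.weak_harnack {n : ℕ} {v : ℝ → Euc n → ℝ} {a b ρ : ℝ} {c : Euc n} (hab : a < b)
    (hρ : 0 < ρ) (hsmall : 2 * n * (b - a) ≤ (ρ / 2) ^ 2) (hv : SepSol v a b c ρ) :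
    (heatKer n (b - a) (ρ / 4) - heatKer n (b - a) (ρ / 2)) * ∫ y in closedBall c (ρ / 4), v a y
      ≤ v b c := by
  have ha : a ∈ Icc a b := ⟨le_rfl, hab.le⟩
  have hba : 0 < b - a := sub_pos.2 hab
  have hfi := integrable_cutoff_mul hρ (hv.cont_space ha)
  refine le_trans ?_ (hv.cutoff_estimate hab hρ hsmall)
  rw [heatExt_eq_kernel _ hba, ← integral_const_mul, ← integral_const_mul,
    ← integral_sub (integrable_heatKer_mul hfi hba c) (hfi.const_mul _),
    ← integral_indicator measurableSet_closedBall]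
  have hsub : closedBall c (ρ / 4) ⊆ closedBall c ρ := closedBall_subset_closedBall (by linarith)
  refine integral_mono ?_ ((integrable_heatKer_mul hfi hba c).sub (hfi.const_mul _)) fun y => ?_
  · refine (integrable_indicator_iff measurableSet_closedBall).2 ?_
    exact (((hv.cont_space ha).mono hsub).integrableOn_compact
      (isCompact_closedBall _ _)).const_mul _
  · simp only
    by_cases hy : y ∈ closedBall c (ρ / 4)
    · have hv0 := hv.nonneg a ha y (hsub hy)
      rw [indicator_of_mem hy]
      rw [mem_closedBall, dist_eq_norm] at hy
      rw [cutoff_eq_one hρ (by linarith), one_mul, ← sub_mul]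
      exact mul_le_mul_of_nonneg_right
        (sub_le_sub_right (heatKer_anti n hba (norm_nonneg _) hy) _) hv0
    · rw [indicator_of_notMem hy, ← sub_mul]
      by_cases hy2 : ρ / 2 ≤ ‖y - c‖
      · simp [cutoff_eq_zero hρ hy2]
      · push Not at hy2
        have hyB : y ∈ closedBall c ρ := by rw [mem_closedBall, dist_eq_norm]; linarith
        exact mul_nonneg (sub_nonneg.2 (heatKer_anti n hba (norm_nonneg _) hy2.le))
          (mul_nonneg (cutoff_nonneg _ _ _) (hv.nonneg a ha y hyB))

lemma SepSol.const_sub {n : ℕ} {v : ℝ → Euc n → ℝ} {a b ρ K : ℝ} {c : Euc n}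
    (hv : SepSol v a b c ρ) (hK : ∀ t ∈ Icc a b, ∀ x ∈ closedBall c ρ, v t x ≤ K) :
    SepSol (fun t x => K - v t x) a b c ρ where
  nonneg t ht x hx := sub_nonneg.2 (hK t ht x hx)
  lip t ht := by
    obtain ⟨k, hk⟩ := hv.lip t ht
    refine ⟨k, LipschitzOnWith.of_dist_le_mul fun x hx y hy => ?_⟩
    rw [dist_sub_left]; exact hk.dist_le_mul x hx y hy
  cont_time x hx := continuousOn_const.sub (hv.cont_time x hx)
  heat t ht x hx := by
    obtain ⟨L, h1, h2⟩ := hv.heat t ht x hx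
    exact ⟨-L, h1.const_sub K, by simpa using (HasLapAt.const K x).sub h2⟩

/-- A bounded solution is close to the heat extension of its localized initial value. -/
lemma SepSol.abs_sub_heatExt_le {n : ℕ} {v : ℝ → Euc n → ℝ} {a b ρ K : ℝ} {c : Euc n}
    (hab : a < b) (hρ : 0 < ρ) (hsmall : 2 * n * (b - a) ≤ (ρ / 2) ^ 2) (hv : SepSol v a b c ρ)
    (hK : ∀ t ∈ Icc a b, ∀ x ∈ closedBall c ρ, v t x ≤ K) :
    |v b c - heatExt (fun y => cutoff ρ c y * v a y) (b - a) c| ≤ 2 * K * gaussTail n (b - a) ρ := by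
  have ha : a ∈ Icc a b := ⟨le_rfl, hab.le⟩
  have hba : 0 < b - a := sub_pos.2 hab
  have hK0 : 0 ≤ K := (hv.nonneg a ha c (mem_closedBall_self hρ.le)).trans
    (hK a ha c (mem_closedBall_self hρ.le))
  have htail := gaussTail_pos n (b - a) ρ
  have hbound : ∀ w : ℝ → Euc n → ℝ, SepSol w a b c ρ →
      (∀ x ∈ closedBall c ρ, w a x ≤ K) →
      |heatKer n (b - a) (ρ / 2) * ∫ y, cutoff ρ c y * w a y| ≤ K * gaussTail n (b - a) ρ := by
    intro w hw hwK
    refine heatKer_half_mul_integral_le_tail (c := c) hba (fun y => ?_)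
      fun y hy => by simp [cutoff_eq_zero hρ hy.le]
    by_cases hy : y ∈ closedBall c ρ
    · rw [abs_of_nonneg (mul_nonneg (cutoff_nonneg _ _ _) (hw.nonneg a ha y hy))]
      exact (mul_le_of_le_one_left (hw.nonneg a ha y hy) (cutoff_le_one _ _ _)).trans (hwK y hy)
    · rw [mem_closedBall, dist_eq_norm, not_le] at hy
      simpa [cutoff_eq_zero hρ (by linarith : ρ / 2 ≤ ‖y - c‖)] using hK0
  have hv' := hv.const_sub hK
  have l1 := hv.cutoff_estimate hab hρ hsmall
  have l2 := abs_le.1 (hbound v hv (hK a ha))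
  have u1 := hv'.cutoff_estimate hab hρ hsmall
  have u2 := abs_le.1 (hbound _ hv' fun x hx => by linarith [hv.nonneg a ha x hx])
  have hfi := integrable_cutoff_mul hρ (hv.cont_space ha)
  have hone := abs_le.1 (abs_integral_heatKer_mul_le_tail (g := fun y => 1 - cutoff ρ c y)
    (M := 1) (c := c) hba hρ.le
    (fun y => by
      rw [abs_of_nonneg (sub_nonneg.2 (cutoff_le_one _ _ _))]
      linarith [cutoff_nonneg ρ c y])
    fun y hy => by rw [cutoff_eq_one hρ hy.le, sub_self])
  have hci : Integrable (cutoff ρ c) := by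
    simpa using integrable_cutoff_mul hρ (c := c) (g := fun _ => 1) continuousOn_const
  have e1 : heatExt (fun y => cutoff ρ c y * (K - v a y)) (b - a) c
      = K * heatExt (cutoff ρ c) (b - a) c
        - heatExt (fun y => cutoff ρ c y * v a y) (b - a) c := by
    simp only [heatExt_eq_kernel _ hba]
    rw [← integral_const_mul, ← integral_sub ((integrable_heatKer_mul hci hba c).const_mul K)
      (integrable_heatKer_mul hfi hba c)]
    congr 1; ext y; ring
  have e2 : ∫ y, heatKer n (b - a) ‖y - c‖ * (1 - cutoff ρ c y)
      = 1 - heatExt (cutoff ρ c) (b - a) c := by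
    simp only [mul_sub, mul_one]
    rw [heatExt_eq_kernel _ hba, integral_sub (integrable_heatKer_sub hba c)
      (integrable_heatKer_mul hci hba c), integral_heatKer_sub hba c]
  rw [e2] at hone
  rw [e1] at u1
  rw [abs_le]
  constructor
  · nlinarith [mul_nonneg hK0 htail.le]
  · nlinarith [mul_le_mul_of_nonneg_left hone.2 hK0]

lemma SepSol.mono_ball {n : ℕ} {v : ℝ → Euc n → ℝ} {a b ρ ρ' : ℝ} {c c' : Euc n}
    (h : SepSol v a b c ρ) (hc : dist c' c + ρ' ≤ ρ) : SepSol v a b c' ρ' where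
  nonneg t ht x hx := h.nonneg t ht x (closedBall_subset_closedBall' (by linarith) hx)
  lip t ht := (h.lip t ht).imp fun _ hk => hk.mono (closedBall_subset_closedBall' (by linarith))
  cont_time x hx := h.cont_time x (closedBall_subset_closedBall' (by linarith) hx)
  heat t ht x hx := h.heat t ht x (ball_subset_ball' (by linarith) hx)

lemma rpow_mul_sq (n : ℕ) {θ δ : ℝ} (hθ : 0 ≤ θ) (hδ : 0 < δ) :
    (4 * π * (θ * δ ^ 2)) ^ (-(n : ℝ) / 2) = (4 * π * θ) ^ (-(n : ℝ) / 2) * (δ ^ n)⁻¹ := by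
  rw [← mul_assoc, Real.mul_rpow (by positivity) (by positivity)]
  congr 1
  rw [← Real.rpow_natCast δ 2, ← Real.rpow_mul hδ.le, ← Real.rpow_natCast δ n,
    ← Real.rpow_neg hδ.le]
  congr 1; push_cast; ring

lemma heatKer_parabolic_scale (n : ℕ) {θ ρ : ℝ} (hθ : 0 < θ) (hρ : 0 < ρ) (r : ℝ) :
    heatKer n (θ * ρ ^ 2) (r * ρ) = (ρ ^ n)⁻¹ * heatKer n θ r := by
  unfold heatKer
  rw [rpow_mul_sq n hθ.le hρ]
  have : -(r * ρ) ^ 2 / (4 * (θ * ρ ^ 2)) = -r ^ 2 / (4 * θ) := by field_simp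
  rw [this]; ring

lemma exists_small_time (n : ℕ) : ∃ θ > (0 : ℝ), θ ≤ 3 / 4 ∧ 2 * n * θ ≤ 1 / 16 ∧
    4 * 2 ^ n * (2 ^ ((n : ℝ) / 2) * exp (-1 / (256 * θ))) ≤ 1 := by
  have h1 : Tendsto (fun θ : ℝ => 4 * 2 ^ n * (2 ^ ((n : ℝ) / 2) * exp (-1 / (256 * θ))))
      (𝓝[>] 0) (𝓝 (4 * 2 ^ n * (2 ^ ((n : ℝ) / 2) * 0))) := by
    refine Tendsto.const_mul _ (Tendsto.const_mul _ (Real.tendsto_exp_atBot.comp ?_))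
    have : (fun θ : ℝ => -1 / (256 * θ)) = fun θ => (-1 / 256) * θ⁻¹ := by
      ext θ; rw [div_mul_eq_div_div, div_eq_mul_inv (-1 / 256)]
    rw [this]
    exact tendsto_inv_nhdsGT_zero.const_mul_atTop_of_neg (by norm_num)
  have h2 : Tendsto (fun θ : ℝ => 2 * n * θ) (𝓝[>] 0) (𝓝 (2 * n * 0)) :=
    ((continuous_const.mul continuous_id).tendsto 0).mono_left nhdsWithin_le_nhds
  obtain ⟨θ, ⟨ha, hb⟩, hc, hd⟩ := ((h1.eventually (ge_mem_nhds (by simp : _ < (1 : ℝ)))).and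
    (h2.eventually (ge_mem_nhds (by simp : _ < (1 / 16 : ℝ))))).and
    (Ioc_mem_nhdsGT (show (0 : ℝ) < 3 / 4 by norm_num)) |>.exists
  exact ⟨θ, hc, hd, hb, ha⟩

/-- A mean value inequality for bounded solutions. -/
lemma exists_mean_value_const (n : ℕ) : ∃ C > (0 : ℝ), ∀ (u : ℝ → Euc n → ℝ) (s₀ : ℝ) (y₀ : Euc n)
    (d K m : ℝ), 0 < d → SepSol u (s₀ - d ^ 2) s₀ y₀ d →
    (∀ s ∈ Icc (s₀ - d ^ 2) s₀, ∀ x ∈ closedBall y₀ d, u s x ≤ K) →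
    (∀ s ∈ Icc (s₀ - d ^ 2) s₀, ∫ x in closedBall y₀ d, u s x ≤ m) →
    d ^ n * u s₀ y₀ ≤ C * m := by
  obtain ⟨θ, hθ, hθ1, hθ2, hθ3⟩ := exists_small_time n
  refine ⟨2 * (4 * π * θ) ^ (-(n : ℝ) / 2), by positivity, ?_⟩
  intro u s₀ y₀ d K m hd hu hK hm
  set B := (4 * π * θ) ^ (-(n : ℝ) / 2) with hB
  have hB0 : 0 < B := by positivity
  set V : Set ℝ := {q | ∃ s x δ, 0 < δ ∧ dist x y₀ + δ ≤ d ∧ δ ^ 2 ≤ s - s₀ + d ^ 2 ∧ s ≤ s₀ ∧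
    q = δ ^ n * u s x} with hV
  have hmem : d ^ n * u s₀ y₀ ∈ V := ⟨s₀, y₀, d, hd, by simp, by simp, le_rfl, rfl⟩
  have hK0 : 0 ≤ K := (hu.nonneg s₀ ⟨by nlinarith, le_rfl⟩ y₀ (mem_closedBall_self hd.le)).trans
    (hK s₀ ⟨by nlinarith, le_rfl⟩ y₀ (mem_closedBall_self hd.le))
  have hbdd : BddAbove V := by
    refine ⟨d ^ n * K, ?_⟩
    rintro q ⟨s, x, δ, hδ, hx, hs, hs', rfl⟩
    have hδd : δ ≤ d := by linarith [dist_nonneg (x := x) (y := y₀)]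
    have h1 : u s x ≤ K := hK s ⟨by nlinarith, hs'⟩ x (by rw [mem_closedBall]; linarith)
    calc δ ^ n * u s x ≤ δ ^ n * K := by gcongr
      _ ≤ d ^ n * K := by gcongr
  set S := sSup V with hS
  have hS0 : 0 ≤ S := by
    refine le_trans ?_ (le_csSup hbdd hmem)
    exact mul_nonneg (by positivity)
      (hu.nonneg s₀ ⟨by nlinarith, le_rfl⟩ y₀ (mem_closedBall_self hd.le))
  have hstep : S ≤ S / 2 + B * m := by
    refine csSup_le ⟨_, hmem⟩ ?_
    rintro q ⟨s, x, δ, hδ, hx, hs, hs', rfl⟩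
    have hδn : 0 < δ ^ n := by positivity
    have hδ2 : 0 < δ ^ 2 := by positivity
    have hlow : s₀ - d ^ 2 ≤ s - θ * δ ^ 2 := by nlinarith
    have hθδ : 0 < θ * δ ^ 2 := by positivity
    have hsol : SepSol u (s - θ * δ ^ 2) s x (δ / 2) :=
      (hu.mono hlow hs').mono_ball (by linarith)
    have hbound : ∀ t ∈ Icc (s - θ * δ ^ 2) s, ∀ y ∈ closedBall x (δ / 2),
        u t y ≤ S * 2 ^ n / δ ^ n := by
      intro t ht y hy
      have hq : (δ / 2) ^ n * u t y ∈ V := by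
        refine ⟨t, y, δ / 2, by positivity, ?_, ?_, ht.2.trans hs', rfl⟩
        · have := dist_triangle y x y₀
          rw [mem_closedBall] at hy
          linarith
        · nlinarith [ht.1]
      have h1 := le_csSup hbdd hq
      rw [le_div_iff₀ hδn]
      calc u t y * δ ^ n = (δ / 2) ^ n * u t y * 2 ^ n := by
            rw [div_pow]; field_simp
        _ ≤ S * 2 ^ n := by gcongr
    have hest := hsol.abs_sub_heatExt_le (by linarith) (by positivity)
      (by rw [sub_sub_cancel]; nlinarith) hbound
    rw [sub_sub_cancel] at hest
    have hsI : s - θ * δ ^ 2 ∈ Icc (s - θ * δ ^ 2) s := ⟨le_rfl, by linarith⟩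
    have hcint := integrable_cutoff_mul (half_pos hδ) (hsol.cont_space hsI)
    have hc0 : ∀ y, 0 ≤ cutoff (δ / 2) x y * u (s - θ * δ ^ 2) y := by
      intro y
      by_cases hy : y ∈ closedBall x (δ / 2)
      · exact mul_nonneg (cutoff_nonneg _ _ _) (hsol.nonneg _ hsI y hy)
      · rw [mem_closedBall, dist_eq_norm, not_le] at hy
        rw [cutoff_eq_zero (by linarith) (by linarith), zero_mul]
    have hmass : ∫ y, cutoff (δ / 2) x y * u (s - θ * δ ^ 2) y ≤ m := by
      have hsI' : s - θ * δ ^ 2 ∈ Icc (s₀ - d ^ 2) s₀ := ⟨hlow, by linarith⟩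
      refine le_trans ?_ (hm _ hsI')
      rw [← integral_indicator measurableSet_closedBall]
      refine integral_mono hcint ((integrable_indicator_iff measurableSet_closedBall).2
        ((hu.cont_space hsI').integrableOn_compact (isCompact_closedBall _ _))) fun y => ?_
      simp only
      by_cases hy : y ∈ closedBall y₀ d
      · rw [indicator_of_mem hy]
        exact mul_le_of_le_one_left (hu.nonneg _ hsI' y hy) (cutoff_le_one _ _ _)
      · rw [indicator_of_notMem hy, cutoff_eq_zero (by linarith), zero_mul]
        rw [mem_closedBall, not_le] at hy
        have := dist_triangle y x y₀
        rw [dist_eq_norm y x] at this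
        linarith
    have hheat := heatExt_le_mass hcint hc0 hθδ x
    rw [rpow_mul_sq n hθ.le hδ] at hheat
    have htail : gaussTail n (θ * δ ^ 2) (δ / 2) = 2 ^ ((n : ℝ) / 2) * exp (-1 / (256 * θ)) := by
      unfold gaussTail
      congr 2; field_simp; ring
    rw [htail] at hest
    have hest' := (abs_le.1 hest).2
    set τ := (2 : ℝ) ^ ((n : ℝ) / 2) * exp (-1 / (256 * θ)) with hτ
    have h1 : u s x ≤ 2 * (S * 2 ^ n / δ ^ n) * τ + B * (δ ^ n)⁻¹ * m := by
      have : B * (δ ^ n)⁻¹ * ∫ y, cutoff (δ / 2) x y * u (s - θ * δ ^ 2) y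
          ≤ B * (δ ^ n)⁻¹ * m := by gcongr
      linarith
    calc δ ^ n * u s x ≤ δ ^ n * (2 * (S * 2 ^ n / δ ^ n) * τ + B * (δ ^ n)⁻¹ * m) := by gcongr
      _ = S * (4 * 2 ^ n * τ) / 2 + B * m := by field_simp; ring
      _ ≤ S * 1 / 2 + B * m := by gcongr
      _ = S / 2 + B * m := by ring
  have := le_csSup hbdd hmem
  linarith

/-- A scale-invariant weak Harnack inequality. -/
lemma exists_harnack_const {n : ℕ} (hn : 0 < n) : ∃ C > (0 : ℝ), ∀ (u : ℝ → Euc n → ℝ) (s : ℝ)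
    (z : Euc n) (ρ : ℝ), 0 < ρ → SepSol u s (s + 1 / (8 * n) * ρ ^ 2) z ρ →
    ∫ x in closedBall z (ρ / 4), u s x ≤ C * ρ ^ n * u (s + 1 / (8 * n) * ρ ^ 2) z := by
  have hn' : (0 : ℝ) < n := by exact_mod_cast hn
  set θ : ℝ := 1 / (8 * n) with hθ
  have hθ0 : 0 < θ := by positivity
  have hc : 0 < heatKer n θ (1 / 4) - heatKer n θ (1 / 2) := by
    rw [sub_pos]; unfold heatKer
    gcongr
    norm_num
  refine ⟨(heatKer n θ (1 / 4) - heatKer n θ (1 / 2))⁻¹, by positivity, ?_⟩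
  intro u s z ρ hρ hu
  have h := hu.weak_harnack (by linarith [show 0 < θ * ρ ^ 2 by positivity]) hρ (by
    rw [add_sub_cancel_left, hθ]; field_simp; norm_num)
  rw [add_sub_cancel_left, show ρ / 4 = 1 / 4 * ρ by ring, show ρ / 2 = 1 / 2 * ρ by ring,
    heatKer_parabolic_scale n hθ0 hρ, heatKer_parabolic_scale n hθ0 hρ, ← mul_sub] at h
  rw [show ρ / 4 = 1 / 4 * ρ by ring]
  set I := ∫ x in closedBall z (1 / 4 * ρ), u s x
  set c := heatKer n θ (1 / 4) - heatKer n θ (1 / 2)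
  have hρn : 0 < ρ ^ n := by positivity
  calc I = c⁻¹ * ρ ^ n * ((ρ ^ n)⁻¹ * c * I) := by field_simp
    _ ≤ _ := by gcongr

/-- `u` is a nonnegative solution of the heat equation on `(0, T) × ball 0 R`, with regularity
assumed only in each variable separately. -/
def LocSepSol {n : ℕ} (u : ℝ → Euc n → ℝ) (T R : ℝ) : Prop :=
  ∀ a b c ρ, 0 < a → b < T → ‖c‖ + ρ < R → SepSol u a b c ρ

/-- `u` is bounded above near `p`. -/
def LocBdd {n : ℕ} (u : ℝ → Euc n → ℝ) (p : ℝ × Euc n) : Prop :=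
  ∃ ε > 0, ∃ K, ∀ q ∈ ball p ε, u q.1 q.2 ≤ K

lemma isOpen_locBdd {n : ℕ} (u : ℝ → Euc n → ℝ) : IsOpen {p | LocBdd u p} := by
  rw [Metric.isOpen_iff]
  rintro p ⟨ε, hε, K, hK⟩
  refine ⟨ε / 2, half_pos hε, fun q hq => ⟨ε / 2, half_pos hε, K, fun r hr => hK r ?_⟩⟩
  rw [mem_ball] at *
  linarith [dist_triangle r q p]

lemma IsCompact.exists_bound_of_locBdd {n : ℕ} {u : ℝ → Euc n → ℝ} {S : Set (ℝ × Euc n)}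
    (hS : IsCompact S) (h : ∀ p ∈ S, LocBdd u p) : ∃ K, ∀ p ∈ S, u p.1 p.2 ≤ K := by
  refine hS.induction_on (p := fun S => ∃ K, ∀ p ∈ S, u p.1 p.2 ≤ K) ⟨0, by simp⟩
    (fun s t hst ⟨K, hK⟩ => ⟨K, fun p hp => hK p (hst hp)⟩) ?_ ?_
  · rintro s t ⟨K, hK⟩ ⟨K', hK'⟩
    exact ⟨max K K', fun p hp => hp.elim (fun h => (hK p h).trans (le_max_left _ _))
      fun h => (hK' p h).trans (le_max_right _ _)⟩
  · intro p hp
    obtain ⟨ε, hε, K, hK⟩ := h p hp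
    exact ⟨_, mem_nhdsWithin_of_mem_nhds (ball_mem_nhds p hε), K, hK⟩

section
variable {n : ℕ} {u : ℝ → Euc n → ℝ} {T R : ℝ}

lemma LocSepSol.continuousOn_space (h : LocSepSol u T R) {s : ℝ} (hs : s ∈ Ioo 0 T) :
    ContinuousOn (u s) (ball 0 R) := by
  intro x hx
  rw [mem_ball_zero_iff] at hx
  have h1 := h s s x ((R - ‖x‖) / 2) hs.1 hs.2 (by linarith)
  exact ((h1.cont_space (left_mem_Icc.2 le_rfl)).continuousAt
    (closedBall_mem_nhds _ (by linarith))).continuousWithinAt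

lemma LocSepSol.continuousAt_time (h : LocSepSol u T R) {s : ℝ} (hs : s ∈ Ioo 0 T) {x : Euc n}
    (hx : x ∈ ball 0 R) : ContinuousAt (fun t => u t x) s := by
  rw [mem_ball_zero_iff] at hx
  have h1 := h (s / 2) ((s + T) / 2) x ((R - ‖x‖) / 2) (by linarith [hs.1]) (by linarith [hs.2])
    (by linarith)
  exact (h1.cont_time x (mem_closedBall_self (by linarith))).continuousAt
    (Icc_mem_nhds (by linarith [hs.1]) (by linarith [hs.2]))

/-- Times at which `u` is controlled by `k` on a time interval of length comparable to `1 / k`. -/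
def timeBdd (u : ℝ → Euc n → ℝ) (T : ℝ) (S : Set (ℝ × Euc n)) (k : ℕ) : Set (ℝ × Euc n) :=
  {p ∈ S | ∀ s, |s - p.1| < 1 / ((k : ℝ) + 1) → s ∈ Ioo 0 T → u s p.2 ≤ k}

lemma LocSepSol.isClosed_timeBdd (h : LocSepSol u T R) {S : Set (ℝ × Euc n)} (hS : IsClosed S)
    (hSD : S ⊆ Ioo 0 T ×ˢ ball 0 R) (k : ℕ) : IsClosed (timeBdd u T S k) := by
  refine IsSeqClosed.isClosed fun p q hp hpq => ?_
  have hq : q ∈ S := hS.mem_of_tendsto hpq (Eventually.of_forall fun j => (hp j).1)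
  refine ⟨hq, fun s hs hsT => ?_⟩
  have h1 : Tendsto (fun j => u s (p j).2) atTop (𝓝 (u s q.2)) :=
    ((h.continuousOn_space hsT).continuousAt (isOpen_ball.mem_nhds (hSD hq).2)).tendsto.comp
      ((continuous_snd.tendsto q).comp hpq)
  have h2 : Tendsto (fun j => |s - (p j).1|) atTop (𝓝 |s - q.1|) :=
    ((continuous_const.sub continuous_fst).abs.tendsto q).comp hpq
  refine le_of_tendsto h1 ?_
  filter_upwards [h2.eventually (gt_mem_nhds hs)] with j hj using (hp j).2 s hj hsT

lemma LocSepSol.exists_mem_timeBdd (h : LocSepSol u T R) {S : Set (ℝ × Euc n)}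
    (hSD : S ⊆ Ioo 0 T ×ˢ ball 0 R) {p : ℝ × Euc n} (hp : p ∈ S) :
    ∃ k, p ∈ timeBdd u T S k := by
  have hc := h.continuousAt_time (hSD hp).1 (hSD hp).2
  obtain ⟨ε, hε, hu⟩ := Metric.eventually_nhds_iff.1
    (hc.eventually (gt_mem_nhds (lt_add_one (u p.1 p.2))))
  obtain ⟨k₁, hk₁⟩ := exists_nat_ge (u p.1 p.2 + 1)
  obtain ⟨k₂, hk₂⟩ := exists_nat_one_div_lt hε
  refine ⟨max k₁ k₂, hp, fun s hs _ => ?_⟩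
  have h1 : (1 : ℝ) / ((max k₁ k₂ : ℕ) + 1) ≤ 1 / ((k₂ : ℝ) + 1) := by
    gcongr; exact le_max_right _ _
  have h2 : (k₁ : ℝ) ≤ (max k₁ k₂ : ℕ) := by exact_mod_cast le_max_left _ _
  have := hu (y := s) (by rw [Real.dist_eq]; linarith)
  linarith

/-- Bound away from a set on which `u` is controlled. -/
lemma LocSepSol.locBdd_of_bound (hn : 0 < n) (h : LocSepSol u T R) {p : ℝ × Euc n} {δ k : ℝ}
    {X : Set (Euc n)} (hδ : 0 < δ) (ht : δ < p.1) (ht' : p.1 + δ < T) (hx : ‖p.2‖ + δ < R)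
    (hpX : p.2 ∈ X) (hX : ∀ z ∈ X, ∀ s, |s - p.1| < δ → u s z ≤ k)
    (hloc : ∀ q ∈ ball p δ, q.2 ∉ X → LocBdd u q) : LocBdd u p := by
  obtain ⟨C₁, hC₁, hmean⟩ := exists_mean_value_const n
  obtain ⟨C₂, hC₂, hharn⟩ := exists_harnack_const hn
  have hn1 : (1 : ℝ) ≤ n := by exact_mod_cast hn
  set η := min 1 (δ / 100) with hη
  have hη0 : 0 < η := by positivity
  have hη1 : η ≤ 1 := min_le_left _ _
  have hηδ : 100 * η ≤ δ := by have := min_le_right 1 (δ / 100); linarith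
  refine ⟨η, hη0, max k (C₁ * (C₂ * 20 ^ n * k)), ?_⟩
  rintro ⟨s, y⟩ hq
  rw [mem_ball, Prod.dist_eq, max_lt_iff, Real.dist_eq, abs_lt] at hq
  obtain ⟨⟨hs1, hs2⟩, hy⟩ := hq
  simp only at hs1 hs2 hy ⊢
  have hyn : ‖y‖ ≤ ‖p.2‖ + η := by
    have := norm_le_norm_add_norm_sub' y p.2
    rw [dist_eq_norm] at hy; linarith
  have hsT : s ∈ Ioo 0 T := ⟨by linarith, by linarith⟩
  rcases (infDist_nonneg (x := y) (s := X)).eq_or_lt with h0 | hd0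
  · refine le_trans ?_ (le_max_left _ _)
    have hycl : y ∈ closure X := (mem_closure_iff_infDist_zero ⟨_, hpX⟩).2 h0.symm
    obtain ⟨z, hz, hzy⟩ := mem_closure_iff_seq_limit.1 hycl
    have hc := (h.continuousOn_space hsT).continuousAt (x := y)
      (isOpen_ball.mem_nhds (mem_ball_zero_iff.2 (by linarith)))
    refine le_of_tendsto' (hc.tendsto.comp hzy) fun j => hX _ (hz j) s ?_
    rw [abs_lt]; constructor <;> linarith
  · refine le_trans ?_ (le_max_right _ _)
    set d := infDist y X / 2 with hd
    have hdpos : 0 < d := by positivity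
    have hdη : 2 * d < η := by
      have := infDist_le_dist_of_mem (x := y) hpX
      linarith
    obtain ⟨z, hz, hyz⟩ := (infDist_lt_iff (r := 4 * d) ⟨_, hpX⟩).1 (by linarith)
    have hd2 : d ^ 2 ≤ η := by nlinarith
    have hcyl : ∀ q ∈ Icc (s - d ^ 2) s ×ˢ closedBall y d, LocBdd u q := by
      rintro ⟨t, w⟩ ⟨htm, hw⟩
      rw [mem_closedBall] at hw
      simp only [mem_Icc] at htm hw
      refine hloc _ ?_ fun hwX => ?_
      · rw [mem_ball, Prod.dist_eq, max_lt_iff, Real.dist_eq, abs_lt]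
        refine ⟨⟨?_, ?_⟩, ?_⟩
        · simp only; linarith
        · simp only; linarith
        · simp only; linarith [dist_triangle w y p.2]
      · have := infDist_le_dist_of_mem (x := y) hwX
        rw [dist_comm] at this
        linarith
    obtain ⟨K, hK⟩ := (isCompact_Icc.prod (isCompact_closedBall y d)).exists_bound_of_locBdd hcyl
    have hsol : SepSol u (s - d ^ 2) s y d := h _ _ _ _ (by linarith) hsT.2 (by linarith)
    have hzn : ‖z‖ ≤ ‖y‖ + 4 * d := by
      have := norm_le_norm_add_norm_sub' z y
      rw [dist_comm, dist_eq_norm] at hyz; linarith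
    have hmass : ∀ t ∈ Icc (s - d ^ 2) s, ∫ x in closedBall y d, u t x
        ≤ C₂ * (20 * d) ^ n * k := by
      intro t htm
      have hτ0 : 0 < 1 / (8 * (n : ℝ)) * (20 * d) ^ 2 := by positivity
      have hτ1 : 1 / (8 * (n : ℝ)) * (20 * d) ^ 2 ≤ 13 * η := by
        have : 1 / (8 * (n : ℝ)) ≤ 1 / 8 := by
          apply one_div_le_one_div_of_le <;> linarith
        have h2 : (20 * d) ^ 2 ≤ 100 * η := by nlinarith
        calc 1 / (8 * (n : ℝ)) * (20 * d) ^ 2 ≤ 1 / 8 * (100 * η) := by gcongr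
          _ ≤ _ := by linarith
      have hsolz : SepSol u t (t + 1 / (8 * n) * (20 * d) ^ 2) z (20 * d) :=
        h _ _ _ _ (by linarith [htm.1]) (by linarith [htm.2]) (by linarith)
      have h1 := hharn u t z (20 * d) (by positivity) hsolz
      have htI : t ∈ Icc t (t + 1 / (8 * n) * (20 * d) ^ 2) := ⟨le_rfl, by linarith⟩
      have hsub : closedBall z (20 * d / 4) ⊆ closedBall z (20 * d) :=
        closedBall_subset_closedBall (by linarith)
      calc ∫ x in closedBall y d, u t x ≤ ∫ x in closedBall z (20 * d / 4), u t x := by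
            refine setIntegral_mono_set ?_ ?_ ?_
            · exact ((hsolz.cont_space htI).mono hsub).integrableOn_compact
                (isCompact_closedBall _ _)
            · refine (ae_restrict_iff' measurableSet_closedBall).2 (Eventually.of_forall ?_)
              exact fun x hx => hsolz.nonneg t htI x (hsub hx)
            · exact (closedBall_subset_closedBall' (by linarith)).eventuallyLE
        _ ≤ C₂ * (20 * d) ^ n * u (t + 1 / (8 * n) * (20 * d) ^ 2) z := h1
        _ ≤ C₂ * (20 * d) ^ n * k := by
            gcongr
            refine hX z hz _ ?_
            rw [abs_lt]; constructor <;> linarith [htm.1, htm.2]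
    have hfin := hmean u s y d K _ hdpos hsol (fun t ht' x hx' => hK (t, x) ⟨ht', hx'⟩) hmass
    have hdn : 0 < d ^ n := by positivity
    rw [mul_pow] at hfin
    refine le_of_mul_le_mul_left ?_ hdn
    calc d ^ n * u s y ≤ _ := hfin
      _ = _ := by ring

/-- A separately regular nonnegative solution of the heat equation is locally bounded. -/
lemma LocSepSol.locBdd (hn : 0 < n) (h : LocSepSol u T R) {p : ℝ × Euc n}
    (hp : p ∈ Ioo 0 T ×ˢ ball 0 R) : LocBdd u p := by
  by_contra hcon
  have hD : IsOpen (Ioo 0 T ×ˢ ball (0 : Euc n) R) := isOpen_Ioo.prod isOpen_ball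
  obtain ⟨r, hr, hrD⟩ := Metric.nhds_basis_closedBall.mem_iff.1 (hD.mem_nhds hp)
  set Z : Set (ℝ × Euc n) := {q | ¬ LocBdd u q} with hZ
  have hZc : IsClosed Z := (isOpen_locBdd u).isClosed_compl
  set F := closure (Z ∩ ball p r) with hF
  have hFZ : F ⊆ Z := closure_minimal inter_subset_left hZc
  have hFr : F ⊆ closedBall p r :=
    closure_minimal (inter_subset_right.trans ball_subset_closedBall) isClosed_closedBall
  have hFD : F ⊆ Ioo 0 T ×ˢ ball 0 R := hFr.trans hrD
  have hpF : p ∈ F := subset_closure ⟨hcon, mem_ball_self hr⟩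
  obtain ⟨k, q, hq, δ, hδ, hsub⟩ := exists_ball_inter_subset_of_baire isClosed_closure ⟨p, hpF⟩
    (fun k => h.isClosed_timeBdd (isClosed_closure : IsClosed F) hFD k)
    (fun x hx => mem_iUnion.2 (h.exists_mem_timeBdd hFD hx))
  obtain ⟨q', ⟨hq'Z, hq'r⟩, hqq'⟩ := Metric.mem_closure_iff.1 hq δ hδ
  have hq'δ : q' ∈ ball q δ := by rwa [mem_ball, dist_comm]
  have hnhds : ball q δ ∩ (ball p r ∩ Ioo 0 T ×ˢ ball (0 : Euc n) R) ∈ 𝓝 q' :=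
    inter_mem (isOpen_ball.mem_nhds hq'δ) (inter_mem (isOpen_ball.mem_nhds hq'r)
      (hD.mem_nhds (hrD (ball_subset_closedBall hq'r))))
  obtain ⟨ε, hε, hεs⟩ := Metric.mem_nhds_iff.1 hnhds
  have hq'D := hrD (ball_subset_closedBall hq'r)
  have hq'R : ‖q'.2‖ < R := mem_ball_zero_iff.1 hq'D.2
  have hk : (0 : ℝ) < 1 / ((k : ℝ) + 1) := by positivity
  obtain ⟨e, he, heu⟩ : ∃ e > (0 : ℝ), e < ε ∧ e ≤ 1 / ((k : ℝ) + 1) / 2 ∧ e < q'.1 ∧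
      e < T - q'.1 ∧ e < R - ‖q'.2‖ := by
    have hm : 0 < min ε (min (1 / ((k : ℝ) + 1)) (min q'.1 (min (T - q'.1) (R - ‖q'.2‖)))) := by
      refine lt_min hε (lt_min hk (lt_min hq'D.1.1 (lt_min ?_ ?_)))
      · linarith [hq'D.1.2]
      · linarith
    obtain ⟨e, he1, he2⟩ := exists_between (half_pos hm)
    set mm := min ε (min (1 / ((k : ℝ) + 1)) (min q'.1 (min (T - q'.1) (R - ‖q'.2‖))))
    have h1 : mm ≤ ε := min_le_left _ _
    have h2 : mm ≤ 1 / ((k : ℝ) + 1) := (min_le_right _ _).trans (min_le_left _ _)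
    have h3 : mm ≤ q'.1 := (min_le_right _ _).trans ((min_le_right _ _).trans (min_le_left _ _))
    have h4 : mm ≤ T - q'.1 := (min_le_right _ _).trans ((min_le_right _ _).trans
      ((min_le_right _ _).trans (min_le_left _ _)))
    have h5 : mm ≤ R - ‖q'.2‖ := (min_le_right _ _).trans ((min_le_right _ _).trans
      ((min_le_right _ _).trans (min_le_right _ _)))
    exact ⟨e, he1, by linarith, by linarith, by linarith, by linarith, by linarith⟩
  obtain ⟨he1, he2, he3, he4, he5⟩ := heu
  have hkey : ∀ w ∈ Z, w ∈ ball q' e → ∀ s, |s - q'.1| < e → u s w.2 ≤ k := by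
    intro w hwZ hw s hs
    have hw' := hεs (ball_subset_ball he1.le hw)
    have hwA := hsub ⟨hw'.1, subset_closure ⟨hwZ, hw'.2.1⟩⟩
    rw [mem_ball, Prod.dist_eq, max_lt_iff, Real.dist_eq] at hw
    rw [abs_lt] at hs
    refine hwA.2 s ?_ ⟨by linarith, by linarith⟩
    have := abs_lt.1 hw.1
    rw [abs_lt]; constructor <;> linarith
  refine hq'Z (h.locBdd_of_bound hn (p := q') (k := k) (X := {x | ∃ t, (t, x) ∈ Z ∩ ball q' e}) he he3
    (by linarith) (by linarith) ⟨q'.1, hq'Z, mem_ball_self he⟩ ?_ ?_)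
  · rintro z ⟨t, htZ, ht⟩ s hs
    exact hkey (t, z) htZ ht s hs
  · intro w hw hwX
    by_contra hwZ
    exact hwX ⟨w.1, hwZ, hw⟩

lemma LocSepSol.exists_bound (hn : 0 < n) (h : LocSepSol u T R) {a b R' : ℝ} (ha : 0 < a)
    (hb : b < T) (hR : R' < R) :
    ∃ K, ∀ t ∈ Icc a b, ∀ x ∈ closedBall (0 : Euc n) R', u t x ≤ K := by
  obtain ⟨K, hK⟩ := (isCompact_Icc.prod (isCompact_closedBall (0 : Euc n) R')).exists_bound_of_locBdd
    (u := u) (S := Icc a b ×ˢ closedBall 0 R') fun p hp => h.locBdd hn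
      ⟨⟨ha.trans_le hp.1.1, hp.1.2.trans_lt hb⟩, closedBall_subset_ball hR hp.2⟩
  exact ⟨K, fun t ht x hx => hK (t, x) ⟨ht, hx⟩⟩

end

/-- Test functions supported in the closed ball of radius `ε` about the origin. -/
def IsTestIn {n : ℕ} (ε : ℝ) (ψ : Euc n → ℝ) : Prop := IsTest ψ ∧ tsupport ψ ⊆ closedBall 0 ε

/-- The convolution of `ψ` with `u t`. -/
def moll {n : ℕ} (u : ℝ → Euc n → ℝ) (ψ : Euc n → ℝ) (t : ℝ) (x : Euc n) : ℝ :=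
  ∫ y, ψ (x - y) * u t y

lemma IsTestIn.pderiv {n : ℕ} {ε : ℝ} {ψ : Euc n → ℝ} (h : IsTestIn ε ψ) (i : Fin n) :
    IsTestIn ε (pderiv i ψ) :=
  ⟨h.1.pderiv i, (closure_minimal (support_pderiv_subset ψ i) (isClosed_tsupport ψ)).trans h.2⟩

lemma IsTestIn.lap {n : ℕ} {ε : ℝ} {ψ : Euc n → ℝ} (h : IsTestIn ε ψ) : IsTestIn ε (lap ψ) := by
  refine ⟨h.1.lap, closure_minimal (fun x hx => ?_) isClosed_closedBall⟩
  rw [Function.mem_support, lap_eq_sum_pderiv] at hx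
  obtain ⟨i, _, hi⟩ := Finset.exists_ne_zero_of_sum_ne_zero hx
  exact ((h.pderiv i).pderiv i).2 (subset_closure hi)

lemma IsTestIn.eq_zero {n : ℕ} {ε : ℝ} {ψ : Euc n → ℝ} (h : IsTestIn ε ψ) {z : Euc n}
    (hz : ε < ‖z‖) : ψ z = 0 :=
  image_eq_zero_of_notMem_tsupport fun hm => by
    have := h.2 hm; rw [mem_closedBall_zero_iff] at this; linarith

lemma IsTestIn.eq_zero_sub {n : ℕ} {ε : ℝ} {ψ : Euc n → ℝ} (h : IsTestIn ε ψ) {x y : Euc n}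
    (hy : ‖x‖ + ε < ‖y‖) : ψ (x - y) = 0 := by
  refine h.eq_zero ?_
  have := norm_sub_norm_le y x
  rw [norm_sub_rev] at this; linarith

section
variable {n : ℕ} {u : ℝ → Euc n → ℝ} {T R ε : ℝ} {ψ : Euc n → ℝ}

lemma moll_congr_of_ball (hψ : IsTestIn ε ψ) {x : Euc n} {r : ℝ} (hr : ‖x‖ + ε ≤ r)
    {f : Euc n → ℝ} {t : ℝ} (hf : ∀ y ∈ closedBall (0 : Euc n) r, f y = u t y) :
    moll u ψ t x = ∫ y, ψ (x - y) * f y := by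
  refine integral_congr_ae (Eventually.of_forall fun y => ?_)
  simp only
  by_cases hy : ‖y‖ ≤ r
  · rw [hf y (mem_closedBall_zero_iff.2 hy)]
  · rw [hψ.eq_zero_sub (by linarith), zero_mul, zero_mul]

lemma IsTestIn.continuous_sub_mul (hψ : IsTestIn ε ψ) {g : Euc n → ℝ}
    (hg : ContinuousOn g (ball 0 R)) {x : Euc n} (hx : ‖x‖ + ε < R) :
    Continuous fun y => ψ (x - y) * g y := by
  rw [continuous_iff_continuousAt]
  intro y
  by_cases hy : ‖y‖ < R
  · exact (hψ.1.continuous.comp (continuous_const.sub continuous_id)).continuousAt.mul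
      (hg.continuousAt (isOpen_ball.mem_nhds (mem_ball_zero_iff.2 hy)))
  · refine (continuousAt_const (y := (0 : ℝ))).congr ?_
    have : ∀ᶠ z : Euc n in 𝓝 y, ‖x‖ + ε < ‖z‖ :=
      continuous_norm.continuousAt.eventually (lt_mem_nhds (by linarith))
    filter_upwards [this] with z hz
    rw [hψ.eq_zero_sub hz, zero_mul]

lemma IsTestIn.hasCompactSupport_sub_mul (hψ : IsTestIn ε ψ) (g : Euc n → ℝ) (x : Euc n) :
    HasCompactSupport fun y => ψ (x - y) * g y := by
  refine HasCompactSupport.intro (isCompact_closedBall (0 : Euc n) (‖x‖ + ε)) fun y hy => ?_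
  rw [mem_closedBall_zero_iff, not_le] at hy
  rw [hψ.eq_zero_sub hy, zero_mul]

lemma IsTestIn.integrable_sub_mul (hψ : IsTestIn ε ψ) {g : Euc n → ℝ}
    (hg : ContinuousOn g (ball 0 R)) {x : Euc n} (hx : ‖x‖ + ε < R) :
    Integrable fun y => ψ (x - y) * g y :=
  (hψ.continuous_sub_mul hg hx).integrable_of_hasCompactSupport
    (hψ.hasCompactSupport_sub_mul g x)

lemma LocSepSol.continuous_moll_integrand (h : LocSepSol u T R) (hψ : IsTestIn ε ψ) {t : ℝ}
    (ht : t ∈ Ioo 0 T) {x : Euc n} (hx : ‖x‖ + ε < R) :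
    Continuous fun y => ψ (x - y) * u t y :=
  hψ.continuous_sub_mul (h.continuousOn_space ht) hx

lemma LocSepSol.nonneg (h : LocSepSol u T R) {t : ℝ} (ht : t ∈ Ioo 0 T) {x : Euc n}
    (hx : ‖x‖ < R) : 0 ≤ u t x :=
  (h t t x 0 ht.1 ht.2 (by linarith)).nonneg t (left_mem_Icc.2 le_rfl) x
    (mem_closedBall_self le_rfl)

lemma LocSepSol.continuousOn_moll (hn : 0 < n) (h : LocSepSol u T R) (hψ : IsTestIn ε ψ) :
    ContinuousOn (fun p : ℝ × Euc n => moll u ψ p.1 p.2) (Ioo 0 T ×ˢ ball 0 (R - ε)) := by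
  rintro ⟨t, x⟩ ⟨ht, hx⟩
  refine ContinuousAt.continuousWithinAt ?_
  rw [mem_ball_zero_iff] at hx
  simp only at ht hx
  obtain ⟨r, hr1, hr2⟩ := exists_between hx
  obtain ⟨K, hK⟩ := h.exists_bound hn (a := t / 2) (b := (t + T) / 2) (R' := r + ε)
    (by linarith [ht.1]) (by linarith [ht.2]) (by linarith)
  obtain ⟨M, hM⟩ := hψ.1.exists_bound
  have hM0 : 0 ≤ M := (abs_nonneg _).trans (hM 0)
  have hnhd : ∀ᶠ p : ℝ × Euc n in 𝓝 (t, x), p.1 ∈ Icc (t / 2) ((t + T) / 2) ∧ ‖p.2‖ < r := by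
    refine (continuous_fst.tendsto (t, x)).eventually
      (Icc_mem_nhds (by linarith [ht.1]) (by linarith [ht.2])) |>.and ?_
    exact (continuous_snd.norm.tendsto (t, x)).eventually (gt_mem_nhds hr1)
  refine continuousAt_of_dominated (bound := (closedBall (0 : Euc n) (r + ε)).indicator
    fun _ => M * |K|) ?_ ?_ ?_ ?_
  · filter_upwards [hnhd] with p hp
    exact (h.continuous_moll_integrand hψ ⟨by linarith [ht.1, hp.1.1], by linarith [ht.2, hp.1.2]⟩
      (by linarith)).aestronglyMeasurable
  · filter_upwards [hnhd] with p hp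
    refine Eventually.of_forall fun y => ?_
    by_cases hy : y ∈ closedBall (0 : Euc n) (r + ε)
    · rw [indicator_of_mem hy, norm_mul]
      have h0 : 0 ≤ u p.1 y :=
        h.nonneg ⟨by linarith [ht.1, hp.1.1], by linarith [ht.2, hp.1.2]⟩
          (by rw [mem_closedBall_zero_iff] at hy; linarith)
      refine mul_le_mul (hM _) ?_ (norm_nonneg _) hM0
      rw [Real.norm_of_nonneg h0]
      exact (hK _ hp.1 y hy).trans (le_abs_self _)
    · rw [indicator_of_notMem hy]
      rw [mem_closedBall_zero_iff, not_le] at hy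
      rw [hψ.eq_zero_sub (by linarith), zero_mul, norm_zero]
  · exact (integrable_indicator_iff measurableSet_closedBall).2
      (continuousOn_const.integrableOn_compact (isCompact_closedBall _ _))
  · refine Eventually.of_forall fun y => ?_
    by_cases hy : ‖y‖ < R
    · refine ContinuousAt.mul ?_ ?_
      · exact (hψ.1.continuous.comp (continuous_snd.sub continuous_const)).continuousAt
      · exact ContinuousAt.comp (g := fun t => u t y) (f := Prod.fst) (x := (t, x))
          (h.continuousAt_time ht (mem_ball_zero_iff.2 hy)) continuousAt_fst
    · refine (continuousAt_const (y := (0 : ℝ))).congr ?_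
      filter_upwards [hnhd] with p hp
      rw [hψ.eq_zero_sub (by linarith), zero_mul]

lemma LocSepSol.hasDerivAt_moll_line (h : LocSepSol u T R) (hψ : IsTestIn ε ψ) {t : ℝ}
    (ht : t ∈ Ioo 0 T) {x : Euc n} (hx : ‖x‖ + ε < R) (i : Fin n) :
    HasDerivAt (fun r : ℝ => moll u ψ t (x + r • basisVec i)) (moll u (pderiv i ψ) t x) 0 := by
  obtain ⟨r, hr1, hr2⟩ := exists_between hx
  set f := (closedBall (0 : Euc n) r).indicator (u t) with hf
  have hfi : Integrable f := by
    refine (integrable_indicator_iff measurableSet_closedBall).2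
      (((h.continuousOn_space ht).mono ?_).integrableOn_compact (isCompact_closedBall _ _))
    exact closedBall_subset_ball hr2
  have hfe : ∀ y ∈ closedBall (0 : Euc n) r, f y = u t y := fun y hy => indicator_of_mem hy _
  have hd := hasDerivAt_integral_mul_of_support (isCompact_closedBall (0 : Euc n) r) hfi
    (fun y hy => indicator_of_notMem hy _) (K := fun q y => ψ (x + q • basisVec i - y))
    (K' := fun q y => pderiv i ψ (x + q • basisVec i - y)) (r₀ := 0) one_pos
    (fun q _ y => by
      have := hψ.1.hasDerivAt_line i (x - y) q
      simpa only [sub_add_eq_add_sub] using this)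
    (fun q _ => hψ.1.continuous.comp (by fun_prop))
    ((hψ.pderiv i).1.continuous.comp (by fun_prop)).continuousOn
  rw [moll_congr_of_ball (hψ.pderiv i) hr1.le hfe]
  simp only [zero_smul, add_zero] at hd
  refine hd.congr_of_eventuallyEq ?_
  have hc : ContinuousAt (fun q : ℝ => ‖x + q • basisVec i‖) 0 := by fun_prop
  have : ∀ᶠ q : ℝ in 𝓝 0, ‖x + q • basisVec i‖ < r - ε :=
    hc.eventually (gt_mem_nhds (by simpa using by linarith))
  filter_upwards [this] with q hq
  exact moll_congr_of_ball hψ (by linarith) hfe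

lemma gaussTail_le_sq (n : ℕ) {h ρ : ℝ} (hh : 0 < h) (hρ : 0 < ρ) :
    gaussTail n h ρ ≤ 2 ^ ((n : ℝ) / 2) * (2 * (64 / ρ ^ 2) ^ 2) * h ^ 2 := by
  unfold gaussTail
  rw [mul_assoc]
  gcongr
  set s := ρ ^ 2 / (64 * h) with hs
  have hs0 : 0 < s := by positivity
  have h1 : s ^ 2 / 2 ≤ exp s := by
    have := Real.quadratic_le_exp_of_nonneg hs0.le; linarith
  have e : -ρ ^ 2 / (64 * h) = -s := by rw [hs]; ring
  rw [e, Real.exp_neg]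
  calc (exp s)⁻¹ ≤ (s ^ 2 / 2)⁻¹ := inv_anti₀ (by positivity) h1
    _ = _ := by rw [hs]; field_simp; try norm_num

/-- A continuous radial cutoff, equal to `1` for `‖y‖ ≤ r₁` and to `0` for `r₂ ≤ ‖y‖`. -/
def radialCut (r₁ r₂ : ℝ) (y : Euc n) : ℝ := max 0 (min 1 ((r₂ - ‖y‖) / (r₂ - r₁)))

lemma radialCut_nonneg (r₁ r₂ : ℝ) (y : Euc n) : 0 ≤ radialCut r₁ r₂ y := le_max_left _ _

lemma radialCut_le_one (r₁ r₂ : ℝ) (y : Euc n) : radialCut r₁ r₂ y ≤ 1 :=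
  max_le zero_le_one (min_le_left _ _)

lemma radialCut_eq_one {r₁ r₂ : ℝ} (hr : r₁ < r₂) {y : Euc n} (hy : ‖y‖ ≤ r₁) :
    radialCut r₁ r₂ y = 1 := by
  have : 1 ≤ (r₂ - ‖y‖) / (r₂ - r₁) := by rw [le_div_iff₀ (by linarith)]; linarith
  rw [radialCut, min_eq_left this, max_eq_right zero_le_one]

lemma radialCut_eq_zero {r₁ r₂ : ℝ} (hr : r₁ < r₂) {y : Euc n} (hy : r₂ ≤ ‖y‖) :
    radialCut r₁ r₂ y = 0 :=
  max_eq_left ((min_le_right _ _).trans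
    (div_nonpos_of_nonpos_of_nonneg (by linarith) (by linarith)))

lemma continuous_radialCut (r₁ r₂ : ℝ) : Continuous (radialCut (n := n) r₁ r₂) := by
  unfold radialCut; fun_prop

lemma LocSepSol.continuous_radialCut_mul (h : LocSepSol u T R) {t r₁ r₂ : ℝ} (ht : t ∈ Ioo 0 T)
    (hr : r₁ < r₂) (hr₂ : r₂ < R) : Continuous fun y => radialCut r₁ r₂ y * u t y := by
  rw [continuous_iff_continuousAt]
  intro y
  by_cases hy : ‖y‖ < R
  · exact (continuous_radialCut _ _).continuousAt.mul
      ((h.continuousOn_space ht).continuousAt (isOpen_ball.mem_nhds (mem_ball_zero_iff.2 hy)))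
  · refine (continuousAt_const (y := (0 : ℝ))).congr ?_
    have : ∀ᶠ z : Euc n in 𝓝 y, r₂ < ‖z‖ :=
      continuous_norm.continuousAt.eventually (lt_mem_nhds (by linarith))
    filter_upwards [this] with z hz
    rw [radialCut_eq_zero hr hz.le, zero_mul]

lemma LocSepSol.abs_radialCut_mul_le (h : LocSepSol u T R) {t r₁ r₂ K : ℝ} (ht : t ∈ Ioo 0 T)
    (hr : r₁ < r₂) (hr₂ : r₂ < R) (hK0 : 0 ≤ K)
    (hK : ∀ y ∈ closedBall (0 : Euc n) r₂, u t y ≤ K) (y : Euc n) :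
    0 ≤ radialCut r₁ r₂ y * u t y ∧ radialCut r₁ r₂ y * u t y ≤ K := by
  by_cases hy : ‖y‖ ≤ r₂
  · have h0 := h.nonneg ht (hy.trans_lt hr₂)
    exact ⟨mul_nonneg (radialCut_nonneg _ _ _) h0, (mul_le_of_le_one_left h0
      (radialCut_le_one _ _ _)).trans (hK y (mem_closedBall_zero_iff.2 hy))⟩
  · rw [radialCut_eq_zero hr (by linarith), zero_mul]
    exact ⟨le_rfl, hK0⟩

/-- Short-time approximation of a bounded solution by the heat semigroup. -/
lemma LocSepSol.abs_sub_heatExt_radialCut_le (h : LocSepSol u T R) {t s r ρ K : ℝ} (ht : 0 < t)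
    (hts : t < s) (hs : s < T) (hρ : 0 < ρ) (hr : r + 2 * ρ < R)
    (hsmall : 2 * n * (s - t) ≤ (ρ / 2) ^ 2)
    (hK : ∀ q ∈ Icc t s, ∀ y ∈ closedBall (0 : Euc n) (r + 2 * ρ), u q y ≤ K)
    {y : Euc n} (hy : ‖y‖ ≤ r) :
    |u s y - heatExt (fun z => radialCut (r + ρ) (r + 2 * ρ) z * u t z) (s - t) y|
      ≤ 3 * K * gaussTail n (s - t) ρ := by
  have hst : 0 < s - t := by linarith
  have htI : t ∈ Ioo 0 T := ⟨ht, by linarith⟩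
  have htI' : t ∈ Icc t s := ⟨le_rfl, hts.le⟩
  have hsol : SepSol u t s y ρ := h _ _ _ _ ht hs (by linarith)
  have hsub : closedBall y ρ ⊆ closedBall 0 (r + 2 * ρ) :=
    closedBall_subset_closedBall' (by rw [dist_zero_right]; linarith)
  have hK0 : 0 ≤ K := (hsol.nonneg t htI' y (mem_closedBall_self hρ.le)).trans
    (hK t htI' y (hsub (mem_closedBall_self hρ.le)))
  have h1 := hsol.abs_sub_heatExt_le hts hρ hsmall fun q hq x hx => hK q hq x (hsub hx)
  have hcb := h.abs_radialCut_mul_le (r₁ := r + ρ) htI (by linarith) hr hK0 (hK t htI')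
  have hcc := h.continuous_radialCut_mul (r₁ := r + ρ) htI (by linarith) hr
  have hci : Integrable fun z => radialCut (r + ρ) (r + 2 * ρ) z * u t z := by
    refine hcc.integrable_of_hasCompactSupport (HasCompactSupport.intro
      (isCompact_closedBall (0 : Euc n) (r + 2 * ρ)) fun z hz => ?_)
    rw [mem_closedBall_zero_iff, not_le] at hz
    rw [radialCut_eq_zero (by linarith) hz.le, zero_mul]
  have h2 := abs_integral_heatKer_mul_le_tail (c := y) (M := K)
    (g := fun z => cutoff ρ y z * u t z - radialCut (r + ρ) (r + 2 * ρ) z * u t z) hst hρ.le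
    (fun z => by
      have hc : 0 ≤ cutoff ρ y z * u t z ∧ cutoff ρ y z * u t z ≤ K := by
        by_cases hz : z ∈ closedBall y ρ
        · have h0 := hsol.nonneg t htI' z hz
          exact ⟨mul_nonneg (cutoff_nonneg _ _ _) h0, (mul_le_of_le_one_left h0
            (cutoff_le_one _ _ _)).trans (hK t htI' z (hsub hz))⟩
        · rw [mem_closedBall, dist_eq_norm, not_le] at hz
          rw [cutoff_eq_zero hρ (by linarith), zero_mul]
          exact ⟨le_rfl, hK0⟩
      rw [abs_le]
      constructor <;> linarith [hcb z])
    (fun z hz => by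
      have : ‖z‖ ≤ r + ρ := by
        have := norm_le_norm_add_norm_sub' z y; linarith
      rw [cutoff_eq_one hρ hz.le, radialCut_eq_one (by linarith) this, sub_self])
  have e : ∫ z, heatKer n (s - t) ‖z - y‖ *
      (cutoff ρ y z * u t z - radialCut (r + ρ) (r + 2 * ρ) z * u t z)
      = heatExt (fun z => cutoff ρ y z * u t z) (s - t) y
        - heatExt (fun z => radialCut (r + ρ) (r + 2 * ρ) z * u t z) (s - t) y := by
    rw [heatExt_eq_kernel _ hst, heatExt_eq_kernel _ hst, ← integral_sub
      (integrable_heatKer_mul (integrable_cutoff_mul hρ (hsol.cont_space htI')) hst y)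
      (integrable_heatKer_mul hci hst y)]
    congr 1; ext z; ring
  rw [e] at h2
  rw [abs_le] at *
  constructor <;> linarith [h1.1, h1.2, h2.1, h2.2]

/-- The right derivative at `0` of a test function smoothed by the heat semigroup, integrated
against an integrable weight. -/
lemma IsTest.hasDerivWithinAt_integral_heatExt (hψ : IsTest ψ) {w : Euc n → ℝ}
    (hw : Integrable w) (x : Euc n) :
    HasDerivWithinAt (fun s => ∫ z, w z * heatExt ψ s (x - z)) (∫ z, w z * _root_.lap ψ (x - z))
      (Ici 0) 0 := by
  obtain ⟨M, hM⟩ := hψ.lap.exists_bound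
  obtain ⟨M', hM'⟩ := hψ.exists_bound
  have hcont : ∀ s, Continuous fun z => heatExt ψ s (x - z) := fun s =>
    (continuous_heatExt hψ.continuous hM').comp (by fun_prop : Continuous fun z : Euc n => (s, x - z))
  have hinteg : ∀ s, Integrable fun z => w z * heatExt ψ s (x - z) := fun s =>
    hw.mul_bdd (hcont s).aestronglyMeasurable
      (Eventually.of_forall fun z => abs_heatExt_le hM' s (x - z))
  rw [← hasDerivWithinAt_Ioi_iff_Ici, hasDerivWithinAt_iff_tendsto_slope' self_notMem_Ioi]
  have e : ∀ s, slope (fun s => ∫ z, w z * heatExt ψ s (x - z)) 0 s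
      = ∫ z, w z * slope (fun s => heatExt ψ s (x - z)) 0 s := by
    intro s
    simp only [slope_def_field]
    rw [← integral_sub (hinteg s) (hinteg 0), ← integral_div]
    congr 1; ext z; ring
  refine Tendsto.congr (fun s => (e s).symm) ?_
  refine tendsto_integral_filter_of_dominated_convergence (fun z => |w z| * M) ?_ ?_
    (hw.abs.mul_const M) ?_
  · refine Eventually.of_forall fun s => hw.1.mul ?_
    simp only [slope_def_field]
    exact (((hcont s).sub (hcont 0)).div_const _).aestronglyMeasurable
  · filter_upwards [self_mem_nhdsWithin] with s hs
    refine Eventually.of_forall fun z => ?_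
    rw [norm_mul, Real.norm_eq_abs, Real.norm_eq_abs]
    gcongr
    have hs' : (0 : ℝ) < s := hs
    rw [slope_def_field, heatExt_zero, sub_zero, abs_div, abs_of_pos hs', div_le_iff₀ hs']
    exact hψ.abs_heatExt_sub_le hM hs'.le _
  · refine Eventually.of_forall fun z => Tendsto.const_mul _ ?_
    have := (hψ.hasDerivWithinAt_heatExt_zero (x - z)).Ioi_of_Ici
    rwa [hasDerivWithinAt_iff_tendsto_slope' self_notMem_Ioi] at this

lemma LocSepSol.hasDerivWithinAt_moll (hn : 0 < n) (h : LocSepSol u T R) (hψ : IsTestIn ε ψ)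
    {t : ℝ} (ht : t ∈ Ioo 0 T) {x : Euc n} (hx : ‖x‖ + ε < R) :
    HasDerivWithinAt (fun s => moll u ψ s x) (moll u (lap ψ) t x) (Ici t) t := by
  obtain ⟨ρ, hρ, hr⟩ : ∃ ρ > 0, (‖x‖ + ε) + 2 * ρ < R :=
    ⟨(R - (‖x‖ + ε)) / 4, by linarith, by linarith⟩
  set r := ‖x‖ + ε with hrdef
  have htb : (t + T) / 2 < T := by linarith [ht.2]
  obtain ⟨K₀, hK₀⟩ := h.exists_bound hn ht.1 htb hr
  set K := max K₀ 0 with hKdef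
  have hK : ∀ q ∈ Icc t ((t + T) / 2), ∀ y ∈ closedBall (0 : Euc n) (r + 2 * ρ), u q y ≤ K :=
    fun q hq y hy => (hK₀ q hq y hy).trans (le_max_left _ _)
  have hK0 : 0 ≤ K := le_max_right _ _
  set w : Euc n → ℝ := fun z => radialCut (r + ρ) (r + 2 * ρ) z * u t z with hw
  have htI : t ∈ Icc t ((t + T) / 2) := ⟨le_rfl, by linarith [ht.2]⟩
  have hwc : Continuous w := h.continuous_radialCut_mul ht (by linarith) hr
  have hwb := h.abs_radialCut_mul_le (r₁ := r + ρ) ht (by linarith) hr hK0 (hK t htI)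
  have hwb' : ∀ y, |w y| ≤ K := fun y => by
    rw [abs_of_nonneg (hwb y).1]; exact (hwb y).2
  have hwi : Integrable w := by
    refine hwc.integrable_of_hasCompactSupport (HasCompactSupport.intro
      (isCompact_closedBall (0 : Euc n) (r + 2 * ρ)) fun z hz => ?_)
    rw [mem_closedBall_zero_iff, not_le] at hz
    simp only [hw]
    rw [radialCut_eq_zero (by linarith) hz.le, zero_mul]
  have hwe : ∀ y ∈ closedBall (0 : Euc n) r, w y = u t y := fun y hy => by
    rw [mem_closedBall_zero_iff] at hy
    simp only [hw]
    rw [radialCut_eq_one (by linarith) (by linarith), one_mul]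
  obtain ⟨M, hM⟩ := hψ.1.exists_bound
  set W : ℝ → ℝ := fun s => ∫ z, w z * heatExt ψ s (x - z) with hW
  have hWd := hψ.1.hasDerivWithinAt_integral_heatExt hwi x
  have hlap : ∫ z, w z * lap ψ (x - z) = moll u (lap ψ) t x := by
    rw [moll_congr_of_ball hψ.lap hrdef.ge hwe]
    congr 1; ext z; ring
  rw [hlap] at hWd
  have hWs : HasDerivWithinAt (fun s => W (s - t)) (moll u (lap ψ) t x) (Ici t) t := by
    have h1 : HasDerivWithinAt (fun s => s - t) 1 (Ici t) t :=
      ((hasDerivAt_id t).sub_const t).hasDerivWithinAt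
    have h2 : HasDerivWithinAt W (moll u (lap ψ) t x) (Ici 0) (t - t) := by
      rw [sub_self]; exact hWd
    have := HasDerivWithinAt.comp (h := fun s => s - t) (h₂ := W) t h2 h1 fun s hs => by
      simp only [mem_Ici] at hs ⊢; linarith
    rwa [mul_one] at this
  have hWeq : ∀ s, W s = ∫ y, ψ (x - y) * heatExt w s y := by
    intro s
    rw [hW]; simp only
    rw [← integral_heatExt_mul hψ.1.continuous hψ.1.integrable hwc hwi hwb' hM]
    congr 1; ext y; ring
  have hE : HasDerivWithinAt (fun s => moll u ψ s x - W (s - t)) 0 (Ici t) t := by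
    set I := ∫ y, |ψ (x - y)| with hI
    set c := 2 ^ ((n : ℝ) / 2) * (2 * (64 / ρ ^ 2) ^ 2) with hc
    have hbig : (fun s => moll u ψ s x - W (s - t)) =O[𝓝[Ici t] t] fun s => ‖s - t‖ ^ 2 := by
      refine Asymptotics.IsBigO.of_bound (I * (3 * K * c)) ?_
      have hn1 : (0 : ℝ) < n := by exact_mod_cast hn
      have hev : ∀ᶠ s in 𝓝[Ici t] t, s < t + (ρ / 2) ^ 2 / (2 * n) ∧ s < (t + T) / 2 :=
        nhdsWithin_le_nhds ((gt_mem_nhds (by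
          have : 0 < (ρ / 2) ^ 2 / (2 * n) := by positivity
          linarith)).and (gt_mem_nhds (by linarith [ht.2])))
      filter_upwards [hev, self_mem_nhdsWithin] with s ⟨hs1, hs2⟩ hst
      rcases (show t ≤ s from hst).eq_or_lt with rfl | hst
      · have : moll u ψ t x - W (t - t) = 0 := by
          rw [sub_self, hWeq, moll_congr_of_ball hψ hrdef.ge hwe]
          simp [heatExt_zero]
        rw [this]; simp
      have hsmall : 2 * n * (s - t) ≤ (ρ / 2) ^ 2 := by
        have : s - t < (ρ / 2) ^ 2 / (2 * n) := by linarith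
        rw [lt_div_iff₀ (by positivity)] at this
        linarith
      have hst0 : 0 < s - t := by linarith
      have hsT : s ∈ Ioo 0 T := ⟨ht.1.trans hst, by linarith⟩
      have hψc : Continuous fun y => ψ (x - y) := hψ.1.continuous.comp (by fun_prop)
      have hi1 : Integrable fun y => ψ (x - y) * u s y := by
        refine (h.continuous_moll_integrand hψ hsT hx).integrable_of_hasCompactSupport
          (HasCompactSupport.intro (isCompact_closedBall (0 : Euc n) r) fun y hy => ?_)
        rw [mem_closedBall_zero_iff, not_le] at hy
        rw [hψ.eq_zero_sub hy, zero_mul]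
      have hi2 : Integrable fun y => ψ (x - y) * heatExt w (s - t) y := by
        refine (hψ.1.integrable.comp_sub_left x).mul_bdd ?_
          (Eventually.of_forall fun y => abs_heatExt_le hwb' (s - t) y)
        exact ((continuous_heatExt hwc hwb').comp
          (by fun_prop : Continuous fun y : Euc n => (s - t, y))).aestronglyMeasurable
      rw [hWeq, moll, ← integral_sub hi1 hi2]
      calc ‖∫ y, (ψ (x - y) * u s y - ψ (x - y) * heatExt w (s - t) y)‖
          ≤ ∫ y, |ψ (x - y)| * (3 * K * gaussTail n (s - t) ρ) := by
            refine norm_integral_le_of_norm_le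
              ((hψ.1.integrable.comp_sub_left x).abs.mul_const _)
              (Eventually.of_forall fun y => ?_)
            rw [← mul_sub, norm_mul, Real.norm_eq_abs, Real.norm_eq_abs]
            by_cases hy : ‖y‖ ≤ r
            · gcongr
              exact h.abs_sub_heatExt_radialCut_le ht.1 hst hsT.2 hρ hr hsmall
                (fun q hq => hK q ⟨hq.1, hq.2.trans hs2.le⟩) hy
            · rw [hψ.eq_zero_sub (by linarith)]; simp
        _ = I * (3 * K * gaussTail n (s - t) ρ) := integral_mul_const _ _
        _ ≤ I * (3 * K * (c * (s - t) ^ 2)) := by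
            have hI0 : 0 ≤ I := integral_nonneg fun _ => abs_nonneg _
            gcongr
            exact gaussTail_le_sq n hst0 hρ
        _ = I * (3 * K * c) * ‖‖s - t‖ ^ 2‖ := by
            rw [Real.norm_of_nonneg (by positivity), Real.norm_eq_abs, sq_abs]; ring
    have := (hbig.hasFDerivWithinAt (𝕜 := ℝ) self_mem_Ici one_lt_two).hasDerivWithinAt
    simpa using this
  have := hE.add hWs
  rw [zero_add] at this
  exact this.congr_of_eventuallyEq (Eventually.of_forall fun s => by simp) (by simp)

lemma LocSepSol.hasDerivAt_moll_time (hn : 0 < n) (h : LocSepSol u T R) (hψ : IsTestIn ε ψ)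
    {t : ℝ} (ht : t ∈ Ioo 0 T) {x : Euc n} (hx : ‖x‖ + ε < R) :
    HasDerivAt (fun s => moll u ψ s x) (moll u (lap ψ) t x) t := by
  have hxR : x ∈ ball (0 : Euc n) (R - ε) := mem_ball_zero_iff.2 (by linarith)
  have hcont : ∀ {φ : Euc n → ℝ}, IsTestIn ε φ → ContinuousOn (fun s => moll u φ s x) (Ioo 0 T) :=
    fun hφ => (h.continuousOn_moll hn hφ).comp (f := fun s => (s, x)) (by fun_prop)
      fun s hs => ⟨hs, hxR⟩
  have hfc := hcont hψ
  have hf'c := hcont hψ.lap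
  set f := fun s => moll u ψ s x
  set f' := fun s => moll u (lap ψ) s x
  set a := t / 2 with ha
  set b := (t + T) / 2 with hb
  have hab : Icc a b ⊆ Ioo 0 T := fun s hs => ⟨by linarith [hs.1, ht.1], by linarith [hs.2, ht.2]⟩
  set g := fun s => f a + ∫ q in a..s, f' q with hg
  have hgd : ∀ s ∈ Icc a b, HasDerivAt g (f' s) s := by
    intro s hs
    refine HasDerivAt.const_add _ (intervalIntegral.integral_hasDerivAt_right ?_ ?_ ?_)
    · refine (hf'c.mono ?_).intervalIntegrable
      rw [uIcc_of_le hs.1]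
      exact (Icc_subset_Icc_right hs.2).trans hab
    · exact hf'c.stronglyMeasurableAtFilter isOpen_Ioo _ (hab hs)
    · exact hf'c.continuousAt (isOpen_Ioo.mem_nhds (hab hs))
  have heq := eq_of_has_deriv_right_eq (f := f) (g := g) (f' := f') (a := a) (b := b)
    (fun s hs => h.hasDerivWithinAt_moll hn hψ (hab (Ico_subset_Icc_self hs)) hx)
    (fun s hs => (hgd s (Ico_subset_Icc_self hs)).hasDerivWithinAt) (hfc.mono hab)
    (fun s hs => (hgd s hs).continuousAt.continuousWithinAt) (by simp [hg])
  have htI : Icc a b ∈ 𝓝 t := Icc_mem_nhds (by linarith [ht.1]) (by linarith [ht.2])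
  refine (hgd t (mem_of_mem_nhds htI)).congr_of_eventuallyEq ?_
  filter_upwards [htI] with s hs using heq s hs

end

/-- `f` has first derivative `a` and second derivative `b` at `0`. -/
def HasTwoJet (f : ℝ → ℝ) (a b : ℝ) : Prop :=
  ∃ p : ℝ → ℝ, (∀ᶠ r in 𝓝 (0 : ℝ), HasDerivAt f (p r) r) ∧ p 0 = a ∧ HasDerivAt p b 0

namespace HasTwoJet

lemma hasDerivAt {f : ℝ → ℝ} {a b : ℝ} (h : HasTwoJet f a b) : HasDerivAt f a 0 := by
  obtain ⟨p, hp, rfl, _⟩ := h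
  exact hp.self_of_nhds

lemma mul {f g : ℝ → ℝ} {a b a' b' : ℝ} (hf : HasTwoJet f a b) (hg : HasTwoJet g a' b') :
    HasTwoJet (fun r => f r * g r) (a * g 0 + f 0 * a') (b * g 0 + 2 * (a * a') + f 0 * b') := by
  have hf0 := hf.hasDerivAt
  have hg0 := hg.hasDerivAt
  obtain ⟨p, hp, rfl, hp'⟩ := hf
  obtain ⟨q, hq, rfl, hq'⟩ := hg
  refine ⟨fun r => p r * g r + f r * q r, ?_, rfl, ?_⟩
  · filter_upwards [hp, hq] with r h1 h2 using h1.mul h2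
  · exact ((hp'.mul hg0).add (hf0.mul hq')).congr_deriv (by ring)

lemma const_mul {f : ℝ → ℝ} {a b : ℝ} (c : ℝ) (hf : HasTwoJet f a b) :
    HasTwoJet (fun r => c * f r) (c * a) (c * b) := by
  obtain ⟨p, hp, rfl, hp'⟩ := hf
  exact ⟨fun r => c * p r, hp.mono fun r h => h.const_mul c, rfl, hp'.const_mul c⟩

lemma sub {f g : ℝ → ℝ} {a b a' b' : ℝ} (hf : HasTwoJet f a b) (hg : HasTwoJet g a' b') :
    HasTwoJet (fun r => f r - g r) (a - a') (b - b') := by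
  obtain ⟨p, hp, rfl, hp'⟩ := hf
  obtain ⟨q, hq, rfl, hq'⟩ := hg
  refine ⟨fun r => p r - q r, ?_, rfl, hp'.sub hq'⟩
  filter_upwards [hp, hq] with r h1 h2 using h1.sub h2

lemma sum {ι : Type*} [Fintype ι] {f : ι → ℝ → ℝ} {a b : ι → ℝ}
    (hf : ∀ i, HasTwoJet (f i) (a i) (b i)) :
    HasTwoJet (fun r => ∑ i, f i r) (∑ i, a i) (∑ i, b i) := by
  choose p hp hp0 hp' using hf
  refine ⟨fun r => ∑ i, p i r, ?_, by simp [hp0], HasDerivAt.fun_sum fun i _ => hp' i⟩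
  filter_upwards [eventually_all.2 hp] with r hr using HasDerivAt.fun_sum fun i _ => hr i

lemma div {f g : ℝ → ℝ} {a b a' b' : ℝ} (hf : HasTwoJet f a b) (hg : HasTwoJet g a' b')
    (h0 : g 0 ≠ 0) :
    HasTwoJet (fun r => f r / g r) ((a - f 0 / g 0 * a') / g 0)
      ((b - 2 * ((a - f 0 / g 0 * a') / g 0 * a') - f 0 / g 0 * b') / g 0) := by
  have hf0 := hf.hasDerivAt
  have hg0 := hg.hasDerivAt
  obtain ⟨p, hp, rfl, hp'⟩ := hf
  obtain ⟨q, hq, rfl, hq'⟩ := hg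
  refine ⟨fun r => (p r * g r - f r * q r) / g r ^ 2, ?_, ?_, ?_⟩
  · filter_upwards [hp, hq, hg0.continuousAt.eventually_ne h0] with r h1 h2 h3 using h1.div h2 h3
  · field_simp
  · refine (((hp'.mul hg0).sub (hf0.mul hq')).div (hg0.pow 2) (pow_ne_zero 2 h0)).congr_deriv ?_
    simp only [Pi.mul_apply, Pi.pow_apply, Pi.sub_apply]
    field_simp
    ring

lemma hasSecondLineDeriv {n : ℕ} {g : Euc n → ℝ} {x e : Euc n} {a b : ℝ}
    (h : HasTwoJet (fun r => g (x + r • e)) a b) : HasSecondLineDeriv g x e b := by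
  obtain ⟨p, hp, _, hp'⟩ := h
  exact ⟨p, hp, hp'⟩

end HasTwoJet

lemma HasDerivAt.line_shift {n : ℕ} {g : Euc n → ℝ} {x e : Euc n} {r d : ℝ}
    (h : HasDerivAt (fun s : ℝ => g (x + r • e + s • e)) d 0) :
    HasDerivAt (fun s : ℝ => g (x + s • e)) d r := by
  have h1 : HasDerivAt (fun s : ℝ => s - r) 1 r := (hasDerivAt_id r).sub_const r
  have h2 : HasDerivAt (fun s : ℝ => g (x + r • e + s • e)) d (r - r) := by rwa [sub_self]
  have h3 := HasDerivAt.comp (h := fun s => s - r)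
    (h₂ := fun s : ℝ => g (x + r • e + s • e)) r h2 h1
  rw [mul_one] at h3
  refine h3.congr_of_eventuallyEq (Eventually.of_forall fun s => ?_)
  simp only [Function.comp_apply]
  congr 1
  module

/-- `V` solves the heat equation on `Ω`, with first and second derivatives `V₁`, `V₂` along the
coordinate lines. -/
structure HeatJet {n : ℕ} (Ω : Set (ℝ × Euc n)) (V : ℝ → Euc n → ℝ)
    (V₁ V₂ : Fin n → ℝ → Euc n → ℝ) : Prop where
  line : ∀ p ∈ Ω, ∀ i, HasDerivAt (fun r : ℝ => V p.1 (p.2 + r • basisVec i)) (V₁ i p.1 p.2) 0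
  line_line : ∀ p ∈ Ω, ∀ i,
    HasDerivAt (fun r : ℝ => V₁ i p.1 (p.2 + r • basisVec i)) (V₂ i p.1 p.2) 0
  time : ∀ p ∈ Ω, HasDerivAt (fun s => V s p.2) (∑ i, V₂ i p.1 p.2) p.1

lemma HeatJet.hasTwoJet {n : ℕ} {Ω : Set (ℝ × Euc n)} {V : ℝ → Euc n → ℝ}
    {V₁ V₂ : Fin n → ℝ → Euc n → ℝ} (h : HeatJet Ω V V₁ V₂) (hΩ : IsOpen Ω) {p : ℝ × Euc n}
    (hp : p ∈ Ω) (i : Fin n) :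
    HasTwoJet (fun r => V p.1 (p.2 + r • basisVec i)) (V₁ i p.1 p.2) (V₂ i p.1 p.2) := by
  refine ⟨fun r => V₁ i p.1 (p.2 + r • basisVec i), ?_, by simp, h.line_line p hp i⟩
  have hc : ContinuousAt (fun r : ℝ => (p.1, p.2 + r • basisVec i)) 0 := by fun_prop
  have : ∀ᶠ r : ℝ in 𝓝 0, (p.1, p.2 + r • basisVec i) ∈ Ω :=
    hc.eventually (hΩ.mem_nhds (by simpa using hp))
  filter_upwards [this] with r hr
  exact (h.line _ hr i).line_shift

/-- The algebraic part of the gradient estimate at a maximum point. -/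
lemma gradient_bound_of_critical {n : ℕ} (hn : 0 < n) {α φ G σ Lφ LG Gt A B : ℝ}
    {f φ₁ G₁ D : Fin n → ℝ} (hα : 1 < α) (hφ : 0 < φ) (hφ1 : φ ≤ 1) (hG : 0 < G) (hσ : 0 < σ)
    (hcrit : ∀ i, φ₁ i * G + φ * G₁ i = 0)
    (hlap : Lφ * G + 2 * ∑ i, φ₁ i * G₁ i + φ * LG ≤ 0)
    (htime : 0 ≤ φ * G + σ * (φ * Gt))
    (hboch : 2 * ∑ i, D i ^ 2 ≤ LG - Gt + 2 * ∑ i, f i * G₁ i)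
    (htr : ∑ i, D i = -(G + (α - 1) * ∑ i, f i ^ 2) / α)
    (hB : ∑ i, φ₁ i ^ 2 ≤ B * φ) (hA : -Lφ ≤ A) :
    σ * φ * G ≤ n * α ^ 2 / 2 * (1 + σ * (A + 2 * B + n * α ^ 2 / (4 * (α - 1)) * B)) := by
  have hn' : (0 : ℝ) < n := by exact_mod_cast hn
  have hα0 : 0 < α := by linarith
  have hα1 : 0 < α - 1 := by linarith
  set F := ∑ i, f i ^ 2
  set N := ∑ i, φ₁ i ^ 2
  set X := ∑ i, f i * φ₁ i
  have hF0 : 0 ≤ F := Finset.sum_nonneg fun _ _ => sq_nonneg _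
  have hN0 : 0 ≤ N := Finset.sum_nonneg fun _ _ => sq_nonneg _
  have e1 : φ * ∑ i, φ₁ i * G₁ i = -(G * N) := by
    rw [Finset.mul_sum, Finset.mul_sum, ← Finset.sum_neg_distrib]
    exact Finset.sum_congr rfl fun i _ => by linear_combination φ₁ i * hcrit i
  have e2 : φ * ∑ i, f i * G₁ i = -(G * X) := by
    rw [Finset.mul_sum, Finset.mul_sum, ← Finset.sum_neg_distrib]
    exact Finset.sum_congr rfl fun i _ => by linear_combination f i * hcrit i
  set k := 4 * (α - 1) / (n * α ^ 2) with hk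
  have hk0 : 0 < k := by positivity
  have hX : 0 ≤ k ^ 2 * φ ^ 2 * F + 2 * k * φ * X + N := by
    have : 0 ≤ ∑ i, (k * φ * f i + φ₁ i) ^ 2 := Finset.sum_nonneg fun _ _ => sq_nonneg _
    have e : ∑ i, (k * φ * f i + φ₁ i) ^ 2 = k ^ 2 * φ ^ 2 * F + 2 * k * φ * X + N := by
      rw [Finset.mul_sum, Finset.mul_sum, ← Finset.sum_add_distrib, ← Finset.sum_add_distrib]
      exact Finset.sum_congr rfl fun i _ => by ring
    rwa [e] at this
  have hX' : 0 ≤ k * φ ^ 2 * F + 2 * φ * X + N / k := by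
    have : k * φ ^ 2 * F + 2 * φ * X + N / k
        = (k ^ 2 * φ ^ 2 * F + 2 * k * φ * X + N) / k := by field_simp
    rw [this]; positivity
  set D2 := ∑ i, D i ^ 2
  have hD : (∑ i, D i) ^ 2 ≤ n * D2 := by
    have := sq_sum_le_card_mul_sum_sq (s := (Finset.univ : Finset (Fin n))) (f := D)
    simpa using this
  have hD2 : G * (G * (2 / (n * α ^ 2)) + k * F) ≤ 2 * D2 := by
    rw [htr] at hD
    have h1 : G ^ 2 + 2 * (α - 1) * (G * F) ≤ (n * α ^ 2) * D2 := by
      rw [div_pow, div_le_iff₀ (by positivity)] at hD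
      nlinarith [mul_nonneg (mul_nonneg hα1.le hα1.le) (mul_nonneg hF0 hF0)]
    have h2 : G * (G * (2 / (n * α ^ 2)) + k * F)
        = 2 * (G ^ 2 + 2 * (α - 1) * (G * F)) / (n * α ^ 2) := by rw [hk]; field_simp; ring
    rw [h2, div_le_iff₀ (by positivity)]
    linarith
  have key : G * (σ * φ * Lφ - 2 * σ * N - φ ^ 2 +
      σ * φ ^ 2 * (G * (2 / (n * α ^ 2)) + k * F) + 2 * σ * φ * X) ≤ 0 := by
    have h1 : φ * (Lφ * G + 2 * ∑ i, φ₁ i * G₁ i + φ * LG) ≤ 0 :=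
      mul_nonpos_of_nonneg_of_nonpos hφ.le hlap
    have h2 : φ ^ 2 * (2 * D2) ≤ φ ^ 2 * (LG - Gt + 2 * ∑ i, f i * G₁ i) := by gcongr
    have h3 : φ ^ 2 * (G * (G * (2 / (n * α ^ 2)) + k * F)) ≤ φ ^ 2 * (2 * D2) := by gcongr
    have h4 : 0 ≤ φ * (φ * G + σ * (φ * Gt)) := by positivity
    have h5 : φ * Lφ * G - 2 * (G * N) + φ ^ 2 * (G * (G * (2 / (n * α ^ 2)) + k * F))
        + φ ^ 2 * Gt + 2 * φ * (G * X) ≤ 0 := by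
      have e2' : φ ^ 2 * (2 * ∑ i, f i * G₁ i) = -(2 * φ * (G * X)) := by
        linear_combination 2 * φ * e2
      have e1' : φ * (2 * ∑ i, φ₁ i * G₁ i) = -(2 * (G * N)) := by linear_combination 2 * e1
      have a1 : φ * (Lφ * G + 2 * ∑ i, φ₁ i * G₁ i + φ * LG)
          = φ * Lφ * G - 2 * (G * N) + φ ^ 2 * LG := by linear_combination e1'
      have a2 : φ ^ 2 * (LG - Gt + 2 * ∑ i, f i * G₁ i)
          = φ ^ 2 * LG - φ ^ 2 * Gt - 2 * φ * (G * X) := by linear_combination e2'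
      rw [a1] at h1
      rw [a2] at h2
      linarith
    have h6 := mul_nonpos_of_nonneg_of_nonpos hσ.le h5
    generalize 2 / ((n : ℝ) * α ^ 2) = m at h6 ⊢
    clear_value k
    linarith
  have key' := nonpos_of_mul_nonpos_right key hG
  have hXσ := mul_nonneg hσ.le hX'
  have hNk : N / k ≤ n * α ^ 2 / (4 * (α - 1)) * (B * φ) := by
    have : N / k = n * α ^ 2 / (4 * (α - 1)) * N := by rw [hk]; field_simp
    rw [this]; gcongr
  have h1 : φ * (σ * φ * G * (2 / (n * α ^ 2)))
      ≤ φ * (1 + σ * (A + 2 * B + n * α ^ 2 / (4 * (α - 1)) * B)) := by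
    have a1 : σ * (N / k) ≤ σ * (n * α ^ 2 / (4 * (α - 1)) * (B * φ)) := by gcongr
    have a2 : σ * N ≤ σ * (B * φ) := by gcongr
    have a3 : σ * φ * (-Lφ) ≤ σ * φ * A := by gcongr
    have a4 : φ ^ 2 ≤ φ := by nlinarith
    generalize 2 / ((n : ℝ) * α ^ 2) = m at key' ⊢
    generalize (n : ℝ) * α ^ 2 / (4 * (α - 1)) = c at a1 ⊢
    generalize N / k = w at hXσ a1
    clear_value k
    linarith
  have h2 := le_of_mul_le_mul_left h1 hφ
  have h3 : σ * φ * G = n * α ^ 2 / 2 * (σ * φ * G * (2 / (n * α ^ 2))) := by field_simp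
  rw [h3]
  gcongr

lemma IsTest.hasTwoJet_scaled {n : ℕ} {g : Euc n → ℝ} (hg : IsTest g) (c : ℝ) (i : Fin n)
    (x : Euc n) : HasTwoJet (fun r => g (c • (x + r • basisVec i)))
      (c * _root_.pderiv i g (c • x)) (c * (c * _root_.pderiv i (_root_.pderiv i g) (c • x))) := by
  have key : ∀ {g : Euc n → ℝ}, IsTest g → ∀ r : ℝ,
      HasDerivAt (fun r : ℝ => g (c • (x + r • basisVec i)))
        (c * _root_.pderiv i g (c • (x + r • basisVec i))) r := by
    intro g hg r
    have h1 : HasDerivAt (fun s : ℝ => c * s) c r := by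
      simpa using (hasDerivAt_id r).const_mul c
    have h2 := HasDerivAt.comp (h := fun s => c * s)
      (h₂ := fun s : ℝ => g (c • x + s • basisVec i)) r (hg.hasDerivAt_line i (c • x) (c * r)) h1
    have e : ∀ s : ℝ, c • (x + s • basisVec i) = c • x + (c * s) • basisVec i := fun s => by
      module
    rw [e, mul_comm c]
    refine h2.congr_of_eventuallyEq (Eventually.of_forall fun s => ?_)
    simp only [Function.comp_apply, e]
  refine ⟨fun r => c * _root_.pderiv i g (c • (x + r • basisVec i)),
    Eventually.of_forall (key hg), by simp, ?_⟩
  have := (key (hg.pderiv i) 0).const_mul c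
  simpa using this

lemma exists_cutoff (n : ℕ) : ∃ A B : ℝ, 0 ≤ A ∧ 0 ≤ B ∧ ∀ R : ℝ, 0 < R →
    ∃ (φ : Euc n → ℝ) (φ₁ φ₂ : Fin n → Euc n → ℝ), Continuous φ ∧ (∀ x, 0 ≤ φ x) ∧
      (∀ x, φ x ≤ 1) ∧ (∀ x, ‖x‖ ≤ R / 2 → φ x = 1) ∧ (∀ x, R ≤ ‖x‖ → φ x = 0) ∧
      (∀ x i, HasTwoJet (fun r => φ (x + r • basisVec i)) (φ₁ i x) (φ₂ i x)) ∧
      (∀ x, -∑ i, φ₂ i x ≤ A / R ^ 2) ∧ ∀ x, ∑ i, φ₁ i x ^ 2 ≤ B / R ^ 2 * φ x := by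
  let b : ContDiffBump (0 : Euc n) := ⟨1 / 2, 1, by norm_num, by norm_num⟩
  have hb : IsTest (b : Euc n → ℝ) := ⟨b.contDiff, b.hasCompactSupport⟩
  choose M₁ hM₁ using fun i => (hb.pderiv i).exists_bound
  choose M₂ hM₂ using fun i => ((hb.pderiv i).pderiv i).exists_bound
  have hM₂0 : ∀ i, 0 ≤ M₂ i := fun i => (abs_nonneg _).trans (hM₂ i 0)
  refine ⟨2 * ∑ i, M₂ i, 4 * ∑ i, M₁ i ^ 2,
    mul_nonneg zero_le_two (Finset.sum_nonneg fun i _ => hM₂0 i), by positivity, fun R hR => ?_⟩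
  have hj := fun (x : Euc n) i => (hb.hasTwoJet_scaled R⁻¹ i x).mul (hb.hasTwoJet_scaled R⁻¹ i x)
  simp only [zero_smul, add_zero] at hj
  have hnorm : ∀ x : Euc n, ‖R⁻¹ • x‖ = ‖x‖ / R := fun x => by
    rw [norm_smul, norm_inv, Real.norm_of_nonneg hR.le, div_eq_inv_mul]
  refine ⟨fun x => b (R⁻¹ • x) * b (R⁻¹ • x), _, _, ?_, fun x => mul_self_nonneg _, fun x => ?_,
    fun x hx => ?_, fun x hx => ?_, fun x i => hj x i, fun x => ?_, fun x => ?_⟩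
  · have := b.continuous
    fun_prop
  · exact mul_le_one₀ b.le_one b.nonneg b.le_one
  · have : b (R⁻¹ • x) = 1 := b.one_of_mem_closedBall (by
      rw [mem_closedBall_zero_iff, hnorm, div_le_iff₀ hR]
      change _ ≤ 1 / 2 * R
      linarith)
    simp [this]
  · have : b (R⁻¹ • x) = 0 := b.zero_of_le_dist (by
      rw [dist_zero_right, hnorm, le_div_iff₀ hR]
      change 1 * R ≤ _
      linarith)
    simp [this]
  · rw [← Finset.sum_neg_distrib, Finset.mul_sum, Finset.sum_div]
    refine Finset.sum_le_sum fun i _ => ?_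
    have h1 := (abs_le.1 (hM₂ i (R⁻¹ • x))).1
    have h2 := b.le_one (x := R⁻¹ • x)
    have h3 := b.nonneg (x := R⁻¹ • x)
    generalize b (R⁻¹ • x) = v at *
    generalize pderiv i (pderiv i b) (R⁻¹ • x) = w at *
    generalize pderiv i b (R⁻¹ • x) = z at *
    have e : -(R⁻¹ * (R⁻¹ * w) * v + 2 * (R⁻¹ * z * (R⁻¹ * z)) + v * (R⁻¹ * (R⁻¹ * w)))
        = (-(2 * (v * w)) - 2 * z ^ 2) / R ^ 2 := by field_simp; ring
    rw [e]
    gcongr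
    have : -(v * w) ≤ M₂ i := by nlinarith [hM₂0 i]
    nlinarith [sq_nonneg z]
  · rw [Finset.mul_sum, Finset.sum_div, Finset.sum_mul]
    refine Finset.sum_le_sum fun i _ => ?_
    dsimp only
    have h1 := sq_le_sq' (abs_le.1 (hM₁ i (R⁻¹ • x))).1 (abs_le.1 (hM₁ i (R⁻¹ • x))).2
    generalize b (R⁻¹ • x) = v at *
    generalize pderiv i b (R⁻¹ • x) = z at *
    have e : (R⁻¹ * z * v + v * (R⁻¹ * z)) ^ 2 = 4 * z ^ 2 / R ^ 2 * (v * v) := by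
      field_simp; ring
    rw [e]
    gcongr
    exact mul_self_nonneg v

/-- A quotient of two solutions of the heat equation satisfies a drift-diffusion equation. -/
lemma HeatJet.div {n : ℕ} {Ω : Set (ℝ × Euc n)} {U V : ℝ → Euc n → ℝ}
    {U₁ U₂ V₁ V₂ : Fin n → ℝ → Euc n → ℝ} (hU : HeatJet Ω U U₁ U₂) (hV : HeatJet Ω V V₁ V₂)
    (hΩ : IsOpen Ω) {t : ℝ} {x : Euc n} (hp : (t, x) ∈ Ω) (h0 : U t x ≠ 0) :
    ∃ (q₁ q₂ : Fin n → ℝ) (qt : ℝ), (∀ i, q₁ i = (V₁ i t x - V t x / U t x * U₁ i t x) / U t x) ∧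
      (∀ i, HasTwoJet (fun r => V t (x + r • basisVec i) / U t (x + r • basisVec i))
        (q₁ i) (q₂ i)) ∧
      HasDerivAt (fun s => V s x / U s x) qt t ∧
      ∑ i, q₂ i - qt = -(2 * ∑ i, U₁ i t x / U t x * q₁ i) := by
  have hj := fun i => (hV.hasTwoJet hΩ hp i).div (hU.hasTwoJet hΩ hp i) (by simpa using h0)
  simp only [zero_smul, add_zero] at hj
  refine ⟨_, _, (∑ i, V₂ i t x - V t x / U t x * ∑ i, U₂ i t x) / U t x, fun i => rfl, hj, ?_, ?_⟩
  · refine ((hV.time _ hp).div (hU.time _ hp) h0).congr_deriv ?_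
    dsimp only
    field_simp
  · rw [Finset.mul_sum, Finset.mul_sum, ← Finset.sum_sub_distrib, Finset.sum_div,
      ← Finset.sum_sub_distrib, ← Finset.sum_neg_distrib]
    refine Finset.sum_congr rfl fun i _ => ?_
    field_simp
    ring

/-- The Li–Yau quantity `|P|² / U² - α Q / U`. -/
def liYau {n : ℕ} (α : ℝ) (U : ℝ → Euc n → ℝ) (P : Fin n → ℝ → Euc n → ℝ) (Q : ℝ → Euc n → ℝ)
    (t : ℝ) (x : Euc n) : ℝ :=
  ∑ j, P j t x / U t x * (P j t x / U t x) - α * (Q t x / U t x)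

lemma bochner_liYau {n : ℕ} {Ω : Set (ℝ × Euc n)} {α : ℝ} (hα : α ≠ 0) {U Q : ℝ → Euc n → ℝ}
    {P U₂ Q₁ Q₂ : Fin n → ℝ → Euc n → ℝ} {P₁ P₂ : Fin n → Fin n → ℝ → Euc n → ℝ}
    (hU : HeatJet Ω U P U₂) (hP : ∀ j, HeatJet Ω (P j) (P₁ j) (P₂ j)) (hQ : HeatJet Ω Q Q₁ Q₂)
    (hPU : ∀ j, P₁ j j = U₂ j) (hQU : ∀ p ∈ Ω, Q p.1 p.2 = ∑ i, U₂ i p.1 p.2)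
    (hΩ : IsOpen Ω) {t : ℝ} {x : Euc n} (hp : (t, x) ∈ Ω) (h0 : U t x ≠ 0) :
    ∃ (G₁ G₂ D : Fin n → ℝ) (Gt : ℝ),
      (∀ i, HasTwoJet (fun r => liYau α U P Q t (x + r • basisVec i)) (G₁ i) (G₂ i)) ∧
      HasDerivAt (fun s => liYau α U P Q s x) Gt t ∧
      2 * ∑ i, D i ^ 2 ≤ ∑ i, G₂ i - Gt + 2 * ∑ i, P i t x / U t x * G₁ i ∧
      ∑ i, D i = -(liYau α U P Q t x + (α - 1) * ∑ i, (P i t x / U t x) ^ 2) / α := by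
  choose f₁ f₂ ft hf₁ hf hft hfe using fun j => hU.div (hP j) hΩ hp h0
  obtain ⟨q₁, q₂, qt, -, hq, hqt, hqe⟩ := hU.div hQ hΩ hp h0
  have hjet := fun i => (HasTwoJet.sum fun j => (hf j i).mul (hf j i)).sub ((hq i).const_mul α)
  simp only [zero_smul, add_zero] at hjet
  set f : Fin n → ℝ := fun j => P j t x / U t x with hfdef
  refine ⟨_, _, fun i => f₁ i i, _, hjet,
    (HasDerivAt.fun_sum fun j _ => (hft j).mul (hft j)).sub (hqt.const_mul α), ?_, ?_⟩
  · have hdiag : ∑ i, f₁ i i ^ 2 ≤ ∑ j, ∑ i, f₁ j i ^ 2 := Finset.sum_le_sum fun j _ =>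
      Finset.single_le_sum (f := fun i => f₁ j i ^ 2) (fun i _ => sq_nonneg _) (Finset.mem_univ j)
    have e1 : ∑ i, (∑ j, (f₂ j i * f j + 2 * (f₁ j i * f₁ j i) + f j * f₂ j i) - α * q₂ i)
        = ∑ j, (2 * ∑ i, f₁ j i ^ 2 + 2 * f j * ∑ i, f₂ j i) - α * ∑ i, q₂ i := by
      rw [Finset.sum_sub_distrib, Finset.sum_comm, ← Finset.mul_sum]
      congr 1
      refine Finset.sum_congr rfl fun j _ => ?_
      rw [Finset.mul_sum, Finset.mul_sum, ← Finset.sum_add_distrib]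
      exact Finset.sum_congr rfl fun i _ => by ring
    have e2 : ∑ i, f i * (∑ j, (f₁ j i * f j + f j * f₁ j i) - α * q₁ i)
        = ∑ j, 2 * f j * ∑ i, f i * f₁ j i - α * ∑ i, f i * q₁ i := by
      simp only [mul_sub, Finset.sum_sub_distrib, Finset.mul_sum]
      rw [Finset.sum_comm]
      congr 1
      · exact Finset.sum_congr rfl fun j _ => Finset.sum_congr rfl fun i _ => by ring
      · exact Finset.sum_congr rfl fun i _ => by ring
    have e3 : ∑ j, (ft j * f j + f j * ft j) = ∑ j, 2 * f j * ft j :=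
      Finset.sum_congr rfl fun j _ => by ring
    have e4 : ∑ j, 2 * f j * ∑ i, f₂ j i - ∑ j, 2 * f j * ft j
        = -(2 * ∑ j, 2 * f j * ∑ i, f i * f₁ j i) := by
      rw [← Finset.sum_sub_distrib, Finset.mul_sum, ← Finset.sum_neg_distrib]
      exact Finset.sum_congr rfl fun j _ => by linear_combination 2 * f j * hfe j
    rw [Finset.sum_add_distrib, ← Finset.mul_sum] at e1
    have e5 : ∀ i, P i t x / U t x = f i := fun i => rfl
    simp only [e5] at hqe ⊢
    rw [e1, e2, e3]
    have e6 : α * (∑ i, q₂ i - qt) = α * -(2 * ∑ i, f i * q₁ i) := by rw [hqe]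
    linarith
  · have e1 : ∀ i, f₁ i i = U₂ i t x / U t x - f i ^ 2 := fun i => by
      rw [hf₁, hPU]
      simp only [hfdef]
      field_simp
    simp only [e1, Finset.sum_sub_distrib, liYau, hQU _ hp, ← Finset.sum_div]
    have e2 : ∑ i, P i t x / U t x * (P i t x / U t x) = ∑ i, f i ^ 2 :=
      Finset.sum_congr rfl fun i _ => by rw [sq]
    rw [e2]
    simp only [hfdef]
    field_simp
    ring

lemma HasDerivAt.nonneg_of_left_max {f : ℝ → ℝ} {a s d : ℝ} (h : HasDerivAt f d s) (ha : a < s)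
    (hmax : ∀ t ∈ Icc a s, f t ≤ f s) : 0 ≤ d := by
  have h1 := h.hasDerivWithinAt (s := Iio s)
  rw [hasDerivWithinAt_iff_tendsto_slope' (by simp)] at h1
  refine ge_of_tendsto h1 ?_
  filter_upwards [Ioo_mem_nhdsLT ha] with t ht
  rw [slope_def_field]
  exact div_nonneg_of_nonpos (sub_nonpos.2 (hmax t ⟨ht.1.le, ht.2.le⟩)) (sub_nonpos.2 ht.2.le)

lemma exists_liYau_bound {n : ℕ} (hn : 0 < n) : ∃ A B : ℝ, 0 ≤ A ∧ 0 ≤ B ∧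
    ∀ {T ρ R τ t₁ α : ℝ} {U Q : ℝ → Euc n → ℝ} {P U₂ Q₁ Q₂ : Fin n → ℝ → Euc n → ℝ}
      {P₁ P₂ : Fin n → Fin n → ℝ → Euc n → ℝ},
      0 < R → R < ρ → 0 < τ → τ < t₁ → t₁ < T → 1 < α →
      HeatJet (Ioo 0 T ×ˢ ball 0 ρ) U P U₂ →
      (∀ j, HeatJet (Ioo 0 T ×ˢ ball 0 ρ) (P j) (P₁ j) (P₂ j)) →
      HeatJet (Ioo 0 T ×ˢ ball 0 ρ) Q Q₁ Q₂ →
      (∀ j, P₁ j j = U₂ j) →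
      (∀ p ∈ Ioo 0 T ×ˢ ball (0 : Euc n) ρ, Q p.1 p.2 = ∑ i, U₂ i p.1 p.2) →
      (∀ t ∈ Ioo 0 T, ∀ x ∈ ball (0 : Euc n) ρ, 0 < U t x) →
      ContinuousOn (fun p : ℝ × Euc n => U p.1 p.2) (Ioo 0 T ×ˢ ball 0 ρ) →
      (∀ j, ContinuousOn (fun p : ℝ × Euc n => P j p.1 p.2) (Ioo 0 T ×ˢ ball 0 ρ)) →
      ContinuousOn (fun p : ℝ × Euc n => Q p.1 p.2) (Ioo 0 T ×ˢ ball 0 ρ) →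
      ∀ x : Euc n, ‖x‖ ≤ R / 2 → liYau α U P Q t₁ x ≤
        n * α ^ 2 / 2 * (1 / (t₁ - τ) + (A + 2 * B + n * α ^ 2 / (4 * (α - 1)) * B) / R ^ 2) := by
  obtain ⟨A, B, hA0, hB0, hcut⟩ := exists_cutoff n
  refine ⟨A, B, hA0, hB0, ?_⟩
  intro T ρ R τ t₁ α U Q P U₂ Q₁ Q₂ P₁ P₂ hR hRρ hτ hτt htT hα hU hP hQ hPU hQU hpos cU cP cQ x hx
  obtain ⟨φ, φ₁, φ₂, cφ, hφ0, hφ1, hφx, hφR, hφj, hφA, hφB⟩ := hcut R hR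
  have hΩ : IsOpen (Ioo 0 T ×ˢ ball (0 : Euc n) ρ) := isOpen_Ioo.prod isOpen_ball
  have hα1 : 0 < α - 1 := by linarith
  set E := A + 2 * B + n * α ^ 2 / (4 * (α - 1)) * B with hE
  have hE0 : 0 ≤ E := by positivity
  set G := liYau α U P Q with hG
  have hsub : Icc τ t₁ ×ˢ closedBall (0 : Euc n) R ⊆ Ioo 0 T ×ˢ ball 0 ρ := by
    rintro ⟨t, y⟩ ⟨ht, hy⟩
    exact ⟨⟨hτ.trans_le ht.1, ht.2.trans_lt htT⟩, closedBall_subset_ball hRρ hy⟩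
  have cG : ContinuousOn (fun p : ℝ × Euc n => G p.1 p.2) (Ioo 0 T ×ˢ ball 0 ρ) := by
    have hne : ∀ p ∈ Ioo 0 T ×ˢ ball (0 : Euc n) ρ, U p.1 p.2 ≠ 0 :=
      fun p hp => (hpos p.1 hp.1 p.2 hp.2).ne'
    refine (continuousOn_finsetSum _ fun j _ => ?_).sub
      (continuousOn_const.mul (cQ.div cU hne))
    exact ((cP j).div cU hne).mul ((cP j).div cU hne)
  set W : ℝ × Euc n → ℝ := fun p => (p.1 - τ) * (φ p.2 * G p.1 p.2) with hW
  have cW : ContinuousOn W (Icc τ t₁ ×ˢ closedBall 0 R) := by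
    refine (Continuous.continuousOn (by fun_prop)).mul
      ((Continuous.continuousOn (by fun_prop)).mul (cG.mono hsub))
  have hxmem : (t₁, x) ∈ Icc τ t₁ ×ˢ closedBall (0 : Euc n) R :=
    ⟨⟨hτt.le, le_rfl⟩, mem_closedBall_zero_iff.2 (by linarith)⟩
  obtain ⟨⟨s, y⟩, ⟨hs, hy⟩, hmax⟩ :=
    (isCompact_Icc.prod (isCompact_closedBall (0 : Euc n) R)).exists_isMaxOn ⟨_, hxmem⟩ cW
  have hσ₁ : 0 < t₁ - τ := by linarith
  have hWx : (t₁ - τ) * G t₁ x ≤ W (s, y) := by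
    have := hmax hxmem
    simpa [hW, hφx x hx] using this
  have hgoal : W (s, y) ≤ n * α ^ 2 / 2 * (1 + (s - τ) * (E / R ^ 2)) → G t₁ x ≤
      n * α ^ 2 / 2 * (1 / (t₁ - τ) + E / R ^ 2) := by
    intro h
    have h1 : (s - τ) * (E / R ^ 2) ≤ (t₁ - τ) * (E / R ^ 2) := by
      gcongr
      exact hs.2
    have h2 : n * α ^ 2 / 2 * (1 + (s - τ) * (E / R ^ 2))
        ≤ n * α ^ 2 / 2 * (1 + (t₁ - τ) * (E / R ^ 2)) := by gcongr
    have h3 : n * α ^ 2 / 2 * (1 / (t₁ - τ) + E / R ^ 2)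
        = n * α ^ 2 / 2 * (1 + (t₁ - τ) * (E / R ^ 2)) / (t₁ - τ) := by
      field_simp
    rw [h3, le_div_iff₀ hσ₁]
    linarith
  apply hgoal
  have hs0 : 0 ≤ s - τ := sub_nonneg.2 hs.1
  rcases le_or_gt (W (s, y)) 0 with hneg | hWpos
  · exact hneg.trans (by positivity)
  have hWpos' : 0 < (s - τ) * (φ y * G s y) := hWpos
  have hσ : 0 < s - τ := pos_of_mul_pos_left hWpos' (by
    by_contra! h
    exact absurd hWpos' (not_lt.2 (mul_nonpos_of_nonneg_of_nonpos hs0 h.le)))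
  have hφG : 0 < φ y * G s y := pos_of_mul_pos_right hWpos' hs0
  have hGpos : 0 < G s y := pos_of_mul_pos_right hφG (hφ0 y)
  have hφpos : 0 < φ y := pos_of_mul_pos_left hφG hGpos.le
  have hyR : ‖y‖ < R := by
    by_contra! h
    exact hφpos.ne' (hφR y h)
  have hyball : y ∈ ball (0 : Euc n) R := mem_ball_zero_iff.2 hyR
  have hp : (s, y) ∈ Ioo 0 T ×ˢ ball (0 : Euc n) ρ := hsub ⟨hs, hy⟩
  obtain ⟨G₁, G₂, D, Gt, hjet, hGt, hboch, htr⟩ :=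
    bochner_liYau (by linarith : α ≠ 0) hU hP hQ hPU hQU hΩ hp (hpos _ hp.1 _ hp.2).ne'
  have hloc : IsLocalMax (fun z => φ z * G s z) y := by
    filter_upwards [isOpen_ball.mem_nhds hyball] with z hz
    have := hmax (show (s, z) ∈ Icc τ t₁ ×ˢ closedBall (0 : Euc n) R from
      ⟨hs, ball_subset_closedBall hz⟩)
    exact le_of_mul_le_mul_left this hσ
  have hj := fun i => (hφj y i).mul (hjet i)
  simp only [zero_smul, add_zero] at hj
  have hcrit : ∀ i, φ₁ i y * G s y + φ y * G₁ i = 0 := fun i => by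
    have hl : IsLocalMax (fun r : ℝ => φ (y + r • basisVec i) * G s (y + r • basisVec i)) 0 := by
      have hc : Tendsto (fun r : ℝ => y + r • basisVec i) (𝓝 0) (𝓝 y) := by
        have : ContinuousAt (fun r : ℝ => y + r • basisVec i) 0 := by fun_prop
        simpa using this.tendsto
      filter_upwards [hc.eventually hloc] with r hr
      simpa using hr
    exact hl.hasDerivAt_eq_zero (hj i).hasDerivAt
  have hlap : (∑ i, φ₂ i y) * G s y + 2 * ∑ i, φ₁ i y * G₁ i + φ y * ∑ i, G₂ i ≤ 0 := by
    have h1 : HasLapAt (fun z => φ z * G s z) y _ :=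
      ⟨_, fun i => (hj i).hasSecondLineDeriv (g := fun z => φ z * G s z), rfl⟩
    have h2 := h1.nonpos_of_isLocalMax hloc
    simpa only [Finset.sum_add_distrib, ← Finset.mul_sum, ← Finset.sum_mul] using h2
  have htime : 0 ≤ φ y * G s y + (s - τ) * (φ y * Gt) := by
    have h1 : HasDerivAt (fun t => (t - τ) * (φ y * G t y))
        (1 * (φ y * G s y) + (s - τ) * (φ y * Gt)) s :=
      ((hasDerivAt_id s).sub_const τ).mul (hGt.const_mul (φ y))
    rw [one_mul] at h1
    refine h1.nonneg_of_left_max (a := τ) (by linarith) fun t ht => ?_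
    exact hmax (show (t, y) ∈ Icc τ t₁ ×ˢ closedBall (0 : Euc n) R from
      ⟨⟨ht.1, ht.2.trans hs.2⟩, hy⟩)
  have key := gradient_bound_of_critical hn hα hφpos (hφ1 y) hGpos hσ hcrit hlap htime hboch htr
    (hφB y) (hφA y)
  have e : A / R ^ 2 + 2 * (B / R ^ 2) + n * α ^ 2 / (4 * (α - 1)) * (B / R ^ 2) = E / R ^ 2 := by
    rw [hE]; ring
  rw [e] at key
  simpa only [hW, mul_assoc] using key

section
variable {n : ℕ} {u : ℝ → Euc n → ℝ} {T R ε : ℝ} {ψ g : Euc n → ℝ}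

lemma ContDiffOn.pderiv {k : WithTop ℕ∞} {m : WithTop ℕ∞} {s : Set (Euc n)}
    (hg : ContDiffOn ℝ k g s) (hs : IsOpen s) (hmk : m + 1 ≤ k) (i : Fin n) :
    ContDiffOn ℝ m (pderiv i g) s :=
  (hg.fderiv_of_isOpen hs hmk).clm_apply contDiffOn_const

lemma IsTestIn.integral_pderiv_sub_mul (hψ : IsTestIn ε ψ) (hg : ContDiffOn ℝ 1 g (ball 0 R))
    {x : Euc n} (hx : ‖x‖ + ε < R) (i : Fin n) :
    ∫ y, _root_.pderiv i ψ (x - y) * g y = ∫ y, ψ (x - y) * _root_.pderiv i g y := by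
  have hd : ∀ y, HasFDerivAt (fun y => ψ (x - y)) (-fderiv ℝ ψ (x - y)) y := fun y => by
    have h1 : HasFDerivAt (fun y : Euc n => x - y) (-ContinuousLinearMap.id ℝ (Euc n)) y :=
      (hasFDerivAt_id y).const_sub x
    have h2 := (hψ.1.differentiable (x - y)).hasFDerivAt.comp y h1
    refine h2.congr_fderiv ?_
    ext z
    simp
  have e : ∀ y, fderiv ℝ (fun y => ψ (x - y)) y (basisVec i) = -_root_.pderiv i ψ (x - y) :=
    fun y => by rw [(hd y).fderiv]; rfl
  have hgc := (hg.pderiv (m := 0) isOpen_ball (by simp) i).continuousOn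
  have h := integral_mul_fderiv_eq_neg_fderiv_mul_of_integrable (μ := volume)
    (f := fun y => ψ (x - y)) (g := g) (v := basisVec i) ?_ ?_ ?_ ?_ ?_
  · simp only [e, neg_mul, integral_neg, neg_neg] at h
    exact h.symm
  · simp only [e, neg_mul]
    exact ((hψ.pderiv i).integrable_sub_mul hg.continuousOn hx).neg
  · exact hψ.integrable_sub_mul hgc hx
  · exact hψ.integrable_sub_mul hg.continuousOn hx
  · exact fun y _ => (hd y).differentiableAt
  · intro y hy
    have hy' : y ∈ closedBall (0 : Euc n) (‖x‖ + ε) := by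
      refine closure_minimal (fun z hz => ?_) isClosed_closedBall hy
      by_contra hcon
      rw [mem_closedBall_zero_iff, not_le] at hcon
      exact hz (hψ.eq_zero_sub hcon)
    exact (hg.differentiableOn (by simp)).differentiableAt
      (isOpen_ball.mem_nhds (closedBall_subset_ball hx hy'))

lemma isTestIn_normed (φ : ContDiffBump (0 : Euc n)) : IsTestIn φ.rOut (φ.normed volume) :=
  ⟨⟨φ.contDiff_normed, φ.hasCompactSupport_normed⟩, φ.tsupport_normed_eq.subset⟩

lemma tendsto_integral_bump_sub_mul {φ : ℕ → ContDiffBump (0 : Euc n)}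
    (hφ : Tendsto (fun k => (φ k).rOut) atTop (𝓝 0)) (hg : ContinuousOn g (ball 0 R)) {x : Euc n}
    (hx : x ∈ ball 0 R) :
    Tendsto (fun k => ∫ y, (φ k).normed volume (x - y) * g y) atTop (𝓝 (g x)) := by
  have hx' := mem_ball_zero_iff.1 hx
  set f := indicator (ball (0 : Euc n) R) g with hf
  have hfg : f =ᶠ[𝓝 x] g := by
    filter_upwards [isOpen_ball.mem_nhds hx] with y hy using indicator_of_mem hy g
  have hm : AEStronglyMeasurable f volume :=
    (aestronglyMeasurable_indicator_iff measurableSet_ball).2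
      (hg.aestronglyMeasurable measurableSet_ball)
  have hc : Tendsto f (𝓝 x) (𝓝 (g x)) :=
    (hg.continuousAt (isOpen_ball.mem_nhds hx)).tendsto.congr' hfg.symm
  have h := ContDiffBump.convolution_tendsto_right (μ := volume) (g := fun _ => f)
    (k := fun _ => x) hφ (Eventually.of_forall fun _ => hm) (hc.comp tendsto_snd)
    tendsto_const_nhds
  refine h.congr' ?_
  filter_upwards [hφ.eventually (gt_mem_nhds (show 0 < R - ‖x‖ by linarith))] with k hk
  rw [convolution_lsmul_swap]
  simp only [smul_eq_mul]
  obtain ⟨r, hr, hrR⟩ := exists_between (show ‖x‖ + (φ k).rOut < R by linarith)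
  refine (moll_congr_of_ball (u := fun _ => g) (t := 0) (isTestIn_normed (φ k)) hr.le
    fun y hy => ?_).symm
  exact indicator_of_mem (closedBall_subset_ball hrR hy) g

lemma moll_lap (hψ : IsTestIn ε ψ) {t : ℝ} (hc : ContinuousOn (u t) (ball 0 R)) {x : Euc n}
    (hx : ‖x‖ + ε < R) : moll u (lap ψ) t x = ∑ i, moll u (pderiv i (pderiv i ψ)) t x := by
  unfold moll
  rw [← integral_finsetSum _ fun i _ => ((hψ.pderiv i).pderiv i).integrable_sub_mul hc hx]
  simp only [lap_eq_sum_pderiv, Finset.sum_mul]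

lemma tendsto_liYau_moll {φ : ℕ → ContDiffBump (0 : Euc n)}
    (hφ : Tendsto (fun k => (φ k).rOut) atTop (𝓝 0)) {t : ℝ}
    (hu : ContDiffOn ℝ 2 (u t) (ball 0 R)) {x : Euc n} (hx : x ∈ ball 0 R) (h0 : u t x ≠ 0)
    (α : ℝ) :
    Tendsto (fun k => liYau α (moll u ((φ k).normed volume))
      (fun j => moll u (pderiv j ((φ k).normed volume))) (moll u (lap ((φ k).normed volume))) t x)
      atTop (𝓝 (∑ j, pderiv j (u t) x / u t x * (pderiv j (u t) x / u t x)
        - α * (lap (u t) x / u t x))) := by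
  have hx' := mem_ball_zero_iff.1 hx
  have hsmall : ∀ᶠ k in atTop, ‖x‖ + (φ k).rOut < R := by
    filter_upwards [hφ.eventually (gt_mem_nhds (show 0 < R - ‖x‖ by linarith))] with k hk
    linarith
  have hu1 : ContDiffOn ℝ 1 (u t) (ball 0 R) := hu.of_le (by norm_num)
  have hp1 : ∀ i, ContDiffOn ℝ 1 (pderiv i (u t)) (ball 0 R) :=
    hu.pderiv isOpen_ball (by norm_num)
  have hp2 : ∀ i, ContDiffOn ℝ 0 (pderiv i (pderiv i (u t))) (ball 0 R) :=
    fun i => (hp1 i).pderiv isOpen_ball (by simp) i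
  have h1 : Tendsto (fun k => moll u ((φ k).normed volume) t x) atTop (𝓝 (u t x)) :=
    tendsto_integral_bump_sub_mul hφ hu.continuousOn hx
  have h2 : ∀ i, Tendsto (fun k => moll u (pderiv i ((φ k).normed volume)) t x) atTop
      (𝓝 (pderiv i (u t) x)) := fun i => by
    refine (tendsto_integral_bump_sub_mul hφ (hp1 i).continuousOn hx).congr' ?_
    filter_upwards [hsmall] with k hk
    exact ((isTestIn_normed (φ k)).integral_pderiv_sub_mul hu1 hk i).symm
  have h3 : Tendsto (fun k => moll u (lap ((φ k).normed volume)) t x) atTop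
      (𝓝 (lap (u t) x)) := by
    rw [lap_eq_sum_pderiv]
    refine (tendsto_finsetSum _ fun i _ =>
      tendsto_integral_bump_sub_mul hφ (hp2 i).continuousOn hx).congr' ?_
    filter_upwards [hsmall] with k hk
    rw [moll_lap (isTestIn_normed (φ k)) hu.continuousOn hk]
    refine Finset.sum_congr rfl fun i _ => ?_
    rw [← (isTestIn_normed (φ k)).integral_pderiv_sub_mul (hp1 i) hk i,
      ← ((isTestIn_normed (φ k)).pderiv i).integral_pderiv_sub_mul hu1 hk i]
    rfl
  exact (tendsto_finsetSum _ fun i _ => ((h2 i).div h1 h0).mul ((h2 i).div h1 h0)).sub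
    ((h3.div h1 h0).const_mul α)

lemma LocSepSol.heatJet_moll (hn : 0 < n) (h : LocSepSol u T R) (hψ : IsTestIn ε ψ) :
    HeatJet (Ioo 0 T ×ˢ ball 0 (R - ε)) (moll u ψ) (fun i => moll u (pderiv i ψ))
      (fun i => moll u (pderiv i (pderiv i ψ))) := by
  have hx : ∀ {p : ℝ × Euc n}, p ∈ Ioo 0 T ×ˢ ball (0 : Euc n) (R - ε) → ‖p.2‖ + ε < R :=
    fun hp => by linarith [mem_ball_zero_iff.1 hp.2]
  refine ⟨fun p hp i => h.hasDerivAt_moll_line hψ hp.1 (hx hp) i,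
    fun p hp i => h.hasDerivAt_moll_line (hψ.pderiv i) hp.1 (hx hp) i, fun p hp => ?_⟩
  rw [← moll_lap hψ (h.continuousOn_space hp.1) (hx hp)]
  exact h.hasDerivAt_moll_time hn hψ hp.1 (hx hp)

lemma moll_pos (hψ : IsTestIn ε ψ) (hψ0 : ∀ z, 0 ≤ ψ z) (hψ1 : 0 < ψ 0) {t : ℝ}
    (hc : ContinuousOn (u t) (ball 0 R)) (hpos : ∀ y ∈ ball 0 R, 0 < u t y) (hε : 0 ≤ ε)
    {x : Euc n} (hx : ‖x‖ + ε < R) : 0 < moll u ψ t x := by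
  refine (hψ.continuous_sub_mul hc hx).integral_pos_of_hasCompactSupport_nonneg_nonzero (x := x)
    (hψ.hasCompactSupport_sub_mul _ x) (fun y => ?_) ?_
  · by_cases hy : ‖y‖ < R
    · exact mul_nonneg (hψ0 _) (hpos y (mem_ball_zero_iff.2 hy)).le
    · simp only [Pi.zero_apply]
      rw [hψ.eq_zero_sub (by linarith), zero_mul]
  · rw [sub_self]
    exact (mul_pos hψ1 (hpos x (mem_ball_zero_iff.2 (by linarith)))).ne'

lemma exists_liYau_moll_bound {n : ℕ} (hn : 0 < n) : ∃ A B : ℝ, 0 ≤ A ∧ 0 ≤ B ∧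
    ∀ {u : ℝ → Euc n → ℝ} {T R ε α t : ℝ} {ψ : Euc n → ℝ}, LocSepSol u T R →
      (∀ t ∈ Ioo 0 T, ∀ x ∈ ball (0 : Euc n) R, 0 < u t x) → IsTestIn ε ψ → (∀ z, 0 ≤ ψ z) →
      0 < ψ 0 → 0 ≤ ε → ε < R → 1 < α → t ∈ Ioo 0 T → ∀ x : Euc n, ‖x‖ < (R - ε) / 2 →
      liYau α (moll u ψ) (fun j => moll u (pderiv j ψ)) (moll u (lap ψ)) t x ≤
        n * α ^ 2 / 2 * (1 / t + (A + 2 * B + n * α ^ 2 / (4 * (α - 1)) * B) / (R - ε) ^ 2) := by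
  obtain ⟨A, B, hA, hB, H⟩ := exists_liYau_bound hn
  refine ⟨A, B, hA, hB, ?_⟩
  intro u T R ε α t ψ h hpos hψ hψ0 hψ1 hε hεR hα ht x hx
  set E := A + 2 * B + n * α ^ 2 / (4 * (α - 1)) * B
  have hlim : Tendsto (fun δ : ℝ => n * α ^ 2 / 2 * (1 / (t - δ) + E / (R - ε - δ) ^ 2)) (𝓝[>] 0)
      (𝓝 (n * α ^ 2 / 2 * (1 / t + E / (R - ε) ^ 2))) := by
    have hc : ContinuousAt (fun δ : ℝ => n * α ^ 2 / 2 * (1 / (t - δ) + E / (R - ε - δ) ^ 2)) 0 := by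
      have h1 : t - 0 ≠ 0 := by simpa using ht.1.ne'
      have h2 : (R - ε - 0) ^ 2 ≠ 0 := by
        rw [sub_zero]; exact pow_ne_zero 2 (sub_pos.2 hεR).ne'
      fun_prop (disch := assumption)
    have := hc.tendsto.mono_left (nhdsWithin_le_nhds (s := Ioi 0))
    simpa using this
  refine ge_of_tendsto hlim ?_
  have hδ : 0 < min t (R - ε - 2 * ‖x‖) := lt_min ht.1 (by linarith)
  filter_upwards [Ioo_mem_nhdsGT hδ] with δ hδ'
  have hδt := hδ'.2.trans_le (min_le_left _ _)
  have hδx := hδ'.2.trans_le (min_le_right _ _)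
  have hδ0 : 0 < δ := hδ'.1
  refine H (ρ := R - ε) (by linarith [norm_nonneg x]) (by linarith) hδ0 hδt ht.2 hα
    (h.heatJet_moll hn hψ) (fun j => h.heatJet_moll hn (hψ.pderiv j)) (h.heatJet_moll hn hψ.lap)
    (fun j => rfl) (fun p hp => ?_) (fun s hs y hy => ?_) (h.continuousOn_moll hn hψ)
    (fun j => h.continuousOn_moll hn (hψ.pderiv j)) (h.continuousOn_moll hn hψ.lap) x (by linarith)
  · exact moll_lap hψ (h.continuousOn_space hp.1) (by linarith [mem_ball_zero_iff.1 hp.2])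
  · exact moll_pos hψ hψ0 hψ1 (h.continuousOn_space hs) (hpos s hs) hε
      (by linarith [mem_ball_zero_iff.1 hy])

end

lemma ContDiffOn.exists_lipschitzOnWith_closedBall {n : ℕ} {g : Euc n → ℝ} {s : Set (Euc n)}
    (hg : ContDiffOn ℝ 1 g s) (hs : IsOpen s) {c : Euc n} {ρ : ℝ} (hc : closedBall c ρ ⊆ s) :
    ∃ k, LipschitzOnWith k g (closedBall c ρ) := by
  have hcont : ContinuousOn (fderiv ℝ g) (closedBall c ρ) :=
    (hg.continuousOn_fderiv_of_isOpen hs le_rfl).mono hc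
  obtain ⟨M, hM⟩ := (isCompact_closedBall c ρ).exists_bound_of_continuousOn hcont
  refine ⟨M.toNNReal, (convex_closedBall c ρ).lipschitzOnWith_of_nnnorm_fderiv_le
    (fun x hx => (hg.differentiableOn (by simp)).differentiableAt (hs.mem_nhds (hc hx)))
    fun x hx => ?_⟩
  exact NNReal.le_toNNReal_of_coe_le (hM x hx)

section
variable {n : ℕ} {u : ℝ → Euc n → ℝ} {T R : ℝ}

lemma locSepSol_of_contDiffOn
    (hpos : ∀ t ∈ Ioo 0 T, ∀ x ∈ ball (0 : Euc n) R, 0 < u t x)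
    (hspace : ∀ t ∈ Ioo 0 T, ContDiffOn ℝ 2 (u t) (ball 0 R))
    (htime : ∀ t ∈ Ioo 0 T, ∀ x ∈ ball (0 : Euc n) R,
      HasDerivAt (fun τ => u τ x) (lap (u t) x) t) : LocSepSol u T R := by
  intro a b c ρ ha hb hcρ
  have hsub : closedBall c ρ ⊆ ball (0 : Euc n) R := fun x hx => by
    rw [mem_ball_zero_iff]
    rw [mem_closedBall_iff_norm] at hx
    have := norm_sub_norm_le x c
    linarith
  have hI : ∀ {t}, t ∈ Icc a b → t ∈ Ioo 0 T := fun ht => ⟨ha.trans_le ht.1, ht.2.trans_lt hb⟩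
  refine ⟨fun t ht x hx => (hpos t (hI ht) x (hsub hx)).le, fun t ht => ?_, fun x hx t ht => ?_,
    fun t ht x hx => ⟨_, htime t (hI (Ioc_subset_Icc_self ht)) x (hsub (ball_subset_closedBall hx)),
      ?_⟩⟩
  · exact ((hspace t (hI ht)).of_le (by norm_num)).exists_lipschitzOnWith_closedBall isOpen_ball hsub
  · exact (htime t (hI ht) x (hsub hx)).continuousAt.continuousWithinAt
  · exact ((hspace t (hI (Ioc_subset_Icc_self ht))).contDiffAt
      (isOpen_ball.mem_nhds (hsub (ball_subset_closedBall hx)))).hasLapAt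

lemma norm_gradient_sq (g : Euc n → ℝ) (x : Euc n) :
    ‖gradient g x‖ ^ 2 = ∑ i, pderiv i g x ^ 2 := by
  rw [EuclideanSpace.norm_sq_eq]
  refine Finset.sum_congr rfl fun i _ => ?_
  have h : inner ℝ (gradient g x) (basisVec i) = pderiv i g x := inner_gradient_left
  rw [← h, EuclideanSpace.inner_single_right]
  simp

/-- Passing from estimates for mollifications to pointwise estimates. -/
lemma liYau_le_of_moll {t α c : ℝ} {b : ℝ → ℝ} (hR : 0 < R)
    (hu : ContDiffOn ℝ 2 (u t) (ball 0 R)) (hpos : ∀ x ∈ ball (0 : Euc n) R, 0 < u t x)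
    (hb : Tendsto b (𝓝 0) (𝓝 c))
    (H : ∀ (φ : ContDiffBump (0 : Euc n)) (x : Euc n), ‖x‖ + φ.rOut < R / 2 →
      liYau α (moll u (φ.normed volume)) (fun j => moll u (pderiv j (φ.normed volume)))
        (moll u (lap (φ.normed volume))) t x ≤ b φ.rOut)
    {x : Euc n} (hx : x ∈ closedBall 0 (R / 2)) :
    ∑ j, pderiv j (u t) x / u t x * (pderiv j (u t) x / u t x) - α * (lap (u t) x / u t x) ≤ c := by
  have hsub : closedBall (0 : Euc n) (R / 2) ⊆ ball 0 R := closedBall_subset_ball (by linarith)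
  have hinner : ∀ y ∈ ball (0 : Euc n) (R / 2),
      ∑ j, pderiv j (u t) y / u t y * (pderiv j (u t) y / u t y) - α * (lap (u t) y / u t y)
        ≤ c := by
    intro y hy
    have hyR := hsub (ball_subset_closedBall hy)
    let φ : ℕ → ContDiffBump (0 : Euc n) := fun k =>
      ⟨1 / ((k : ℝ) + 1) / 2, 1 / ((k : ℝ) + 1), by positivity, half_lt_self (by positivity)⟩
    have hφ : Tendsto (fun k => (φ k).rOut) atTop (𝓝 0) := tendsto_one_div_add_atTop_nhds_zero_nat
    refine le_of_tendsto_of_tendsto (tendsto_liYau_moll hφ hu hyR (hpos y hyR).ne' α)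
      (hb.comp hφ) ?_
    have hy' := mem_ball_zero_iff.1 hy
    filter_upwards [hφ.eventually (gt_mem_nhds (show 0 < R / 2 - ‖y‖ by linarith))] with k hk
    exact H (φ k) y (by linarith)
  have hp1 : ∀ i, ContDiffOn ℝ 1 (pderiv i (u t)) (ball 0 R) :=
    hu.pderiv isOpen_ball (by norm_num)
  have hne : ∀ y ∈ ball (0 : Euc n) R, u t y ≠ 0 := fun y hy => (hpos y hy).ne'
  have hlap : ContinuousOn (lap (u t)) (ball 0 R) :=
    continuousOn_finsetSum _ fun i _ =>
      ((hp1 i).pderiv (m := 0) isOpen_ball (by simp) i).continuousOn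
  have hcont : ContinuousOn (fun y => ∑ j, pderiv j (u t) y / u t y * (pderiv j (u t) y / u t y)
      - α * (lap (u t) y / u t y)) (ball 0 R) :=
    (continuousOn_finsetSum _ fun i _ => ((hp1 i).continuousOn.div hu.continuousOn hne).mul
      ((hp1 i).continuousOn.div hu.continuousOn hne)).sub
      (continuousOn_const.mul (hlap.div hu.continuousOn hne))
  have hxc : x ∈ closure (ball (0 : Euc n) (R / 2)) := by
    rwa [closure_ball _ (by linarith : R / 2 ≠ 0)]
  have : (𝓝[ball (0 : Euc n) (R / 2)] x).NeBot := mem_closure_iff_nhdsWithin_neBot.1 hxc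
  refine le_of_tendsto ((hcont.continuousAt (isOpen_ball.mem_nhds (hsub hx))).tendsto.mono_left
    (nhdsWithin_le_nhds (s := ball 0 (R / 2)))) ?_
  filter_upwards [self_mem_nhdsWithin] with y hy using hinner y hy

lemma le_exp_mul_of_lap_ge {c : ℝ} (hc : 0 ≤ c) {a : ℝ} (ha : 0 < a) {x : Euc n}
    (hcont : ContinuousOn (fun t => u t x) (Icc 0 T)) (hT : 0 ≤ u T x)
    (htime : ∀ t ∈ Ioo a T, HasDerivAt (fun τ => u τ x) (lap (u t) x) t)
    (hlow : ∀ t ∈ Ioo a T, -(c * u t x) ≤ lap (u t) x) {t : ℝ} (ht : t ∈ Icc a T) :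
    u t x ≤ exp (c * (T - a)) * u T x := by
  have hd : ∀ s ∈ Ioo a T, HasDerivAt (fun s => exp (c * s) * u s x)
      (exp (c * s) * c * u s x + exp (c * s) * lap (u s) x) s := fun s hs => by
    have h1 : HasDerivAt (fun s : ℝ => exp (c * s)) (exp (c * s) * c) s := by
      simpa using ((hasDerivAt_id s).const_mul c).exp
    exact h1.mul (htime s hs)
  have hmono : MonotoneOn (fun s => exp (c * s) * u s x) (Icc a T) := by
    refine monotoneOn_of_deriv_nonneg (convex_Icc a T) ?_ ?_ ?_
    · exact (Continuous.continuousOn (by fun_prop)).mul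
        (hcont.mono (Icc_subset_Icc_left ha.le))
    · rw [interior_Icc]
      exact fun s hs => (hd s hs).differentiableAt.differentiableWithinAt
    · rw [interior_Icc]
      intro s hs
      rw [(hd s hs).deriv]
      have := mul_nonneg (exp_pos (c * s)).le (by linarith [hlow s hs] : 0 ≤ c * u s x + lap (u s) x)
      linarith
  have h1 : exp (c * t) * u t x ≤ exp (c * T) * u T x :=
    hmono ht (right_mem_Icc.2 (ht.1.trans ht.2)) ht.2
  have h2 : u t x ≤ exp (c * (T - t)) * u T x := by
    have e : exp (c * T) = exp (c * t) * exp (c * (T - t)) := by rw [← exp_add]; ring_nf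
    rw [e, mul_assoc] at h1
    exact le_of_mul_le_mul_left h1 (exp_pos _)
  refine h2.trans ?_
  gcongr
  exact ht.1

lemma tendsto_moll_left {ε r a K : ℝ} {ψ : Euc n → ℝ} (h : LocSepSol u T R) (hrR : r ≤ R)
    (ha : 0 ≤ a) (haT : a < T) (hψ : IsTestIn ε ψ) {x : Euc n} (hx : ‖x‖ + ε < r)
    (hT : ContinuousOn (u T) (ball 0 R))
    (hlim : ∀ y ∈ ball (0 : Euc n) r, Tendsto (fun t => u t y) (𝓝[<] T) (𝓝 (u T y)))
    (hdom : ∀ t ∈ Ioo a T, ∀ y ∈ ball (0 : Euc n) r, u t y ≤ K * u T y) :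
    Tendsto (fun t => moll u ψ t x) (𝓝[<] T) (𝓝 (moll u ψ T x)) := by
  have hmem : Ioo a T ∈ 𝓝[<] T := Ioo_mem_nhdsLT haT
  refine tendsto_integral_filter_of_dominated_convergence
    (fun y => |K| * |ψ (x - y) * u T y|) ?_ ?_ ?_ ?_
  · filter_upwards [hmem] with t ht
    exact (h.continuous_moll_integrand hψ ⟨ha.trans_lt ht.1, ht.2⟩
      (hx.trans_le hrR)).aestronglyMeasurable
  · filter_upwards [hmem] with t ht
    refine Eventually.of_forall fun y => ?_
    by_cases hy : ‖y‖ < r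
    · have h0 := h.nonneg ⟨ha.trans_lt ht.1, ht.2⟩ (hy.trans_le hrR)
      have h1 := hdom t ht y (mem_ball_zero_iff.2 hy)
      rw [Real.norm_eq_abs, abs_mul, abs_mul, abs_of_nonneg h0, mul_left_comm, ← abs_mul]
      gcongr
      exact h1.trans (le_abs_self _)
    · rw [hψ.eq_zero_sub (by linarith)]
      simp
  · exact (hψ.integrable_sub_mul hT (hx.trans_le hrR)).abs.const_mul _
  · refine Eventually.of_forall fun y => ?_
    by_cases hy : ‖y‖ < r
    · exact (hlim y (mem_ball_zero_iff.2 hy)).const_mul _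
    · rw [hψ.eq_zero_sub (by linarith)]
      simp

lemma tendsto_liYau_of_tendsto {ι : Type*} {l : Filter ι} {α : ℝ} {U Q : ℝ → Euc n → ℝ}
    {P : Fin n → ℝ → Euc n → ℝ} {s : ι → ℝ} {t : ℝ} {x : Euc n}
    (hU : Tendsto (fun k => U (s k) x) l (𝓝 (U t x)))
    (hP : ∀ j, Tendsto (fun k => P j (s k) x) l (𝓝 (P j t x)))
    (hQ : Tendsto (fun k => Q (s k) x) l (𝓝 (Q t x))) (h0 : U t x ≠ 0) :
    Tendsto (fun k => liYau α U P Q (s k) x) l (𝓝 (liYau α U P Q t x)) :=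
  (tendsto_finsetSum _ fun i _ => ((hP i).div hU h0).mul ((hP i).div hU h0)).sub
    ((hQ.div hU h0).const_mul α)

lemma exists_pointwise_bound {n : ℕ} (hn : 0 < n) : ∃ A B : ℝ, 0 ≤ A ∧ 0 ≤ B ∧
    ∀ {u : ℝ → Euc n → ℝ} {T R α : ℝ}, 0 < T → 0 < R → 1 < α →
      (∀ t ∈ Ioc 0 T, ∀ x ∈ ball (0 : Euc n) R, 0 < u t x) →
      (∀ t ∈ Ioc 0 T, ContDiffOn ℝ 2 (u t) (ball 0 R)) →
      (∀ t ∈ Ioo 0 T, ∀ x ∈ ball (0 : Euc n) R, HasDerivAt (fun τ => u τ x) (lap (u t) x) t) →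
      (∀ x ∈ ball (0 : Euc n) R, ContinuousOn (fun t => u t x) (Icc 0 T)) →
      ∀ t ∈ Ioc 0 T, ∀ x ∈ closedBall (0 : Euc n) (R / 2),
        ∑ j, pderiv j (u t) x / u t x * (pderiv j (u t) x / u t x) - α * (lap (u t) x / u t x) ≤
          n * α ^ 2 / 2 * (1 / t + (A + 2 * B + n * α ^ 2 / (4 * (α - 1)) * B) / R ^ 2) := by
  obtain ⟨A, B, hA, hB, H⟩ := exists_liYau_moll_bound hn
  refine ⟨A, B, hA, hB, ?_⟩
  intro u T R α hT hR hα hpos hspace htime hcont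
  have hpos' : ∀ t ∈ Ioo 0 T, ∀ x ∈ ball (0 : Euc n) R, 0 < u t x :=
    fun t ht => hpos t (Ioo_subset_Ioc_self ht)
  have hsol : LocSepSol u T R :=
    locSepSol_of_contDiffOn hpos' (fun t ht => hspace t (Ioo_subset_Ioc_self ht)) htime
  have hα1 : 0 < α - 1 := by linarith
  set E := A + 2 * B + n * α ^ 2 / (4 * (α - 1)) * B with hE
  have hE0 : 0 ≤ E := by positivity
  have hblim : ∀ t, Tendsto (fun ε : ℝ => n * α ^ 2 / 2 * (1 / t + E / (R - ε) ^ 2)) (𝓝 0)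
      (𝓝 (n * α ^ 2 / 2 * (1 / t + E / R ^ 2))) := fun t => by
    have hc : ContinuousAt (fun ε : ℝ => n * α ^ 2 / 2 * (1 / t + E / (R - ε) ^ 2)) 0 := by
      have h2 : (R - 0) ^ 2 ≠ 0 := by rw [sub_zero]; positivity
      fun_prop (disch := assumption)
    simpa using hc.tendsto
  have hmoll : ∀ t ∈ Ioo 0 T, ∀ (φ : ContDiffBump (0 : Euc n)) (x : Euc n),
      ‖x‖ + φ.rOut < R / 2 →
      liYau α (moll u (φ.normed volume)) (fun j => moll u (pderiv j (φ.normed volume)))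
        (moll u (lap (φ.normed volume))) t x ≤ n * α ^ 2 / 2 * (1 / t + E / (R - φ.rOut) ^ 2) := by
    intro t ht φ x hx
    have hφ := φ.rOut_pos
    have hx0 := norm_nonneg x
    refine H hsol hpos' (isTestIn_normed φ) φ.nonneg_normed ?_ hφ.le (by linarith) hα ht x
      (by linarith)
    refine lt_of_le_of_ne (φ.nonneg_normed 0) (Ne.symm ?_)
    rw [← Function.mem_support, φ.support_normed_eq]
    exact mem_ball_self hφ
  have hinner : ∀ t ∈ Ioo 0 T, ∀ x ∈ closedBall (0 : Euc n) (R / 2),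
      ∑ j, pderiv j (u t) x / u t x * (pderiv j (u t) x / u t x) - α * (lap (u t) x / u t x) ≤
        n * α ^ 2 / 2 * (1 / t + E / R ^ 2) := fun t ht x hx =>
    liYau_le_of_moll hR (hspace t (Ioo_subset_Ioc_self ht)) (hpos' t ht) (hblim t) (hmoll t ht) hx
  intro t ht
  rcases lt_or_eq_of_le ht.2 with htT | rfl
  · exact hinner t ⟨ht.1, htT⟩
  have hsub : ball (0 : Euc n) (R / 2) ⊆ ball 0 R := ball_subset_ball (by linarith)
  set c := n * α ^ 2 / 2 * (1 / (t / 2) + E / R ^ 2) with hc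
  have hc0 : 0 ≤ c := by positivity
  have hlow : ∀ s ∈ Ioo (t / 2) t, ∀ x ∈ ball (0 : Euc n) (R / 2), -(c * u s x) ≤ lap (u s) x := by
    intro s hs x hx
    have hs' : s ∈ Ioo 0 t := ⟨by linarith [hs.1], hs.2⟩
    have h1 := hinner s hs' x (ball_subset_closedBall hx)
    have hus := hpos' s hs' x (hsub hx)
    have h2 : 0 ≤ ∑ j, pderiv j (u s) x / u s x * (pderiv j (u s) x / u s x) :=
      Finset.sum_nonneg fun _ _ => mul_self_nonneg _
    have h3 : n * α ^ 2 / 2 * (1 / s + E / R ^ 2) ≤ c := by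
      rw [hc]
      have := hs.1.le
      gcongr
    have h4 : -c ≤ α * (lap (u s) x / u s x) := by linarith
    by_contra! hcon
    have h5 : lap (u s) x / u s x < -c := by
      rw [div_lt_iff₀ hus]; linarith
    nlinarith
  have hdom : ∀ s ∈ Ioo (t / 2) t, ∀ x ∈ ball (0 : Euc n) (R / 2),
      u s x ≤ exp (c * (t - t / 2)) * u t x := fun s hs x hx =>
    le_exp_mul_of_lap_ge hc0 (by linarith) (hcont x (hsub hx)) (hpos t ht x (hsub hx)).le
      (fun q hq => htime q ⟨by linarith [hq.1], hq.2⟩ x (hsub hx)) (fun q hq => hlow q hq x hx)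
      (Ioo_subset_Icc_self hs)
  have hlim : ∀ y ∈ ball (0 : Euc n) (R / 2),
      Tendsto (fun s => u s y) (𝓝[<] t) (𝓝 (u t y)) := fun y hy =>
    (hcont y (hsub hy) t ⟨hT.le, le_rfl⟩).tendsto.mono_left
      (nhdsWithin_le_of_mem (mem_of_superset (Ioo_mem_nhdsLT hT) Ioo_subset_Icc_self))
  intro x hx
  refine liYau_le_of_moll hR (hspace t ht) (hpos t ht) (hblim t) (fun φ y hy => ?_) hx
  have hφ := isTestIn_normed φ
  have hcT := (hspace t ht).continuousOn
  have htend : ∀ {ψ : Euc n → ℝ}, IsTestIn φ.rOut ψ →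
      Tendsto (fun s => moll u ψ s y) (𝓝[<] t) (𝓝 (moll u ψ t y)) := fun hψ =>
    tendsto_moll_left hsol (by linarith) (by linarith) (by linarith) hψ hy hcT hlim hdom
  have hpt : 0 < moll u (φ.normed volume) t y := by
    refine moll_pos hφ φ.nonneg_normed ?_ hcT (hpos t ht) φ.rOut_pos.le (by linarith)
    refine lt_of_le_of_ne (φ.nonneg_normed 0) (Ne.symm ?_)
    rw [← Function.mem_support, φ.support_normed_eq]
    exact mem_ball_self φ.rOut_pos
  have hlhs := tendsto_liYau_of_tendsto (α := α) (s := fun s => s) (t := t)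
    (P := fun j => moll u (pderiv j (φ.normed volume))) (htend hφ)
    (fun j => htend (hφ.pderiv j)) (htend hφ.lap) hpt.ne'
  have hrhs : Tendsto (fun s : ℝ => n * α ^ 2 / 2 * (1 / s + E / (R - φ.rOut) ^ 2)) (𝓝[<] t)
      (𝓝 (n * α ^ 2 / 2 * (1 / t + E / (R - φ.rOut) ^ 2))) := by
    have hne := hT.ne'
    have hca : ContinuousAt (fun s : ℝ => n * α ^ 2 / 2 * (1 / s + E / (R - φ.rOut) ^ 2)) t := by
      fun_prop (disch := assumption)
    exact hca.tendsto.mono_left nhdsWithin_le_nhds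
  refine le_of_tendsto_of_tendsto hlhs hrhs ?_
  filter_upwards [Ioo_mem_nhdsLT hT] with s hs using hmoll s hs φ y hy

end

/-- Li–Yau-type gradient estimate for the heat equation
(paper's Theorem 10). There is `C = C(n) > 0` such that every positive solution `u` of
`∂ₜu = Δu` on `(0,T] × B̄_R` satisfies, for `α > 1` and `(t,x) ∈ (0,T] × B̄_{R/2}`:
`‖∇u‖²/u² - α ∂ₜu/u ≤ nα²/(2t) + (Cα²/R²)(1 + α²/(α-1))`. -/
theorem heat_gradient_estimate (n : ℕ) (hn : 0 < n) :
    ∃ C : ℝ, 0 < C ∧ ∀ R T : ℝ, 0 < R → 0 < T →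
      ∀ u : ℝ → EuclideanSpace ℝ (Fin n) → ℝ,
        (∀ t ∈ Set.Icc (0 : ℝ) T,
          ∀ x ∈ Metric.closedBall (0 : EuclideanSpace ℝ (Fin n)) R, 0 < u t x) →
        (∀ t ∈ Set.Icc (0 : ℝ) T,
          ContDiffOn ℝ 2 (u t) (Metric.closedBall (0 : EuclideanSpace ℝ (Fin n)) R)) →
        (∀ x ∈ Metric.closedBall (0 : EuclideanSpace ℝ (Fin n)) R,
          ContDiffOn ℝ 1 (fun t => u t x) (Set.Icc (0 : ℝ) T)) →
        (∀ t ∈ Set.Ioc (0 : ℝ) T,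
          ∀ x ∈ Metric.closedBall (0 : EuclideanSpace ℝ (Fin n)) R,
            deriv (fun τ => u τ x) t = lap (u t) x) →
        ∀ α : ℝ, 1 < α → ∀ t ∈ Set.Ioc (0 : ℝ) T,
          ∀ x ∈ Metric.closedBall (0 : EuclideanSpace ℝ (Fin n)) (R / 2),
            ‖gradient (u t) x‖ ^ 2 / (u t x) ^ 2
                - α * deriv (fun τ => u τ x) t / u t x
              ≤ (n : ℝ) * α ^ 2 / (2 * t) + C * α ^ 2 / R ^ 2 * (1 + α ^ 2 / (α - 1)) := by
  obtain ⟨A, B, hA, hB, H⟩ := exists_pointwise_bound hn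
  refine ⟨n / 2 * (A + 2 * B + n * B / 4) + 1, by positivity, ?_⟩
  intro R T hR hT u hpos hspace htime hheat α hα t ht x hx
  have hsub : ball (0 : Euc n) R ⊆ closedBall 0 R := ball_subset_closedBall
  have hxR : x ∈ closedBall (0 : Euc n) R := closedBall_subset_closedBall (by linarith) hx
  have hIcc : ∀ {s}, s ∈ Ioc 0 T → s ∈ Icc 0 T := fun hs => Ioc_subset_Icc_self hs
  have key := H hT hR hα (fun s hs y hy => hpos s (hIcc hs) y (hsub hy))
    (fun s hs => (hspace s (hIcc hs)).mono hsub)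
    (fun s hs y hy => by
      rw [← hheat s (Ioo_subset_Ioc_self hs) y (hsub hy)]
      exact (((htime y (hsub hy)).differentiableOn (by simp)).differentiableAt
        (Icc_mem_nhds hs.1 hs.2)).hasDerivAt)
    (fun y hy => (htime y (hsub hy)).continuousOn) t ht x hx
  have hα1 : 0 < α - 1 := by linarith
  have ht0 := ht.1
  rw [hheat t ht x hxR, norm_gradient_sq, Finset.sum_div, mul_div_assoc]
  have e1 : ∑ i, pderiv i (u t) x ^ 2 / u t x ^ 2
      = ∑ j, pderiv j (u t) x / u t x * (pderiv j (u t) x / u t x) :=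
    Finset.sum_congr rfl fun i _ => by ring
  rw [e1]
  refine key.trans ?_
  have hs : 0 ≤ α ^ 2 / (α - 1) := by positivity
  have e2 : n * α ^ 2 / 2 * (1 / t + (A + 2 * B + n * α ^ 2 / (4 * (α - 1)) * B) / R ^ 2)
      = n * α ^ 2 / (2 * t)
        + (n / 2 * (A + 2 * B + n * B / 4 * (α ^ 2 / (α - 1)))) * (α ^ 2 / R ^ 2) := by
    field_simp
  have e3 : (n / 2 * (A + 2 * B + n * B / 4) + 1) * α ^ 2 / R ^ 2 * (1 + α ^ 2 / (α - 1))
      = ((n / 2 * (A + 2 * B + n * B / 4) + 1) * (1 + α ^ 2 / (α - 1))) * (α ^ 2 / R ^ 2) := by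
    ring
  have h3 : (n : ℝ) / 2 * (A + 2 * B + n * B / 4 * (α ^ 2 / (α - 1)))
      ≤ (n / 2 * (A + 2 * B + n * B / 4) + 1) * (1 + α ^ 2 / (α - 1)) := by
    generalize α ^ 2 / (α - 1) = s at hs ⊢
    have h1 : 0 ≤ (n : ℝ) / 2 * (A + 2 * B) * s := by positivity
    have h2 : 0 ≤ (n : ℝ) / 2 * (n * B / 4) := by positivity
    linarith
  rw [e2, e3]
  exact add_le_add_right (mul_le_mul_of_nonneg_right h3 (by positivity)) _
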